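/- Let n ≥ 2 and let ℒ_q be the B_{n+1}-module ℚ[q^{±1}] on which every standard generator σ_i acts by multiplication by −q. For every integer i ≥ 1 with 0 ≤ n−2(i−1) ≤ n, the group cohomology in even complementary degree satisfies: H^{n−2(i−1)}(B_{n+1}; ℒ_q) ≅ ℚ[q]/(φ_h) as ℚ[q^{±1}]-modules if n+1 = i·h for an integer h, and H^{n−2(i−1)}(B_{n+1}; ℒ_q) = 0 if i does not divide n+1. In particular H^n(B_{n+1}; ℒ_q) ≅ ℚ[q]/(φ_{n+1}). -/

import Mathlib

/-!
STATEMENT 15: For n ≥ 2 and i ≥ 1 with 0 ≤ n−2(i−1) ≤ n, the cohomology of the braid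
group B_{n+1} with coefficients in ℒ_q = ℚ[q^{±1}] (each standard generator acting by
multiplication by −q) satisfies: H^{n−2(i−1)}(B_{n+1}; ℒ_q) ≅ ℚ[q]/(φ_h) if n+1 = i·h,
and H^{n−2(i−1)}(B_{n+1}; ℒ_q) = 0 if i ∤ n+1.  In particular
H^n(B_{n+1}; ℒ_q) ≅ ℚ[q]/(φ_{n+1}).
-/

open Polynomial

/-- The alternating word `s t s t ⋯` with `m` factors, as an element of the free group. -/
def braidWord {B : Type*} (s t : B) (m : ℕ) : FreeGroup B :=
  ((List.range m).map (fun i => if i % 2 = 0 then FreeGroup.of s else FreeGroup.of t)).prod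

/-- The Artin relations associated to a Coxeter matrix `M`. -/
def artinRels {B : Type*} (M : CoxeterMatrix B) : Set (FreeGroup B) :=
  {r | ∃ s t : B, s ≠ t ∧ M s t ≠ 0 ∧ r = braidWord s t (M s t) * (braidWord t s (M s t))⁻¹}

/-- The Artin group associated to a Coxeter matrix `M`. -/
def ArtinGroup {B : Type*} (M : CoxeterMatrix B) : Type _ := PresentedGroup (artinRels M)

instance {B : Type*} (M : CoxeterMatrix B) : Group (ArtinGroup M) :=
  QuotientGroup.Quotient.group _

/-- The standard generator `g_s` of the Artin group. -/
def artinGen {B : Type*} (M : CoxeterMatrix B) (s : B) : ArtinGroup M :=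
  PresentedGroup.of s

/-- The braid group on `n` strands: the Artin group of type A_{n−1}. -/
def BraidGroup (n : ℕ) : Type := ArtinGroup (CoxeterMatrix.Aₙ (n - 1))

instance (n : ℕ) : Group (BraidGroup n) :=
  inferInstanceAs (Group (ArtinGroup (CoxeterMatrix.Aₙ (n - 1))))

/-- The standard generator `σ_i` of the braid group. -/
def braidGen (n : ℕ) (i : Fin (n - 1)) : BraidGroup n := artinGen (CoxeterMatrix.Aₙ (n - 1)) i

/-- The defining relations of the positive Artin monoid of a simply laced Coxeter graph. -/
inductive ArtinMonoidRel {I : Type*} (Γ : SimpleGraph I) :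
    FreeMonoid I → FreeMonoid I → Prop
  | comm {s t : I} (hne : s ≠ t) (h : ¬ Γ.Adj s t) :
      ArtinMonoidRel Γ (.of s * .of t) (.of t * .of s)
  | braid {s t : I} (h : Γ.Adj s t) :
      ArtinMonoidRel Γ (.of s * .of t * .of s) (.of t * .of s * .of t)

/-- The positive Artin monoid of a simply laced Coxeter graph. -/
abbrev ArtinMonoid {I : Type*} (Γ : SimpleGraph I) : Type _ := (conGen (ArtinMonoidRel Γ)).Quotient

namespace ArtinMonoid

variable {I : Type*} {Γ : SimpleGraph I}

variable (Γ) in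
/-- The standard generators of the positive Artin monoid. -/
def gen (s : I) : ArtinMonoid Γ := (conGen (ArtinMonoidRel Γ)).mk' (.of s)

theorem gen_comm {s t : I} (hne : s ≠ t) (h : ¬ Γ.Adj s t) : gen Γ s * gen Γ t = gen Γ t * gen Γ s :=
  (Con.eq _).2 (ConGen.Rel.of _ _ (.comm hne h))

theorem gen_braid {s t : I} (h : Γ.Adj s t) :
    gen Γ s * gen Γ t * gen Γ s = gen Γ t * gen Γ s * gen Γ t :=
  (Con.eq _).2 (ConGen.Rel.of _ _ (.braid h))

theorem gen_comm_mul {s t : I} (hne : s ≠ t) (h : ¬ Γ.Adj s t) (c : ArtinMonoid Γ) :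
    gen Γ s * (gen Γ t * c) = gen Γ t * (gen Γ s * c) := by
  rw [← mul_assoc, gen_comm hne h, mul_assoc]

theorem gen_braid_mul {s t : I} (h : Γ.Adj s t) (c : ArtinMonoid Γ) :
    gen Γ s * (gen Γ t * (gen Γ s * c)) = gen Γ t * (gen Γ s * (gen Γ t * c)) := by
  simp only [← mul_assoc, gen_braid h]

/-- The homomorphism out of the positive Artin monoid determined by elements satisfying the
defining relations. -/
def lift {M : Type*} [Monoid M] (f : I → M)
    (hcomm : ∀ s t, s ≠ t → ¬ Γ.Adj s t → f s * f t = f t * f s)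
    (hbraid : ∀ s t, Γ.Adj s t → f s * f t * f s = f t * f s * f t) : ArtinMonoid Γ →* M :=
  (conGen (ArtinMonoidRel Γ)).lift (FreeMonoid.lift f) (Con.conGen_le.2 fun x y h => by
    cases h with
    | comm hne h => simpa [Con.ker_rel] using hcomm _ _ hne h
    | braid h => simpa [Con.ker_rel] using hbraid _ _ h)

@[simp]
theorem lift_gen {M : Type*} [Monoid M] (f : I → M) (hcomm hbraid) (s : I) :
    lift (Γ := Γ) f hcomm hbraid (gen Γ s) = f s := by
  simp [lift, gen]

@[elab_as_elim]
theorem induction_on {p : ArtinMonoid Γ → Prop} (a : ArtinMonoid Γ) (one : p 1)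
    (gen_mul : ∀ s a, p a → p (gen Γ s * a)) : p a := by
  induction a using Con.induction_on with
  | H w =>
    induction w using FreeMonoid.inductionOn' with
    | one => exact one
    | of_mul s w ih => exact gen_mul s _ ih

/-- The word length. -/
def lengthHom : ArtinMonoid Γ →* Multiplicative ℕ :=
  lift (fun _ => .ofAdd 1) (fun _ _ _ _ => rfl) (fun _ _ _ => rfl)

/-- The word length. -/
def length (a : ArtinMonoid Γ) : ℕ := (lengthHom a).toAdd

@[simp] theorem length_one : length (1 : ArtinMonoid Γ) = 0 := by simp [length]

@[simp] theorem length_mul (a b : ArtinMonoid Γ) : length (a * b) = length a + length b := by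
  simp [length]

@[simp] theorem length_gen (s : I) : length (gen Γ s) = 1 := by simp [length, lengthHom]

/-- The elements `a` and `b` complete `s` and `t` to multiples of their least common multiple. -/
inductive Cofactor (Γ : SimpleGraph I) : I → I → ArtinMonoid Γ → ArtinMonoid Γ → Prop
  | refl (s : I) (c) : Cofactor Γ s s c c
  | comm {s t : I} (hne : s ≠ t) (h : ¬ Γ.Adj s t) (c) : Cofactor Γ s t (gen Γ t * c) (gen Γ s * c)
  | braid {s t : I} (h : Γ.Adj s t) (c) :
      Cofactor Γ s t (gen Γ t * (gen Γ s * c)) (gen Γ s * (gen Γ t * c))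

theorem Cofactor.symm {s t : I} {a b : ArtinMonoid Γ} (h : Cofactor Γ s t a b) :
    Cofactor Γ t s b a := by
  cases h with
  | refl c => exact .refl _ _
  | comm hne h c => exact .comm hne.symm (fun h' => h h'.symm) c
  | braid h c => exact .braid h.symm c

theorem Cofactor.mul_right {s t : I} {a b : ArtinMonoid Γ} (h : Cofactor Γ s t a b)
    (d : ArtinMonoid Γ) : Cofactor Γ s t (a * d) (b * d) := by
  cases h with
  | refl c => exact .refl _ _
  | comm hne h c => simpa [mul_assoc] using Cofactor.comm hne h (c * d)
  | braid h c => simpa [mul_assoc] using Cofactor.braid h (c * d)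

theorem Cofactor.of_eq {s t : I} {a b a' b' : ArtinMonoid Γ} (h : Cofactor Γ s t a b)
    (ha : a' = a) (hb : b' = b) : Cofactor Γ s t a' b' := ha ▸ hb ▸ h

theorem Cofactor.elim {s t : I} {a b : ArtinMonoid Γ} (h : Cofactor Γ s t a b) :
    (s = t ∧ a = b) ∨
    (s ≠ t ∧ ¬ Γ.Adj s t ∧ ∃ c, a = gen Γ t * c ∧ b = gen Γ s * c) ∨
    (Γ.Adj s t ∧ ∃ c, a = gen Γ t * (gen Γ s * c) ∧ b = gen Γ s * (gen Γ t * c)) := by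
  cases h with
  | refl c => exact .inl ⟨rfl, rfl⟩
  | comm hne h c => exact .inr (.inl ⟨hne, h, c, rfl, rfl⟩)
  | braid h c => exact .inr (.inr ⟨h, c, rfl, rfl⟩)

theorem Cofactor.eq_of_self {s : I} {a b : ArtinMonoid Γ} (h : Cofactor Γ s s a b) : a = b := by
  rcases h.elim with h | ⟨h, -⟩ | ⟨h, -⟩
  · exact h.2
  · exact absurd rfl h
  · exact absurd h (Γ.loopless.irrefl s)

theorem Cofactor.comm_elim {s t : I} {a b : ArtinMonoid Γ} (h : Cofactor Γ s t a b)
    (hne : s ≠ t) (hadj : ¬ Γ.Adj s t) : ∃ c, a = gen Γ t * c ∧ b = gen Γ s * c := by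
  rcases h.elim with h | ⟨-, -, h⟩ | ⟨h, -⟩
  · exact absurd h.1 hne
  · exact h
  · exact absurd h hadj

theorem Cofactor.braid_elim {s t : I} {a b : ArtinMonoid Γ} (h : Cofactor Γ s t a b)
    (hadj : Γ.Adj s t) :
    ∃ c, a = gen Γ t * (gen Γ s * c) ∧ b = gen Γ s * (gen Γ t * c) := by
  rcases h.elim with h | ⟨-, h, -⟩ | ⟨-, h⟩
  · exact absurd h.1 hadj.ne
  · exact absurd hadj h
  · exact h

/-- The case of `Cofactor.trans` in which the middle generator braids with the first one and
commutes with the last one. -/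
theorem Cofactor.trans_braid_comm {s u t : I} {x y : ArtinMonoid Γ}
    (hsu : Γ.Adj s u) (hut : u ≠ t) (hut' : ¬ Γ.Adj u t) (hst : s ≠ t)
    (hd : gen Γ s * (gen Γ u * x) = gen Γ t * y)
    (H : ∀ (s t : I) (x' y' : ArtinMonoid Γ), length x' ≤ length x + 1 →
      gen Γ s * x' = gen Γ t * y' → Cofactor Γ s t x' y') :
    Cofactor Γ s t (gen Γ u * (gen Γ s * x)) (gen Γ u * y) := by
  have h₁ := H _ _ _ _ (by simp [add_comm]) hd
  by_cases hst' : Γ.Adj s t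
  · obtain ⟨z, hz, rfl⟩ := h₁.braid_elim hst'
    have hlen : length x = length z + 1 := by
      have := congrArg length hz
      simp at this; omega
    obtain ⟨w, rfl, hw⟩ := (H _ _ _ _ (by simp) hz).comm_elim hut hut'
    obtain ⟨v, rfl, rfl⟩ := (H _ _ _ _ (by simp at hlen ⊢; omega) hw).braid_elim hsu
    refine (Cofactor.braid hst' (gen Γ u * (gen Γ s * (gen Γ t * v)))).of_eq ?_ ?_
    · rw [gen_braid_mul hst', gen_comm_mul hut hut', ← gen_comm_mul hut hut' v,
        gen_braid_mul hsu.symm]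
    · rw [← gen_comm_mul hut hut' (gen Γ s * v), gen_braid_mul hsu.symm, gen_braid_mul hst',
        gen_comm_mul hut hut']
  · obtain ⟨z, hz, rfl⟩ := h₁.comm_elim hst hst'
    obtain ⟨w, rfl, rfl⟩ := (H _ _ _ _ (by simp) hz).comm_elim hut hut'
    refine (Cofactor.comm hst hst' (gen Γ u * (gen Γ s * w))).of_eq ?_ ?_
    · rw [gen_comm_mul hst hst', gen_comm_mul hut hut']
    · rw [gen_braid_mul hsu.symm]

theorem Cofactor.trans {s u t : I} {a d b : ArtinMonoid Γ} (hΓ : Γ.CliqueFree 3)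
    (H : ∀ (s t : I) (x y : ArtinMonoid Γ), length x < length d →
      gen Γ s * x = gen Γ t * y → Cofactor Γ s t x y)
    (hsu : Cofactor Γ s u a d) (hut : Cofactor Γ u t d b) : Cofactor Γ s t a b := by
  rcases hsu.elim with ⟨rfl, rfl⟩ | ⟨hsu₁, hsu₂, x, rfl, rfl⟩ | ⟨hsu₁, x, rfl, rfl⟩
  · exact hut
  · rcases hut.elim with ⟨rfl, rfl⟩ | ⟨hut₁, hut₂, y, hd, rfl⟩ | ⟨hut₁, y, hd, rfl⟩
    · exact hsu
    · rcases (H _ _ _ _ (by simp) hd).elim with ⟨rfl, rfl⟩ | ⟨h₁, h₂, z, rfl, rfl⟩ | ⟨h₁, z, rfl, rfl⟩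
      · exact .refl _ _
      · exact (Cofactor.comm h₁ h₂ (gen Γ u * z)).of_eq (gen_comm_mul hut₁ hut₂ _)
          (gen_comm_mul hsu₁.symm (fun h => hsu₂ h.symm) _)
      · have hus : ∀ c, gen Γ u * (gen Γ s * c) = gen Γ s * (gen Γ u * c) :=
          gen_comm_mul hsu₁.symm (fun h => hsu₂ h.symm)
        refine (Cofactor.braid h₁ (gen Γ u * z)).of_eq ?_ ?_
        · rw [gen_comm_mul hut₁ hut₂, hus]
        · rw [hus, gen_comm_mul hut₁ hut₂]
    · have hlen : length x = length y + 1 := by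
        have := congrArg length hd
        simp at this; omega
      by_cases hst : s = t
      · subst hst; exact absurd hut₁.symm hsu₂
      · refine (Cofactor.trans_braid_comm hut₁.symm hsu₁.symm (fun h => hsu₂ h.symm)
          (Ne.symm hst) hd.symm fun s' t' x' y' hl he => H _ _ _ _ ?_ he).symm
        simp; omega
  · rcases hut.elim with ⟨rfl, rfl⟩ | ⟨hut₁, hut₂, y, hd, rfl⟩ | ⟨hut₁, y, hd, rfl⟩
    · exact hsu
    · by_cases hst : s = t
      · subst hst; exact absurd hsu₁.symm hut₂
      · refine Cofactor.trans_braid_comm hsu₁ hut₁ hut₂ hst hd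
          fun s' t' x' y' hl he => H _ _ _ _ ?_ he
        simp; omega
    · by_cases hst : s = t
      · subst hst
        have h₁ := (H _ _ _ _ (by simp) hd).eq_of_self
        rw [(H _ _ _ _ (by simp; omega) h₁).eq_of_self]
        exact .refl _ _
      · have hst' : ¬ Γ.Adj s t := fun h => by
          classical
          exact hΓ {s, u, t} (SimpleGraph.is3Clique_triple_iff.2 ⟨hsu₁, h, hut₁⟩)
        obtain ⟨z, hz, hz'⟩ := (H _ _ _ _ (by simp) hd).comm_elim hst hst'
        have hl₁ := congrArg length hz
        have hl₂ := congrArg length hz'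
        simp only [length_mul, length_gen] at hl₁ hl₂
        obtain ⟨w, rfl, rfl⟩ := (H _ _ _ _ (by simp; omega) hz).braid_elim hut₁
        simp only [length_mul, length_gen] at hl₁ hl₂
        obtain ⟨w', rfl, hw⟩ := (H _ _ _ _ (by simp; omega) hz').braid_elim hsu₁.symm
        simp only [length_mul, length_gen] at hl₁ hl₂
        have hw := (H _ _ _ _ (by simp only [length_mul, length_gen]; omega) hw).eq_of_self
        obtain ⟨v, rfl, rfl⟩ := (H _ _ _ _ (by simp only [length_mul, length_gen]; omega) hw).comm_elim (Ne.symm hst)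
          (fun h => hst' h.symm)
        have hst_comm : ∀ c, gen Γ s * (gen Γ t * c) = gen Γ t * (gen Γ s * c) :=
          gen_comm_mul hst hst'
        refine (Cofactor.comm hst hst' (gen Γ u * (gen Γ t * (gen Γ s * (gen Γ u * v))))).of_eq ?_ ?_
        · rw [hst_comm, gen_braid_mul hsu₁, gen_braid_mul hut₁]
        · rw [← hst_comm, gen_braid_mul hut₁.symm, gen_braid_mul hsu₁.symm, hst_comm]

/-- Two words agree in their first letters up to completing these to common multiples. -/
def HeadRel (Γ : SimpleGraph I) : List I → List I → Prop
  | [], [] => True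
  | s :: a, t :: b => Cofactor Γ s t ((conGen (ArtinMonoidRel Γ)).mk' (FreeMonoid.ofList a))
      ((conGen (ArtinMonoidRel Γ)).mk' (FreeMonoid.ofList b))
  | _, _ => False

theorem length_mk (w : FreeMonoid I) :
    length ((conGen (ArtinMonoidRel Γ)).mk' w) = w.toList.length := by
  induction w using FreeMonoid.inductionOn' with
  | one => simp
  | of_mul s w ih =>
    rw [map_mul, length_mul, ih]
    exact (congrArg (· + _) (length_gen s)).trans (by simp [add_comm])

theorem headRel_of_conGen (hΓ : Γ.CliqueFree 3) (m : ℕ) :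
    ∀ u v : FreeMonoid I, u.toList.length = m → conGen (ArtinMonoidRel Γ) u v →
      HeadRel Γ u.toList v.toList := by
  induction m using Nat.strong_induction_on with
  | _ m IH =>
  have H : ∀ (s t : I) (x y : ArtinMonoid Γ), length x + 1 < m →
      gen Γ s * x = gen Γ t * y → Cofactor Γ s t x y := by
    intro s t x y hl he
    obtain ⟨x, rfl⟩ := Con.mk'_surjective x
    obtain ⟨y, rfl⟩ := Con.mk'_surjective y
    rw [length_mk] at hl
    exact IH _ hl (.of s * x) (.of t * y) (by simp [add_comm]) ((Con.eq (conGen _)).1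
      (show ((FreeMonoid.of s * x : FreeMonoid I) : ArtinMonoid Γ) =
        ((FreeMonoid.of t * y : FreeMonoid I) : ArtinMonoid Γ) from he))
  intro u v hu huv
  have hlen : ∀ u v : FreeMonoid I, conGen (ArtinMonoidRel Γ) u v →
      u.toList.length = v.toList.length := by
    intro u v h
    rw [← length_mk (Γ := Γ), ← length_mk (Γ := Γ)]
    exact congrArg length ((Con.eq _).2 h)
  induction (huv : ConGen.Rel (ArtinMonoidRel Γ) u v) with
  | of u v h =>
    cases h with
    | @comm s t hne h => exact Cofactor.comm hne h 1
    | @braid s t h => exact Cofactor.braid h 1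
  | refl u =>
    cases hl : u.toList with
    | nil => trivial
    | cons s a => exact .refl _ _
  | @symm u v h ih =>
    have := ih (by rw [hlen _ _ h, hu])
    cases hl : u.toList with
    | nil =>
      cases hl' : v.toList with
      | nil => trivial
      | cons s a => rw [hl, hl'] at this; exact this
    | cons s a =>
      cases hl' : v.toList with
      | nil => rw [hl, hl'] at this; exact this
      | cons t b => rw [hl, hl'] at this; exact Cofactor.symm this
  | @trans u v w h₁ h₂ ih₁ ih₂ =>
    have k₁ := ih₁ hu
    have k₂ := ih₂ (by rw [← hlen _ _ h₁, hu])
    have hlv := (hlen _ _ h₁).symm.trans hu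
    cases hl : u.toList <;> cases hl' : v.toList <;> cases hl'' : w.toList <;>
      simp only [hl, hl', hl'', HeadRel] at k₁ k₂ ⊢
    refine Cofactor.trans hΓ (fun s t x y hxy he => H s t x y ?_ he) k₁ k₂
    rw [length_mk, FreeMonoid.toList_ofList] at hxy
    rw [hl', List.length_cons] at hlv
    omega
  | @mul u v u' v' h₁ h₂ ih₁ ih₂ =>
    have hl₁ := hlen _ _ h₁
    cases hl : u.toList with
    | nil =>
      cases hl' : v.toList with
      | nil =>
        simp only [FreeMonoid.toList_mul, hl, hl', List.nil_append] at hu ⊢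
        exact ih₂ hu
      | cons t b => simp [hl, hl'] at hl₁
    | cons s a =>
      have hl₂ := hlen _ _ h₂
      cases hl' : v.toList with
      | nil => simp [hl, hl'] at hl₁
      | cons t b =>
        have key : HeadRel Γ u.toList v.toList := by
          rw [FreeMonoid.toList_mul, List.length_append] at hu
          rcases Nat.eq_zero_or_pos u'.toList.length with h0 | h0
          · exact ih₁ (by omega)
          · exact IH _ (by omega) u v rfl h₁
        rw [hl, hl'] at key
        simp only [FreeMonoid.toList_mul, hl, hl', List.cons_append]
        refine (Cofactor.mul_right key ((conGen (ArtinMonoidRel Γ)).mk' u')).of_eq ?_ ?_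
        · rw [← map_mul]; rfl
        · rw [show (conGen (ArtinMonoidRel Γ)).mk' u' = (conGen (ArtinMonoidRel Γ)).mk' v' from
            (Con.eq _).2 h₂, ← map_mul]; rfl

theorem cofactor_of_gen_mul_eq (hΓ : Γ.CliqueFree 3) {s t : I} {a b : ArtinMonoid Γ}
    (h : gen Γ s * a = gen Γ t * b) : Cofactor Γ s t a b := by
  obtain ⟨x, rfl⟩ := Con.mk'_surjective a
  obtain ⟨y, rfl⟩ := Con.mk'_surjective b
  exact headRel_of_conGen hΓ _ (.of s * x) (.of t * y) rfl ((Con.eq (conGen _)).1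
    (show ((FreeMonoid.of s * x : FreeMonoid I) : ArtinMonoid Γ) =
      ((FreeMonoid.of t * y : FreeMonoid I) : ArtinMonoid Γ) from h))

theorem mul_left_cancel_of_cliqueFree (hΓ : Γ.CliqueFree 3) {a b c : ArtinMonoid Γ}
    (h : a * b = a * c) : b = c := by
  induction a using induction_on with
  | one => simpa using h
  | gen_mul s a ih =>
    rw [mul_assoc, mul_assoc] at h
    exact ih (cofactor_of_gen_mul_eq hΓ h).eq_of_self

/-- Reversal of words. -/
def reverse : ArtinMonoid Γ →* (ArtinMonoid Γ)ᵐᵒᵖ :=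
  lift (fun s => .op (gen Γ s))
    (fun s t hne h => by rw [← MulOpposite.op_mul, ← MulOpposite.op_mul, gen_comm hne h])
    (fun s t h => by
      simp only [← MulOpposite.op_mul, ← mul_assoc]
      rw [gen_braid h])

theorem reverse_gen (s : I) : reverse (gen Γ s) = .op (gen Γ s) := by simp [reverse]

theorem reverse_reverse (a : ArtinMonoid Γ) : (reverse (reverse a).unop).unop = a := by
  induction a using induction_on with
  | one => simp
  | gen_mul s a ih => simp [reverse_gen, ih]

theorem mul_right_cancel_of_cliqueFree (hΓ : Γ.CliqueFree 3) {a b c : ArtinMonoid Γ}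
    (h : b * a = c * a) : b = c := by
  have := congrArg (fun x => (reverse x).unop) h
  simp only [map_mul, MulOpposite.unop_mul] at this
  rw [← reverse_reverse b, mul_left_cancel_of_cliqueFree hΓ this, reverse_reverse]

theorem exists_of_mul_gen_eq_of_comm (hΓ : Γ.CliqueFree 3) {s t : I} (hne : s ≠ t)
    (hadj : ¬ Γ.Adj s t) {a b : ArtinMonoid Γ} (h : a * gen Γ s = b * gen Γ t) :
    ∃ c, a = c * gen Γ t ∧ b = c * gen Γ s := by
  have := congrArg (fun x => (reverse x).unop) h
  simp only [map_mul, MulOpposite.unop_mul, reverse_gen, MulOpposite.unop_op] at this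
  obtain ⟨c, hc, hc'⟩ := (cofactor_of_gen_mul_eq hΓ this).comm_elim hne hadj
  refine ⟨(reverse c).unop, ?_, ?_⟩
  · rw [← reverse_reverse a, hc]; simp [reverse_gen]
  · rw [← reverse_reverse b, hc']; simp [reverse_gen]

theorem exists_of_mul_gen_eq_of_adj (hΓ : Γ.CliqueFree 3) {s t : I}
    (hadj : Γ.Adj s t) {a b : ArtinMonoid Γ} (h : a * gen Γ s = b * gen Γ t) :
    ∃ c, a = c * gen Γ s * gen Γ t ∧ b = c * gen Γ t * gen Γ s := by
  have := congrArg (fun x => (reverse x).unop) h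
  simp only [map_mul, MulOpposite.unop_mul, reverse_gen, MulOpposite.unop_op] at this
  obtain ⟨c, hc, hc'⟩ := (cofactor_of_gen_mul_eq hΓ this).braid_elim hadj
  refine ⟨(reverse c).unop, ?_, ?_⟩
  · rw [← reverse_reverse a, hc]; simp [reverse_gen]
  · rw [← reverse_reverse b, hc']; simp [reverse_gen]

theorem length_eq_zero {a : ArtinMonoid Γ} : length a = 0 ↔ a = 1 := by
  refine ⟨fun h => ?_, fun h => by simp [h]⟩
  induction a using induction_on with
  | one => rfl
  | gen_mul s a ih => simp at h

theorem exists_eq_mul_gen {a : ArtinMonoid Γ} (h : a ≠ 1) : ∃ s b, a = b * gen Γ s := by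
  induction a using induction_on with
  | one => exact absurd rfl h
  | gen_mul s a ih =>
    by_cases ha : a = 1
    · exact ⟨s, 1, by simp [ha]⟩
    · obtain ⟨t, b, rfl⟩ := ih ha
      exact ⟨t, gen Γ s * b, by rw [mul_assoc]⟩

end ArtinMonoid

/-- The positive braid monoid on `n + 1` strands. -/
abbrev BraidMonoid (n : ℕ) : Type := ArtinMonoid (SimpleGraph.pathGraph n)

namespace BraidMonoid

open ArtinMonoid

variable {n : ℕ}

theorem pathGraph_cliqueFree (n : ℕ) : (SimpleGraph.pathGraph n).CliqueFree 3 := by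
  classical
  intro s hs
  obtain ⟨a, b, c, hab, hac, hbc, -⟩ := SimpleGraph.is3Clique_iff.1 hs
  rw [SimpleGraph.pathGraph_adj] at hab hac hbc
  omega

instance : IsCancelMul (BraidMonoid n) where
  mul_left_cancel _ _ _ h := mul_left_cancel_of_cliqueFree (pathGraph_cliqueFree n) h
  mul_right_cancel _ _ _ h := mul_right_cancel_of_cliqueFree (pathGraph_cliqueFree n) h

variable (n) in
/-- The standard generators of the positive braid monoid, with trivial value out of range. -/
def sigma (j : ℕ) : BraidMonoid n := if h : j < n then gen _ ⟨j, h⟩ else 1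

theorem sigma_of_lt {j : ℕ} (h : j < n) : sigma n j = gen _ ⟨j, h⟩ := dif_pos h

theorem length_sigma {j : ℕ} (h : j < n) : length (sigma n j) = 1 := by
  rw [sigma_of_lt h, length_gen]

theorem sigma_comm {i j : ℕ} (h : i + 2 ≤ j) : sigma n i * sigma n j = sigma n j * sigma n i := by
  by_cases hj : j < n
  · rw [sigma_of_lt hj, sigma_of_lt (show i < n by omega)]
    refine gen_comm (by simp; omega) ?_
    rw [SimpleGraph.pathGraph_adj]; simp; omega
  · rw [sigma, sigma, dif_neg hj]; simp

theorem sigma_braid {j : ℕ} (h : j + 1 < n) :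
    sigma n j * sigma n (j + 1) * sigma n j = sigma n (j + 1) * sigma n j * sigma n (j + 1) := by
  rw [sigma_of_lt h, sigma_of_lt (show j < n by omega)]
  exact gen_braid (by simp [SimpleGraph.pathGraph_adj])

/-- Right divisibility. -/
def RDvd (a b : BraidMonoid n) : Prop := ∃ c, b = c * a

theorem RDvd.mul_left {a b : BraidMonoid n} (h : RDvd a b) (c : BraidMonoid n) :
    RDvd a (c * b) := by
  obtain ⟨d, rfl⟩ := h
  exact ⟨c * d, by rw [mul_assoc]⟩

theorem RDvd.mul_right_cancel {a b c : BraidMonoid n} (h : RDvd (a * c) (b * c)) : RDvd a b := by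
  obtain ⟨d, hd⟩ := h
  rw [← mul_assoc] at hd
  exact ⟨d, _root_.mul_right_cancel hd⟩

theorem RDvd.mul_right {a b : BraidMonoid n} (h : RDvd a b) (c : BraidMonoid n) :
    RDvd (a * c) (b * c) := by
  obtain ⟨d, rfl⟩ := h
  exact ⟨d, by rw [mul_assoc]⟩

theorem RDvd.refl (a : BraidMonoid n) : RDvd a a := ⟨1, by simp⟩

theorem RDvd.trans {a b c : BraidMonoid n} (h : RDvd a b) (h' : RDvd b c) : RDvd a c := by
  obtain ⟨d, rfl⟩ := h'
  exact h.mul_left d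

theorem RDvd.length_le {a b : BraidMonoid n} (h : RDvd a b) : length a ≤ length b := by
  obtain ⟨d, rfl⟩ := h
  simp

theorem RDvd.of_mul_sigma {a : BraidMonoid n} {i j : ℕ} (hi : i < n) (hij : i + 2 ≤ j ∨ j + 2 ≤ i)
    (h : RDvd (sigma n j) (a * sigma n i)) : RDvd (sigma n j) a := by
  by_cases hj : j < n
  · obtain ⟨b, hb⟩ := h
    rw [sigma_of_lt hi, sigma_of_lt hj] at hb
    obtain ⟨c, rfl, -⟩ := exists_of_mul_gen_eq_of_comm (pathGraph_cliqueFree n)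
      (by simp; omega) (by rw [SimpleGraph.pathGraph_adj]; simp; omega) hb
    exact ⟨c, by rw [sigma_of_lt hj]⟩
  · exact ⟨a, by simp [sigma, hj]⟩

theorem exists_of_mul_sigma_eq {a b : BraidMonoid n} {j : ℕ} (hj : j + 1 < n)
    (h : a * sigma n j = b * sigma n (j + 1)) :
    ∃ c, a = c * sigma n j * sigma n (j + 1) ∧ b = c * sigma n (j + 1) * sigma n j := by
  rw [sigma_of_lt hj, sigma_of_lt (show j < n by omega)] at h ⊢
  exact exists_of_mul_gen_eq_of_adj (pathGraph_cliqueFree n) (by simp [SimpleGraph.pathGraph_adj]) h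

/-- The ascending product of the generators of the component of `t` in `Γ ∩ [0, t]`. -/
def tau (n : ℕ) (Γ : Finset ℕ) : ℕ → BraidMonoid n
  | 0 => 1
  | t + 1 => if t ∈ Γ then tau n Γ t * sigma n t else 1

/-- The Garside element of the parabolic submonoid generated by `Γ ∩ [0, t)`. -/
def garside (n : ℕ) (Γ : Finset ℕ) : ℕ → BraidMonoid n
  | 0 => 1
  | t + 1 => tau n Γ (t + 1) * garside n Γ t

theorem tau_comm (Γ : Finset ℕ) {t j : ℕ} (h : t + 1 ≤ j) :
    tau n Γ t * sigma n j = sigma n j * tau n Γ t := by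
  induction t with
  | zero => simp [tau]
  | succ t ih =>
    rw [tau]
    split_ifs
    · rw [mul_assoc, sigma_comm (by omega), ← mul_assoc, ih (by omega), mul_assoc]
    · simp

theorem garside_comm (Γ : Finset ℕ) {t j : ℕ} (h : t + 1 ≤ j) :
    garside n Γ t * sigma n j = sigma n j * garside n Γ t := by
  induction t with
  | zero => simp [garside]
  | succ t ih =>
    rw [garside, mul_assoc, ih (by omega), ← mul_assoc, tau_comm _ h, mul_assoc]

theorem RDvd.of_mul_tau {Γ : Finset ℕ} {a : BraidMonoid n} {t j : ℕ} (hj : j < n) (h : t + 1 ≤ j)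
    (hd : RDvd (sigma n j) (a * tau n Γ t)) : RDvd (sigma n j) a := by
  induction t with
  | zero => simpa [tau] using hd
  | succ t ih =>
    rw [tau] at hd
    split_ifs at hd
    · rw [← mul_assoc] at hd
      exact ih (by omega) (hd.of_mul_sigma (by omega) (by omega))
    · simpa using hd

theorem RDvd.of_mul_garside {Γ : Finset ℕ} {a : BraidMonoid n} {t j : ℕ} (hj : j < n)
    (h : t + 1 ≤ j) (hd : RDvd (sigma n j) (a * garside n Γ t)) : RDvd (sigma n j) a := by
  induction t generalizing a with
  | zero => simpa [garside] using hd
  | succ t ih =>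
    rw [garside, ← mul_assoc] at hd
    exact (ih (by omega) hd).of_mul_tau hj h

theorem tau_rdvd {Γ : Finset ℕ} {c : BraidMonoid n} {t : ℕ} (ht : t < n) (hΓ : t ∈ Γ)
    (hd : RDvd (sigma n t) (c * tau n Γ t)) : RDvd (tau n Γ (t + 1)) c := by
  induction t generalizing c with
  | zero => simpa [tau, hΓ] using hd
  | succ t ih =>
    by_cases h : t ∈ Γ
    · obtain ⟨d, hd⟩ := hd
      rw [tau, if_pos h, ← mul_assoc] at hd
      obtain ⟨e, he, -⟩ := exists_of_mul_sigma_eq ht hd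
      obtain ⟨f, rfl⟩ : RDvd (sigma n (t + 1)) c := RDvd.of_mul_tau ht le_rfl ⟨_, he⟩
      rw [mul_assoc, ← tau_comm _ le_rfl, ← mul_assoc] at he
      have := ih (by omega) h ⟨e, _root_.mul_right_cancel he⟩
      rw [tau, if_pos hΓ]
      exact this.mul_right _
    · rw [tau, if_neg h, mul_one] at hd
      rwa [tau, if_pos hΓ, tau, if_neg h, one_mul]

theorem sigma_rdvd_tau_mul_tau {Γ : Finset ℕ} {t : ℕ} (ht : t < n) (hΓ : t ∈ Γ) :
    RDvd (sigma n t) (tau n Γ (t + 1) * tau n Γ t) := by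
  induction t with
  | zero => simp [tau, hΓ, RDvd.refl]
  | succ t ih =>
    by_cases h : t ∈ Γ
    · obtain ⟨y, hy⟩ := ih (by omega) h
      refine ⟨y * sigma n (t + 1) * sigma n t, ?_⟩
      rw [tau, if_pos hΓ]
      conv_lhs => rw [tau.eq_2 n Γ t, if_pos h]
      rw [mul_assoc _ (sigma n (t + 1)), ← mul_assoc (sigma n (t + 1)), ← tau_comm _ le_rfl]
      rw [tau, if_pos h] at hy
      simp only [← mul_assoc] at hy ⊢
      rw [hy, mul_assoc y, mul_assoc y, mul_assoc y, mul_assoc y, sigma_braid ht]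
    · rw [tau, if_pos hΓ, tau, if_neg h]
      exact ⟨1, by simp⟩

theorem sigma_rdvd_garside {Γ : Finset ℕ} {s t : ℕ} (ht : t ≤ n) (hs : s < t) (hΓ : s ∈ Γ) :
    RDvd (sigma n s) (garside n Γ t) := by
  induction t with
  | zero => omega
  | succ t ih =>
    rw [garside]
    rcases (Nat.lt_succ_iff.1 hs).lt_or_eq with h | rfl
    · exact (ih (by omega) h).mul_left _
    · cases s with
      | zero => simp [garside, tau, hΓ, RDvd.refl]
      | succ t =>
        obtain ⟨y, hy⟩ := sigma_rdvd_tau_mul_tau ht hΓ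
        refine ⟨y * garside n Γ t, ?_⟩
        rw [garside, ← mul_assoc, hy, mul_assoc, mul_assoc, garside_comm _ le_rfl]

theorem garside_rdvd {Γ : Finset ℕ} {b : BraidMonoid n} {t : ℕ} (ht : t ≤ n)
    (h : ∀ s ∈ Γ, s < t → RDvd (sigma n s) b) : RDvd (garside n Γ t) b := by
  induction t with
  | zero => exact ⟨b, by simp [garside]⟩
  | succ t ih =>
    obtain ⟨c, rfl⟩ := ih (by omega) fun s hs hst => h s hs (by omega)
    rw [garside]
    refine RDvd.mul_right ?_ _
    by_cases hΓ : t ∈ Γ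
    · refine tau_rdvd ht hΓ ?_
      have := h t hΓ (by omega)
      cases t with
      | zero => simpa [garside, tau] using this
      | succ t =>
        rw [garside, ← mul_assoc] at this
        exact this.of_mul_garside ht le_rfl
    · rw [tau, if_neg hΓ]
      exact ⟨c, by simp⟩

/-- The fundamental element. -/
def fundamental (n : ℕ) : BraidMonoid n := garside n (Finset.range n) n

theorem fundamental_rdvd_mul_sigma {s : ℕ} (hs : s < n) :
    RDvd (fundamental n) (fundamental n * sigma n s) := by
  refine garside_rdvd le_rfl fun t _ ht => ?_
  obtain ⟨y, hy⟩ : RDvd (sigma n t) (fundamental n) := sigma_rdvd_garside le_rfl ht (by simpa)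
  obtain ⟨z, hz⟩ : RDvd (sigma n s) (fundamental n) := sigma_rdvd_garside le_rfl hs (by simpa)
  rcases (by omega : s = t ∨ t = s + 1 ∨ s = t + 1 ∨ s + 2 ≤ t ∨ t + 2 ≤ s) with
    rfl | rfl | rfl | hst | hst
  · exact ⟨_, rfl⟩
  · obtain ⟨c, -, rfl⟩ := exists_of_mul_sigma_eq ht (hz.symm.trans hy)
    refine ⟨c * sigma n (s + 1) * sigma n (s + 1) * sigma n s, ?_⟩
    have := congrArg (c * sigma n (s + 1) * ·) (sigma_braid ht)
    simp only [← mul_assoc] at this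
    rw [hy, this]
  · obtain ⟨c, rfl, -⟩ := exists_of_mul_sigma_eq hs (hy.symm.trans hz)
    refine ⟨c * sigma n t * sigma n t * sigma n (t + 1), ?_⟩
    have := congrArg (c * sigma n t * ·) (sigma_braid hs)
    simp only [← mul_assoc] at this
    rw [hy, this]
  · exact ⟨y * sigma n s, by rw [hy, mul_assoc, mul_assoc, sigma_comm hst]⟩
  · exact ⟨y * sigma n s, by rw [hy, mul_assoc, mul_assoc, sigma_comm hst]⟩

theorem fundamental_rdvd_mul (a : BraidMonoid n) :
    ∃ b, fundamental n * a = b * fundamental n ∧ length b = length a := by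
  suffices RDvd (fundamental n) (fundamental n * a) by
    obtain ⟨b, hb⟩ := this
    have := congrArg length hb
    rw [length_mul, length_mul] at this
    exact ⟨b, hb, by omega⟩
  induction a using ArtinMonoid.induction_on with
  | one => exact ⟨1, by simp⟩
  | gen_mul s a ih =>
    obtain ⟨b, hb⟩ := fundamental_rdvd_mul_sigma s.2
    rw [sigma_of_lt s.2] at hb
    rw [← mul_assoc, hb, mul_assoc]
    exact ih.mul_left _

theorem fundamental_pow_rdvd_mul (k : ℕ) (a : BraidMonoid n) :
    RDvd (fundamental n ^ k) (fundamental n ^ k * a) := by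
  induction k with
  | zero => exact ⟨a, by simp⟩
  | succ k ih =>
    obtain ⟨b, hb⟩ := ih
    obtain ⟨c, hc, -⟩ := fundamental_rdvd_mul b
    refine ⟨c, ?_⟩
    rw [pow_succ', mul_assoc, hb, ← mul_assoc, hc, mul_assoc]

theorem rdvd_fundamental_pow (a : BraidMonoid n) : RDvd a (fundamental n ^ length a) := by
  induction hl : length a generalizing a with
  | zero => exact ⟨1, by simp [length_eq_zero.1 hl]⟩
  | succ m ih =>
    induction a using ArtinMonoid.induction_on with
    | one => simp at hl
    | gen_mul s a _ =>
      obtain ⟨y, hy⟩ : RDvd (sigma n s) (fundamental n) := sigma_rdvd_garside le_rfl s.2 (by simp)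
      rw [sigma_of_lt s.2] at hy
      obtain ⟨b, hb, hlb⟩ := fundamental_rdvd_mul a
      rw [length_mul, length_gen] at hl
      obtain ⟨c, hc⟩ := ih b (by omega)
      refine ⟨c * y, ?_⟩
      have : y * (gen _ s * a) = b * fundamental n := by rw [← hb, ← mul_assoc]; exact hy ▸ rfl
      rw [mul_assoc, this, ← mul_assoc, ← hc, pow_succ]

theorem exists_left_common_multiple (r s : BraidMonoid n) : ∃ r' s', s' * r = r' * s := by
  obtain ⟨b, hb⟩ := rdvd_fundamental_pow s
  obtain ⟨c, hc⟩ := fundamental_pow_rdvd_mul (length s) r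
  exact ⟨c * b, fundamental n ^ length s, by rw [hc, mul_assoc, ← hb]⟩

noncomputable instance : OreLocalization.OreSet (⊤ : Submonoid (BraidMonoid n)) where
  ore_right_cancel _ _ s h := ⟨s, by rw [mul_right_cancel h]⟩
  oreNum r s := (exists_left_common_multiple r s).choose
  oreDenom r s := ⟨(exists_left_common_multiple r s).choose_spec.choose, Submonoid.mem_top _⟩
  ore_eq r s := (exists_left_common_multiple r s).choose_spec.choose_spec

/-- The map from the braid monoid to its group of left fractions. -/
noncomputable def toFractions (n : ℕ) :
    BraidMonoid n →* (OreLocalization (⊤ : Submonoid (BraidMonoid n)) (BraidMonoid n))ˣ :=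
  Units.liftRight OreLocalization.numeratorHom
    (fun a => OreLocalization.numeratorUnit (⟨a, Submonoid.mem_top a⟩ : (⊤ : Submonoid (BraidMonoid n))))
    fun _ => rfl

theorem toFractions_injective (n : ℕ) : Function.Injective (toFractions n) := by
  intro a b h
  have h : OreLocalization.oreDiv a (1 : (⊤ : Submonoid (BraidMonoid n))) =
    OreLocalization.oreDiv b 1 := congrArg Units.val h
  rw [OreLocalization.oreDiv_eq_iff] at h
  obtain ⟨u, v, h₁, h₂⟩ := h
  simp only [OneMemClass.coe_one, mul_one] at h₂
  rw [Submonoid.smul_def, smul_eq_mul, smul_eq_mul, h₂] at h₁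
  exact (mul_left_cancel h₁).symm

end BraidMonoid

section BraidGroup

open ArtinMonoid BraidMonoid

theorem lift_braidWord_two {B M : Type*} [Group M] (f : B → M) (s t : B) :
    FreeGroup.lift f (braidWord s t 2) = f s * f t := by
  simp [braidWord, List.range_succ]

theorem lift_braidWord_three {B M : Type*} [Group M] (f : B → M) (s t : B) :
    FreeGroup.lift f (braidWord s t 3) = f s * f t * f s := by
  simp [braidWord, List.range_succ, mul_assoc]

theorem coxeterMatrix_A_of_adj {n : ℕ} {s t : Fin n} (h : (SimpleGraph.pathGraph n).Adj s t) :
    CoxeterMatrix.A n s t = 3 := by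
  have hne : s ≠ t := h.ne
  rw [SimpleGraph.pathGraph_adj] at h
  simp [CoxeterMatrix.A, hne]
  omega

theorem coxeterMatrix_A_of_not_adj {n : ℕ} {s t : Fin n} (hne : s ≠ t)
    (h : ¬ (SimpleGraph.pathGraph n).Adj s t) : CoxeterMatrix.A n s t = 2 := by
  rw [SimpleGraph.pathGraph_adj] at h
  simp [CoxeterMatrix.A, hne]
  omega

theorem artinGen_relation {B : Type*} (M : CoxeterMatrix B) {s t : B} (hne : s ≠ t)
    (h : M s t ≠ 0) :
    FreeGroup.lift (artinGen M) (braidWord s t (M s t)) =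
      FreeGroup.lift (artinGen M) (braidWord t s (M s t)) := by
  rw [← mul_inv_eq_one, ← map_inv, ← map_mul]
  have hl : ∀ w : FreeGroup B, FreeGroup.lift (artinGen M) w =
      (PresentedGroup.mk (artinRels M) w : PresentedGroup (artinRels M)) := fun w =>
    (FreeGroup.lift_unique (f := artinGen M) (PresentedGroup.mk (artinRels M)) fun _ => rfl).symm
  exact (hl _).trans
    ((QuotientGroup.eq_one_iff _).2 (Subgroup.subset_normalClosure ⟨s, t, hne, h, rfl⟩))

/-- The map from the braid monoid to the braid group. -/
def BraidMonoid.toBraidGroup (n : ℕ) : BraidMonoid n →* BraidGroup (n + 1) :=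
  ArtinMonoid.lift (braidGen (n + 1))
    (fun s t hne h => by
      have hM := coxeterMatrix_A_of_not_adj hne h
      have := artinGen_relation (CoxeterMatrix.A n) hne (by omega)
      rw [hM, lift_braidWord_two, lift_braidWord_two] at this
      exact this)
    (fun s t h => by
      have hM := coxeterMatrix_A_of_adj h
      have := artinGen_relation (CoxeterMatrix.A n) h.ne (by omega)
      rw [hM, lift_braidWord_three, lift_braidWord_three] at this
      exact this)

theorem BraidMonoid.toBraidGroup_gen (n : ℕ) (s : Fin n) :
    toBraidGroup n (gen _ s) = braidGen (n + 1) s := lift_gen _ _ _ _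

theorem BraidMonoid.toBraidGroup_injective (n : ℕ) : Function.Injective (toBraidGroup n) := by
  let f : Fin n → (OreLocalization (⊤ : Submonoid (BraidMonoid n)) (BraidMonoid n))ˣ :=
    fun s => toFractions n (gen _ s)
  have hf : ∀ r ∈ artinRels (CoxeterMatrix.A n), FreeGroup.lift f r = 1 := by
    rintro r ⟨s, t, hne, -, rfl⟩
    rw [map_mul, map_inv, mul_inv_eq_one]
    by_cases h : (SimpleGraph.pathGraph n).Adj s t
    · rw [coxeterMatrix_A_of_adj h, lift_braidWord_three, lift_braidWord_three]
      simp only [f, ← map_mul, gen_braid h]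
    · rw [coxeterMatrix_A_of_not_adj hne h, lift_braidWord_two, lift_braidWord_two]
      simp only [f, ← map_mul, gen_comm hne h]
  let F : BraidGroup (n + 1) →* _ := PresentedGroup.toGroup hf
  have hF : ∀ a, F (toBraidGroup n a) = toFractions n a := by
    intro a
    induction a using ArtinMonoid.induction_on with
    | one => simp
    | gen_mul s a ih =>
      rw [map_mul, map_mul, ih, map_mul, toBraidGroup_gen]
      exact congrArg (· * _) (PresentedGroup.toGroup.of hf)
  intro a b h
  exact toFractions_injective n (by rw [← hF, h, hF])

theorem BraidGroup.exists_fundamental_pow_mul {n : ℕ} (g : BraidGroup (n + 1)) :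
    ∃ k, ∀ m, k ≤ m → ∃ a, toBraidGroup n (fundamental n) ^ m * g = toBraidGroup n a := by
  suffices ∃ k a, toBraidGroup n (fundamental n) ^ k * g = toBraidGroup n a by
    obtain ⟨k, a, h⟩ := this
    refine ⟨k, fun m hm => ⟨fundamental n ^ (m - k) * a, ?_⟩⟩
    rw [map_mul, map_pow, ← h, ← mul_assoc, ← pow_add, Nat.sub_add_cancel hm]
  have hg : g ∈ Subgroup.closure (Set.range (braidGen (n + 1))) := by
    have := PresentedGroup.closure_range_of (artinRels (CoxeterMatrix.A n))
    exact (Eq.symm this ▸ Subgroup.mem_top (G := PresentedGroup (artinRels (CoxeterMatrix.A n))) g :)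
  induction hg using Subgroup.closure_induction_right with
  | one => exact ⟨0, 1, by simp⟩
  | mul_right g _ s hs ih =>
    obtain ⟨s, rfl⟩ := hs
    obtain ⟨k, a, h⟩ := ih
    exact ⟨k, a * gen _ s, by rw [map_mul, ← h, toBraidGroup_gen, mul_assoc]⟩
  | mul_inv_cancel g _ s hs ih =>
    obtain ⟨s, rfl⟩ := hs
    obtain ⟨k, a, h⟩ := ih
    obtain ⟨b, hb, -⟩ := fundamental_rdvd_mul a
    obtain ⟨y, hy⟩ : RDvd (sigma n s) (fundamental n) := sigma_rdvd_garside le_rfl s.2 (by simp)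
    rw [sigma_of_lt (show (s : ℕ) < n from s.2)] at hy
    refine ⟨k + 1, b * y, ?_⟩
    rw [pow_succ', mul_assoc, ← mul_assoc _ g, h, ← mul_assoc, ← map_mul, hb, mul_inv_eq_iff_eq_mul,
      ← toBraidGroup_gen, ← map_mul, mul_assoc b y]
    exact congrArg (fun z => toBraidGroup n (b * z)) hy

end BraidGroup

namespace BraidIdentities

variable {S : Type*} [Ring S]

/-- The sum `1 + x_{j-1} + x_{j-2} x_{j-1} + ⋯ + x_p ⋯ x_{j-1}`. -/
def ascSum (x : ℕ → S) (p : ℕ) : ℕ → S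
  | 0 => 1
  | j + 1 => if j < p then 1 else 1 + ascSum x p j * x j

/-- The descending product `x_j ⋯ x_p`, zero if `j < p`. -/
def descProd (x : ℕ → S) (p : ℕ) : ℕ → S
  | 0 => if p = 0 then x 0 else 0
  | j + 1 => if p = j + 1 then x (j + 1) else x (j + 1) * descProd x p j

/-- The shuffle sum of type `(j, p)`, a braid version of a Gaussian binomial coefficient. -/
def shuffleSum (x : ℕ → S) : ℕ → ℕ → S
  | 0, _ => 1
  | _ + 1, 0 => 1
  | j + 1, p + 1 => shuffleSum x j (p + 1) + shuffleSum x j p * descProd x p j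

/-- The sum of all positive permutation braids, a braid version of a factorial. -/
def permSum (x : ℕ → S) : ℕ → S
  | 0 => 1
  | j + 1 => ascSum x 0 (j + 1) * permSum x j

/-- A sequence satisfying the braid relations. -/
structure IsBraidSeq (x : ℕ → S) : Prop where
  braid (i : ℕ) : x i * x (i + 1) * x i = x (i + 1) * x i * x (i + 1)
  comm {i j : ℕ} (h : i + 2 ≤ j) : Commute (x i) (x j)

variable {x : ℕ → S}

theorem ascSum_self (x : ℕ → S) (p : ℕ) : ascSum x p p = 1 := by
  cases p <;> simp [ascSum]

theorem ascSum_succ (x : ℕ → S) {p j : ℕ} (h : p ≤ j) :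
    ascSum x p (j + 1) = 1 + ascSum x p j * x j := by
  rw [ascSum, if_neg (by omega)]

theorem descProd_self (x : ℕ → S) (p : ℕ) : descProd x p p = x p := by
  cases p <;> simp [descProd]

theorem descProd_succ (x : ℕ → S) {p j : ℕ} (h : p ≤ j) :
    descProd x p (j + 1) = x (j + 1) * descProd x p j := by
  rw [descProd, if_neg (by omega)]

theorem descProd_of_lt (x : ℕ → S) {p j : ℕ} (h : j < p) : descProd x p j = 0 := by
  induction j with
  | zero => rw [descProd, if_neg (by omega)]
  | succ j ih => rw [descProd, if_neg (by omega), ih (by omega), mul_zero]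

theorem shuffleSum_zero (x : ℕ → S) (j : ℕ) : shuffleSum x j 0 = 1 := by
  cases j <;> simp [shuffleSum]

theorem shuffleSum_of_lt (x : ℕ → S) {p j : ℕ} (h : j < p) : shuffleSum x j p = 1 := by
  induction j with
  | zero => simp [shuffleSum]
  | succ j ih =>
    cases p with
    | zero => simp [shuffleSum]
    | succ p =>
      rw [shuffleSum, ih (by omega), descProd_of_lt x (by omega), mul_zero, add_zero]

theorem shuffleSum_self (x : ℕ → S) (p : ℕ) : shuffleSum x p p = ascSum x 0 p := by
  induction p with
  | zero => simp [shuffleSum, ascSum]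
  | succ p ih =>
    rw [shuffleSum, ih, shuffleSum_of_lt x (by omega), descProd_self, ascSum_succ x (by omega)]

section Commutation

theorem ascSum_commute (hx : IsBraidSeq x) (p : ℕ) {j i : ℕ} (h : j + 1 ≤ i) :
    Commute (ascSum x p j) (x i) := by
  induction j with
  | zero => exact Commute.one_left _
  | succ j ih =>
    rw [ascSum]
    split_ifs
    · exact Commute.one_left _
    · exact (Commute.one_left _).add_left ((ih (by omega)).mul_left (hx.comm (by omega)))

theorem descProd_commute (hx : IsBraidSeq x) (p : ℕ) {j i : ℕ} (h : j + 2 ≤ i) :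
    Commute (descProd x p j) (x i) := by
  induction j with
  | zero =>
    rw [descProd]
    split_ifs
    · exact hx.comm (by omega)
    · exact Commute.zero_left _
  | succ j ih =>
    rw [descProd]
    split_ifs
    · exact hx.comm (by omega)
    · exact (hx.comm (by omega)).mul_left (ih (by omega))

theorem shuffleSum_commute (hx : IsBraidSeq x) {p j i : ℕ} (h : j + 1 ≤ i) :
    Commute (shuffleSum x j p) (x i) := by
  induction j generalizing p with
  | zero => simp [shuffleSum]
  | succ j ih =>
    cases p with
    | zero => simp [shuffleSum]
    | succ p =>
      rw [shuffleSum]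
      exact (ih (by omega)).add_left ((ih (by omega)).mul_left (descProd_commute hx _ (by omega)))

end Commutation

theorem mul_descProd (hx : IsBraidSeq x) {p j : ℕ} (h : p ≤ j) :
    x j * descProd x p (j + 1) = descProd x p (j + 1) * x (j + 1) := by
  rw [descProd_succ x h]
  rcases h.lt_or_eq with h | rfl
  · obtain ⟨j, rfl⟩ : ∃ i, j = i + 1 := ⟨j - 1, by omega⟩
    have hc := (descProd_commute hx p (show j + 2 ≤ j + 1 + 1 by omega)).eq
    have hb := hx.braid (j + 1)
    rw [descProd_succ x (by omega)]
    simp only [← mul_assoc]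
    rw [hb, mul_assoc _ (descProd x p j), hc]
    simp only [← mul_assoc]
  · rw [descProd_self, ← mul_assoc, hx.braid]

theorem ascSum_mul_descProd (hx : IsBraidSeq x) {p j : ℕ} (h : p ≤ j) :
    ascSum x p j * descProd x p j = descProd x p j * ascSum x (p + 1) (j + 1) := by
  induction j, h using Nat.le_induction with
  | base => rw [ascSum_self, ascSum_self, one_mul, mul_one]
  | succ j hj ih =>
    have key : ascSum x p j * descProd x p (j + 1) =
        descProd x p (j + 1) * ascSum x (p + 1) (j + 1) := by
      rw [descProd_succ x hj, ← mul_assoc, (ascSum_commute hx p le_rfl).eq, mul_assoc, ih,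
        mul_assoc]
    rw [ascSum_succ x hj, ascSum_succ x (show p + 1 ≤ j + 1 by omega), add_mul, one_mul, mul_assoc,
      mul_descProd hx hj, ← mul_assoc, key, mul_add, mul_one, mul_assoc]

theorem ascSum_mul_shuffleSum (hx : IsBraidSeq x) {p j : ℕ} (h : p ≤ j + 1) :
    ascSum x 0 (j + 1) * shuffleSum x j p = shuffleSum x (j + 1) p * ascSum x p (j + 1) := by
  induction j generalizing p with
  | zero =>
    rcases (by omega : p = 0 ∨ p = 1) with rfl | rfl
    · rw [shuffleSum_zero, shuffleSum_zero, one_mul, mul_one]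
    · rw [shuffleSum_self, ascSum_self, shuffleSum_of_lt x (by omega)]
  | succ i ih =>
    rcases h.lt_or_eq with h | rfl
    · cases p with
      | zero => rw [shuffleSum_zero, shuffleSum_zero, one_mul, mul_one]
      | succ p =>
        have h₁ : ascSum x 0 (i + 1 + 1) * shuffleSum x i (p + 1) = shuffleSum x i (p + 1) +
            shuffleSum x (i + 1) (p + 1) * (ascSum x (p + 1) (i + 1) * x (i + 1)) := by
          rw [ascSum_succ x (Nat.zero_le _), add_mul, one_mul, mul_assoc,
            ← (shuffleSum_commute hx le_rfl).eq, ← mul_assoc, ih (by omega), mul_assoc]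
        have h₂ : ascSum x 0 (i + 1 + 1) * (shuffleSum x i p * descProd x p i) =
            shuffleSum x i p * descProd x p i +
            shuffleSum x (i + 1) p * (descProd x p (i + 1) * ascSum x (p + 1) (i + 1 + 1)) := by
          rw [← ascSum_mul_descProd hx (by omega), descProd_succ x (by omega),
            ascSum_succ x (Nat.zero_le _), add_mul, one_mul, mul_assoc, ← mul_assoc (x (i + 1)),
            ← (shuffleSum_commute hx le_rfl).eq]
          simp only [← mul_assoc]
          rw [ih (by omega)]
        rw [shuffleSum.eq_3 x (i + 1) p, add_mul]
        conv_lhs => rw [shuffleSum, mul_add, h₁, h₂]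
        rw [ascSum_succ x (show p + 1 ≤ i + 1 by omega), mul_add (shuffleSum x (i + 1) (p + 1)),
          mul_one]
        conv_rhs => rw [shuffleSum.eq_3 x i p]
        rw [← ascSum_succ x (show p + 1 ≤ i + 1 by omega), mul_assoc, shuffleSum.eq_3 x i p]
        abel
    · rw [shuffleSum_self, ascSum_self, shuffleSum_of_lt x (by omega)]

theorem ascSum_congr {x y : ℕ → S} {p j : ℕ} (h : ∀ i < j, x i = y i) :
    ascSum x p j = ascSum y p j := by
  induction j with
  | zero => rfl
  | succ j ih => rw [ascSum, ascSum, ih fun i hi => h i (by omega), h j (by omega)]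

theorem ascSum_of_eq_zero {x y : ℕ → S} {p j : ℕ} (hp : y p = 0) (h : ∀ i, i ≠ p → y i = x i)
    (hj : p ≤ j) : ascSum y 0 (j + 1) = ascSum x (p + 1) (j + 1) := by
  induction j, hj using Nat.le_induction with
  | base => rw [ascSum_self, ascSum_succ _ (Nat.zero_le _), hp, mul_zero, add_zero]
  | succ j hj ih =>
    rw [ascSum_succ y (Nat.zero_le _), ih, ascSum_succ x (show p + 1 ≤ j + 1 by omega),
      h _ (by omega)]

theorem permSum_eq_shuffleSum_mul (hx : IsBraidSeq x) {y : ℕ → S} {p : ℕ} (hp : y p = 0)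
    (h : ∀ i, i ≠ p → y i = x i) (j : ℕ) :
    permSum x j = shuffleSum x j (p + 1) * permSum y j := by
  induction j with
  | zero => simp [permSum, shuffleSum]
  | succ j ih =>
    rw [permSum, ih, permSum, ← mul_assoc, ← mul_assoc]
    by_cases hj : p ≤ j
    · rw [ascSum_mul_shuffleSum hx (by omega), ascSum_of_eq_zero hp h hj]
    · rw [shuffleSum_of_lt x (by omega), shuffleSum_of_lt x (by omega), mul_one, one_mul,
        ascSum_congr fun i hi => (h i (by omega)).symm]

section Map

variable {S' : Type*} [Ring S'] (f : S →+* S') (x : ℕ → S)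

theorem map_ascSum (p j : ℕ) : f (ascSum x p j) = ascSum (fun i => f (x i)) p j := by
  induction j with
  | zero => simp [ascSum]
  | succ j ih => rw [ascSum, ascSum]; split_ifs <;> simp [ih]

theorem map_descProd (p j : ℕ) : f (descProd x p j) = descProd (fun i => f (x i)) p j := by
  induction j with
  | zero => rw [descProd, descProd]; split_ifs <;> simp
  | succ j ih => rw [descProd, descProd]; split_ifs <;> simp [ih]

theorem map_shuffleSum (j p : ℕ) : f (shuffleSum x j p) = shuffleSum (fun i => f (x i)) j p := by
  induction j generalizing p with
  | zero => simp [shuffleSum]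
  | succ j ih => cases p <;> simp [shuffleSum, ih, map_descProd]

theorem map_permSum (j : ℕ) : f (permSum x j) = permSum (fun i => f (x i)) j := by
  induction j with
  | zero => simp [permSum]
  | succ j ih => simp [permSum, ih, map_ascSum]

end Map

end BraidIdentities

section

open ArtinMonoid BraidMonoid BraidIdentities

section LenLT

variable {k : Type*} [CommRing k] {n : ℕ}

/-- The element `y` of the monoid algebra is a combination of braids of length less than `l`. -/
def LenLT (l : ℕ) (y : MonoidAlgebra k (BraidMonoid n)) : Prop :=
  ∀ a, l ≤ length a → y.coeff a = 0

theorem LenLT.mono {l m : ℕ} {y : MonoidAlgebra k (BraidMonoid n)} (h : LenLT l y) (hlm : l ≤ m) :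
    LenLT m y := fun a ha => h a (hlm.trans ha)

theorem LenLT.zero (l : ℕ) : LenLT l (0 : MonoidAlgebra k (BraidMonoid n)) := fun _ _ => rfl

theorem LenLT.add {l : ℕ} {y z : MonoidAlgebra k (BraidMonoid n)} (hy : LenLT l y)
    (hz : LenLT l z) : LenLT l (y + z) := fun a ha => by
  rw [MonoidAlgebra.coeff_add, Finsupp.add_apply, hy a ha, hz a ha, add_zero]

theorem LenLT.neg {l : ℕ} {y : MonoidAlgebra k (BraidMonoid n)} (hy : LenLT l y) :
    LenLT l (-y) := fun a ha => by
  rw [MonoidAlgebra.coeff_neg, Finsupp.neg_apply, hy a ha, neg_zero]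

theorem LenLT.sum {ι : Type*} {l : ℕ} (s : Finset ι) {f : ι → MonoidAlgebra k (BraidMonoid n)}
    (h : ∀ i ∈ s, LenLT l (f i)) : LenLT l (∑ i ∈ s, f i) := by
  classical
  induction s using Finset.induction_on with
  | empty => exact LenLT.zero l
  | insert i s hi ih =>
    rw [Finset.sum_insert hi]
    exact (h i (by simp)).add (ih fun j hj => h j (by simp [hj]))

theorem LenLT.single (a : BraidMonoid n) (r : k) {l : ℕ} (h : length a < l) :
    LenLT l (MonoidAlgebra.single a r) := fun b hb => by
  rw [MonoidAlgebra.coeff_single, Finsupp.single_eq_of_ne]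
  rintro rfl; omega

theorem LenLT.eq_zero {y : MonoidAlgebra k (BraidMonoid n)} (h : LenLT 0 y) : y = 0 := by
  ext a; exact h a (Nat.zero_le _)

theorem exists_lenLT (y : MonoidAlgebra k (BraidMonoid n)) : ∃ l, LenLT l y := by
  refine ⟨y.coeff.support.sup length + 1, fun a ha => ?_⟩
  by_contra h
  have := Finset.le_sup (f := length) (Finsupp.mem_support_iff.2 h)
  omega

theorem LenLT.mul {l m c : ℕ} {y z : MonoidAlgebra k (BraidMonoid n)} (hy : LenLT l y)
    (hz : LenLT m z) (h : l + m ≤ c + 1) : LenLT c (y * z) := fun a ha => by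
  classical
  rw [MonoidAlgebra.coeff_mul]
  refine Finset.sum_eq_zero fun b hb => Finset.sum_eq_zero fun d hd => if_neg ?_
  rintro rfl
  have h₁ : length b < l := by
    by_contra h'; exact Finsupp.mem_support_iff.1 hb (hy b (by omega))
  have h₂ : length d < m := by
    by_contra h'; exact Finsupp.mem_support_iff.1 hd (hz d (by omega))
  rw [length_mul] at ha
  omega

/-- The element `w` has leading monomial `d` with invertible coefficient. -/
def HasLead (w : MonoidAlgebra k (BraidMonoid n)) (d : BraidMonoid n) : Prop :=
  ∃ e : kˣ, LenLT (length d) (w - MonoidAlgebra.single d (e : k))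

theorem HasLead.lenLT {w : MonoidAlgebra k (BraidMonoid n)} {d : BraidMonoid n}
    (h : HasLead w d) : LenLT (length d + 1) w := by
  obtain ⟨e, he⟩ := h
  simpa using (he.mono (Nat.le_succ _)).add (LenLT.single d (e : k) (Nat.lt_succ_self _))

theorem HasLead.one : HasLead (1 : MonoidAlgebra k (BraidMonoid n)) 1 :=
  ⟨1, by rw [Units.val_one, ← MonoidAlgebra.one_def, sub_self]; exact LenLT.zero _⟩

theorem HasLead.mul {w w' : MonoidAlgebra k (BraidMonoid n)} {d d' : BraidMonoid n}
    (h : HasLead w d) (h' : HasLead w' d') : HasLead (w * w') (d * d') := by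
  have hw' := h'.lenLT
  obtain ⟨e, he⟩ := h
  obtain ⟨e', he'⟩ := h'
  refine ⟨e * e', ?_⟩
  have : w * w' - MonoidAlgebra.single (d * d') ((e * e' : kˣ) : k) =
      (w - MonoidAlgebra.single d (e : k)) * w' +
        MonoidAlgebra.single d (e : k) * (w' - MonoidAlgebra.single d' (e' : k)) := by
    rw [sub_mul, mul_sub, MonoidAlgebra.single_mul_single, Units.val_mul]; abel
  rw [this, length_mul]
  exact (he.mul hw' (by omega)).add
    ((LenLT.single d _ (Nat.lt_succ_self _)).mul he' (by omega))

theorem HasLead.add_lenLT {w y : MonoidAlgebra k (BraidMonoid n)} {d : BraidMonoid n}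
    (h : HasLead w d) (hy : LenLT (length d) y) : HasLead (y + w) d := by
  obtain ⟨e, he⟩ := h
  exact ⟨e, by rw [add_sub_assoc]; exact hy.add he⟩

theorem HasLead.lenLT_of_mul {w : MonoidAlgebra k (BraidMonoid n)} {d : BraidMonoid n}
    (h : HasLead w d) {c : ℕ} {y : MonoidAlgebra k (BraidMonoid n)} (hy : LenLT c (y * w)) :
    LenLT (c - length d) y := by
  obtain ⟨e, he⟩ := h
  obtain ⟨M, hM⟩ := exists_lenLT y
  suffices ∀ i, LenLT (c - length d + i) y → LenLT (c - length d) y from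
    this M (hM.mono (by omega))
  intro i
  induction i with
  | zero => exact id
  | succ i ih =>
    intro hi
    refine ih fun a ha => ?_
    rcases ha.lt_or_eq with ha | ha
    · exact hi a (by omega)
    have h₁ : (y * (w - MonoidAlgebra.single d (e : k))).coeff (a * d) = 0 :=
      hi.mul he (c := length a + length d) (by omega) _ (by simp)
    have h₂ : (y * w).coeff (a * d) = 0 := hy _ (by rw [length_mul]; omega)
    rw [mul_sub, MonoidAlgebra.coeff_sub, Finsupp.sub_apply, h₂, zero_sub, neg_eq_zero,
      MonoidAlgebra.coeff_mul_single_mul] at h₁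
    exact (Units.mul_left_eq_zero e).1 h₁

theorem HasLead.mul_right_cancel {w : MonoidAlgebra k (BraidMonoid n)} {d : BraidMonoid n}
    (h : HasLead w d) {y z : MonoidAlgebra k (BraidMonoid n)} (hy : y * w = z * w) : y = z := by
  have : LenLT 0 ((y - z) * w) := by rw [sub_mul, hy, sub_self]; exact LenLT.zero _
  exact sub_eq_zero.1 ((h.lenLT_of_mul this).mono (by omega)).eq_zero

theorem HasLead.rdvd_of_coeff_ne_zero {w : MonoidAlgebra k (BraidMonoid n)} {d : BraidMonoid n}
    (h : HasLead w d) {y : MonoidAlgebra k (BraidMonoid n)} {b : BraidMonoid n}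
    (hy : LenLT (length b + 1) (y * w)) (hb : (y * w).coeff b ≠ 0) : RDvd d b := by
  have h₁ := h.lenLT_of_mul hy
  obtain ⟨e, he⟩ := h
  by_contra hd
  apply hb
  by_cases hlen : length d ≤ length b + 1
  · have h₂ : (y * (w - MonoidAlgebra.single d (e : k))).coeff b = 0 :=
      h₁.mul he (c := length b) (by omega) _ le_rfl
    rwa [mul_sub, MonoidAlgebra.coeff_sub, Finsupp.sub_apply,
      MonoidAlgebra.coeff_mul_single_of_forall_mul_ne _ _ (fun c hc => hd ⟨c, hc.symm⟩),
      sub_zero] at h₂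
  · rw [(h₁.mono (show _ ≤ 0 by omega)).eq_zero]; simp

theorem HasLead.exists_approx {w : MonoidAlgebra k (BraidMonoid n)} {d : BraidMonoid n}
    (h : HasLead w d) {m : ℕ} {y : MonoidAlgebra k (BraidMonoid n)}
    (hy : ∀ b, y.coeff b ≠ 0 → length b = m ∧ RDvd d b) : ∃ f, LenLT m (f * w - y) := by
  obtain ⟨e, he⟩ := h
  have : ∀ b, ∃ f, y.coeff b ≠ 0 → LenLT m (f * w - MonoidAlgebra.single b (y.coeff b)) := by
    intro b
    by_cases hb : y.coeff b = 0
    · exact ⟨0, fun h => absurd hb h⟩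
    obtain ⟨hl, c, rfl⟩ := hy b hb
    refine ⟨MonoidAlgebra.single c (y.coeff (c * d) * ((e⁻¹ : kˣ) : k)), fun _ => ?_⟩
    have : MonoidAlgebra.single (c * d) (y.coeff (c * d)) =
        MonoidAlgebra.single c (y.coeff (c * d) * ((e⁻¹ : kˣ) : k)) *
          MonoidAlgebra.single d (e : k) := by
      rw [MonoidAlgebra.single_mul_single, mul_assoc, Units.inv_mul, mul_one]
    rw [this, ← mul_sub]
    rw [length_mul] at hl
    exact (LenLT.single c _ (Nat.lt_succ_self _)).mul he (by omega)
  choose f hf using this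
  refine ⟨∑ b ∈ y.coeff.support, f b, ?_⟩
  have hys : y = ∑ b ∈ y.coeff.support, MonoidAlgebra.single b (y.coeff b) :=
    (MonoidAlgebra.sum_coeff_single y).symm
  have : (∑ b ∈ y.coeff.support, f b) * w - y =
      ∑ b ∈ y.coeff.support, (f b * w - MonoidAlgebra.single b (y.coeff b)) := by
    rw [Finset.sum_sub_distrib, Finset.sum_mul, ← hys]
  rw [this]
  exact LenLT.sum _ fun b hb => hf b (Finsupp.mem_support_iff.1 hb)

end LenLT

section Weights

variable (k : Type*) [CommRing k] {n : ℕ}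

/-- The negatives of the generators in `Γ`, with zeros inserted elsewhere. -/
noncomputable def negGen (n : ℕ) (Γ : Finset ℕ) (j : ℕ) : MonoidAlgebra k (BraidMonoid n) :=
  if j ∈ Γ then -MonoidAlgebra.of k _ (sigma n j) else 0

theorem isBraidSeq_negGen {Γ : Finset ℕ} (hΓ : Γ ⊆ Finset.range n) :
    IsBraidSeq (negGen k n Γ) where
  braid i := by
    by_cases h : i ∈ Γ <;> by_cases h' : i + 1 ∈ Γ <;> simp only [negGen, h, h', if_true, if_false,
      mul_zero, zero_mul]
    simp only [neg_mul, mul_neg, neg_neg]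
    rw [← map_mul, ← map_mul, ← map_mul, ← map_mul, sigma_braid (Finset.mem_range.1 (hΓ h'))]
  comm {i j} hij := by
    by_cases h : i ∈ Γ <;> by_cases h' : j ∈ Γ <;> simp only [negGen, h, h', if_true, if_false,
      Commute.zero_left, Commute.zero_right]
    refine (Commute.neg_right (Commute.neg_left ?_))
    rw [commute_iff_eq, ← map_mul, ← map_mul, sigma_comm hij]

theorem hasLead_ascSum {Γ : Finset ℕ} (hΓ : Γ ⊆ Finset.range n) (t : ℕ) :
    HasLead (ascSum (negGen k n Γ) 0 t) (tau n Γ t) := by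
  induction t with
  | zero => exact HasLead.one
  | succ t ih =>
    rw [ascSum_succ _ (Nat.zero_le _), tau]
    by_cases h : t ∈ Γ
    · rw [if_pos h]
      have hl := length_sigma (Finset.mem_range.1 (hΓ h))
      refine HasLead.add_lenLT (ih.mul ⟨-1, ?_⟩) ?_
      · rw [negGen, if_pos h, MonoidAlgebra.of_apply, Units.val_neg, Units.val_one,
          MonoidAlgebra.single_neg, sub_self]
        exact LenLT.zero _
      · rw [MonoidAlgebra.one_def]
        exact LenLT.single _ _ (by simp [hl])
    · rw [if_neg h, negGen, if_neg h, mul_zero, add_zero]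
      exact HasLead.one

theorem hasLead_permSum {Γ : Finset ℕ} (hΓ : Γ ⊆ Finset.range n) (t : ℕ) :
    HasLead (permSum (negGen k n Γ) t) (garside n Γ t) := by
  induction t with
  | zero => exact HasLead.one
  | succ t ih => exact (hasLead_ascSum k hΓ (t + 1)).mul ih

/-- The coefficients of the boundary map. -/
noncomputable def bdCoeff (n : ℕ) (Γ : Finset ℕ) (s : ℕ) : MonoidAlgebra k (BraidMonoid n) :=
  shuffleSum (negGen k n Γ) n (s + 1)

theorem permSum_negGen_eq {Γ : Finset ℕ} (hΓ : Γ ⊆ Finset.range n) (s : ℕ) :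
    permSum (negGen k n Γ) n = bdCoeff k n Γ s * permSum (negGen k n (Γ.erase s)) n :=
  permSum_eq_shuffleSum_mul (isBraidSeq_negGen k hΓ) (by simp [negGen])
    (fun i hi => by simp [negGen, hi]) n

end Weights

end

section

open ArtinMonoid BraidMonoid BraidIdentities

section Boundary

/-- The incidence sign of `insert s Γ` and `Γ`. -/
def incSign (Γ : Finset ℕ) (s : ℕ) : ℤ := (-1) ^ (Γ.filter (s < ·)).card

theorem incSign_of_forall_le {Γ : Finset ℕ} {s : ℕ} (h : ∀ t ∈ Γ, t ≤ s) : incSign Γ s = 1 := by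
  rw [incSign, Finset.filter_false_of_mem (fun t ht => not_lt.2 (h t ht)), Finset.card_empty,
    pow_zero]

theorem incSign_insert_of_lt {Γ : Finset ℕ} {s m : ℕ} (hm : m ∉ Γ) (h : s < m) :
    incSign (insert m Γ) s = -incSign Γ s := by
  rw [incSign, incSign, Finset.filter_insert, if_pos h, Finset.card_insert_of_notMem (by simp [hm]),
    pow_succ, mul_neg_one]

theorem incSign_insert_of_le {Γ : Finset ℕ} {s m : ℕ} (h : m ≤ s) :
    incSign (insert m Γ) s = incSign Γ s := by
  rw [incSign, incSign, Finset.filter_insert, if_neg (not_lt.2 h)]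

theorem incSign_mul_antisymm {Γ : Finset ℕ} {s t : ℕ} (hs : s ∉ Γ) (ht : t ∉ Γ) (hst : s ≠ t) :
    incSign Γ s * incSign (insert s Γ) t = -(incSign Γ t * incSign (insert t Γ) s) := by
  rcases hst.lt_or_gt with h | h
  · rw [incSign_insert_of_lt ht h, incSign_insert_of_le h.le]; ring
  · rw [incSign_insert_of_lt hs h, incSign_insert_of_le h.le]; ring

variable {M : Type*} [AddCommGroup M]

/-- The boundary operator of the full simplex on `{0, …, n - 1}`, indexed by complements. -/
def bd (n : ℕ) (u : Finset ℕ → M) (Γ : Finset ℕ) : M :=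
  ∑ s ∈ Finset.range n \ Γ, incSign Γ s • u (insert s Γ)

theorem bd_bd (n : ℕ) (u : Finset ℕ → M) (Γ : Finset ℕ) : bd n (bd n u) Γ = 0 := by
  have : bd n (bd n u) Γ = ∑ p ∈ (Finset.range n \ Γ).offDiag,
      (incSign Γ p.1 * incSign (insert p.1 Γ) p.2) • u (insert p.2 (insert p.1 Γ)) := by
    rw [Finset.sum_finset_product (f := fun p : ℕ × ℕ =>
      (incSign Γ p.1 * incSign (insert p.1 Γ) p.2) • u (insert p.2 (insert p.1 Γ)))
      (Finset.range n \ Γ).offDiag (Finset.range n \ Γ) (fun s => Finset.range n \ (insert s Γ))]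
    · simp only [bd, Finset.smul_sum, smul_smul]
    · rintro ⟨s, t⟩
      simp only [Finset.mem_offDiag, Finset.mem_sdiff, Finset.mem_insert, ne_eq]
      tauto
  rw [this]
  refine Finset.sum_involution (fun p _ => (p.2, p.1)) ?_ ?_ ?_ ?_
  · rintro ⟨s, t⟩ h
    simp only [Finset.mem_offDiag, Finset.mem_sdiff] at h
    simp only
    rw [Finset.insert_comm, incSign_mul_antisymm h.1.2 h.2.1.2 h.2.2, neg_smul, neg_add_cancel]
  · rintro ⟨s, t⟩ h _ h'
    simp only [Finset.mem_offDiag] at h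
    exact h.2.2 (Prod.ext_iff.1 h').2
  · rintro ⟨s, t⟩ h
    simp only [Finset.mem_offDiag] at h ⊢
    exact ⟨h.2.1, h.1, h.2.2.symm⟩
  · intros; rfl

theorem bd_congr {n : ℕ} {u v : Finset ℕ → M} {Γ : Finset ℕ} (hΓ : Γ ⊆ Finset.range n)
    (h : ∀ Γ ⊆ Finset.range n, u Γ = v Γ) : bd n u Γ = bd n v Γ :=
  Finset.sum_congr rfl fun s hs => by
    rw [h _ (Finset.insert_subset (Finset.mem_sdiff.1 hs).1 hΓ)]

theorem bd_sub (n : ℕ) (u v : Finset ℕ → M) (Γ : Finset ℕ) :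
    bd n (u - v) Γ = bd n u Γ - bd n v Γ := by
  simp only [bd, Pi.sub_apply, smul_sub, Finset.sum_sub_distrib]

theorem bd_add (n : ℕ) (u v : Finset ℕ → M) (Γ : Finset ℕ) :
    bd n (u + v) Γ = bd n u Γ + bd n v Γ := by
  simp only [bd, Pi.add_apply, smul_add, Finset.sum_add_distrib]

theorem map_bd {M' : Type*} [AddCommGroup M'] (φ : M →+ M') (n : ℕ) (u : Finset ℕ → M)
    (Γ : Finset ℕ) : φ (bd n u Γ) = bd n (fun Γ => φ (u Γ)) Γ := by
  simp only [bd, map_sum, map_zsmul]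

theorem bd_eq_zero_of_card {n c : ℕ} {u : Finset ℕ → M} (h : ∀ Γ, Γ.card ≠ c + 1 → u Γ = 0)
    {Γ : Finset ℕ} (hΓ : Γ.card ≠ c) : bd n u Γ = 0 :=
  Finset.sum_eq_zero fun s hs => by
    rw [h, smul_zero]
    rw [Finset.card_insert_of_notMem (Finset.mem_sdiff.1 hs).2]
    omega

end Boundary

section Exactness

variable {k : Type*} [CommRing k] {n : ℕ}

theorem exists_max_sigma_rdvd {b : BraidMonoid n} (hb : b ≠ 1) :
    ∃ m < n, RDvd (sigma n m) b ∧ ∀ s < n, RDvd (sigma n s) b → s ≤ m := by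
  classical
  have hne : ((Finset.range n).filter fun s => RDvd (sigma n s) b).Nonempty := by
    obtain ⟨s, c, rfl⟩ := exists_eq_mul_gen hb
    refine ⟨s, ?_⟩
    rw [Finset.mem_filter, Finset.mem_range]
    exact ⟨s.2, c, by rw [sigma_of_lt s.2]⟩
  obtain ⟨hm₁, hm₂⟩ := Finset.mem_filter.1 (Finset.max'_mem _ hne)
  refine ⟨_, Finset.mem_range.1 hm₁, hm₂, fun s hs hsb => Finset.le_max' _ _ ?_⟩
  rw [Finset.mem_filter, Finset.mem_range]
  exact ⟨hs, hsb⟩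

theorem sigma_rdvd_of_coeff_ne_zero {Γ : Finset ℕ} (hΓ : Γ ⊆ Finset.range n)
    {y : MonoidAlgebra k (BraidMonoid n)} (hy : ∃ f, y = f * permSum (negGen k n Γ) n)
    {b : BraidMonoid n} (hl : LenLT (length b + 1) y) (hb : y.coeff b ≠ 0) {s : ℕ} (hs : s ∈ Γ) :
    RDvd (sigma n s) b := by
  obtain ⟨f, rfl⟩ := hy
  exact (sigma_rdvd_garside le_rfl (Finset.mem_range.1 (hΓ hs)) hs).trans
    ((hasLead_permSum k hΓ n).rdvd_of_coeff_ne_zero hl hb)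

theorem exists_bd_eq_mul {v : Finset ℕ → MonoidAlgebra k (BraidMonoid n)}
    (hv : ∀ Γ ⊆ Finset.range n, ∃ f, v Γ = f * permSum (negGen k n Γ) n) {Γ : Finset ℕ}
    (hΓ : Γ ⊆ Finset.range n) : ∃ f, bd n v Γ = f * permSum (negGen k n Γ) n := by
  have : ∀ s ∈ Finset.range n \ Γ, ∃ f, v (insert s Γ) = f * permSum (negGen k n Γ) n := by
    intro s hs
    rw [Finset.mem_sdiff] at hs
    have h' := Finset.insert_subset hs.1 hΓ
    obtain ⟨f, hf⟩ := hv _ h'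
    refine ⟨f * bdCoeff k n (insert s Γ) s, ?_⟩
    rw [hf, permSum_negGen_eq k h' s, Finset.erase_insert hs.2, mul_assoc]
  choose! f hf using this
  refine ⟨∑ s ∈ Finset.range n \ Γ, incSign Γ s • f s, ?_⟩
  rw [bd, Finset.sum_mul]
  exact Finset.sum_congr rfl fun s hs => by rw [hf s hs, smul_mul_assoc]

theorem coeff_bd (v : Finset ℕ → MonoidAlgebra k (BraidMonoid n)) (Γ : Finset ℕ)
    (b : BraidMonoid n) : (bd n v Γ).coeff b = bd n (fun Γ => (v Γ).coeff b) Γ :=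
  map_bd ((Finsupp.applyAddHom b).comp
    (MonoidAlgebra.coeffAddEquiv (R := k) (M := BraidMonoid n)).toAddMonoidHom) n v Γ

/-- The combinatorial core of acyclicity: coning off the last right divisor of a braid. -/
theorem bd_ite_mem_erase {c : Finset ℕ → k} {m : ℕ} (hm : m < n)
    (hc : ∀ Γ ⊆ Finset.range n, c Γ ≠ 0 → ∀ s ∈ Γ, s ≤ m)
    (hbd : ∀ Γ ⊆ Finset.range n, bd n c Γ = 0) {Γ : Finset ℕ} (hΓ : Γ ⊆ Finset.range n) :
    bd n (fun Γ => if m ∈ Γ then c (Γ.erase m) else 0) Γ = c Γ := by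
  by_cases hmΓ : m ∈ Γ
  · obtain ⟨Γ', hm', rfl⟩ : ∃ Γ', m ∉ Γ' ∧ Γ = insert m Γ' :=
      ⟨Γ.erase m, Finset.notMem_erase _ _, (Finset.insert_erase hmΓ).symm⟩
    have hΓ' : Γ' ⊆ Finset.range n := (Finset.subset_insert _ _).trans hΓ
    have h := hbd Γ' hΓ'
    have hset : Finset.range n \ Γ' = insert m (Finset.range n \ insert m Γ') := by
      ext x
      simp only [Finset.mem_sdiff, Finset.mem_insert, Finset.mem_range]
      by_cases hx : x = m
      · subst hx; simp [hm, hm']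
      · simp [hx]
    rw [bd, hset, Finset.sum_insert (by simp)] at h
    have h₁ : incSign Γ' m • c (insert m Γ') = c (insert m Γ') := by
      by_cases h0 : c (insert m Γ') = 0
      · rw [h0, smul_zero]
      · rw [incSign_of_forall_le fun t ht => hc _ hΓ h0 t (Finset.mem_insert_of_mem ht), one_smul]
    rw [h₁] at h
    rw [eq_neg_of_add_eq_zero_left h, bd, ← Finset.sum_neg_distrib]
    refine Finset.sum_congr rfl fun s hs => ?_
    simp only [Finset.mem_sdiff, Finset.mem_insert, not_or] at hs
    rw [if_pos (by simp), Finset.insert_comm, Finset.erase_insert (by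
      simp only [Finset.mem_insert, not_or]; exact ⟨fun h => hs.2.1 h.symm, hm'⟩)]
    by_cases h0 : c (insert s Γ') = 0
    · rw [h0, smul_zero, smul_zero, neg_zero]
    · have := hc _ (Finset.insert_subset hs.1 hΓ') h0 s (by simp)
      rw [incSign_insert_of_lt hm' (lt_of_le_of_ne this hs.2.1), neg_smul]
  · rw [bd, Finset.sum_eq_single m]
    · rw [if_pos (by simp), Finset.erase_insert hmΓ]
      by_cases h0 : c Γ = 0
      · rw [h0, smul_zero]
      · rw [incSign_of_forall_le (hc _ hΓ h0), one_smul]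
    · intro s hs hsm
      rw [if_neg, smul_zero]
      simp only [Finset.mem_insert, not_or]
      exact ⟨fun h => hsm h.symm, hmΓ⟩
    · intro h
      exact absurd (Finset.mem_sdiff.2 ⟨Finset.mem_range.2 hm, hmΓ⟩) h

/-- One step of the reduction of the length of a cycle. -/
theorem exists_bd_approx {c w : ℕ} (hw : w ≠ 0) {u : Finset ℕ → MonoidAlgebra k (BraidMonoid n)}
    (hu : ∀ Γ ⊆ Finset.range n, ∃ f, u Γ = f * permSum (negGen k n Γ) n)
    (hc : ∀ Γ, Γ.card ≠ c → u Γ = 0) (hbd : ∀ Γ ⊆ Finset.range n, bd n u Γ = 0)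
    (hlen : ∀ Γ ⊆ Finset.range n, LenLT (w + 1) (u Γ)) :
    ∃ v : Finset ℕ → MonoidAlgebra k (BraidMonoid n),
      (∀ Γ ⊆ Finset.range n, ∃ f, v Γ = f * permSum (negGen k n Γ) n) ∧
      (∀ Γ, Γ.card ≠ c + 1 → v Γ = 0) ∧
      ∀ Γ ⊆ Finset.range n, LenLT w (u Γ - bd n v Γ) := by
  classical
  have hne : ∀ b : BraidMonoid n, length b = w → b ≠ 1 := by
    rintro b hb rfl; exact hw (by rw [← hb, length_one])
  have := fun (b : BraidMonoid n) (hb : length b = w) => exists_max_sigma_rdvd (hne b hb)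
  choose! m hmn hmd hmax using this
  have hdvd : ∀ b : BraidMonoid n, length b = w → ∀ Γ ⊆ Finset.range n, (u Γ).coeff b ≠ 0 →
      ∀ s ∈ Γ, RDvd (sigma n s) b := fun b hb Γ hΓ h0 s hs =>
    sigma_rdvd_of_coeff_ne_zero hΓ (hu Γ hΓ) (by rw [hb]; exact hlen Γ hΓ) h0 hs
  -- the cone on the top degree part of `u`
  let y : Finset ℕ → MonoidAlgebra k (BraidMonoid n) := fun Γ => MonoidAlgebra.ofCoeff
    (Finsupp.onFinset ((Finset.range n).biUnion fun s => (u (Γ.erase s)).coeff.support)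
      (fun b => if length b = w then (if m b ∈ Γ then (u (Γ.erase (m b))).coeff b else 0) else 0)
      (fun b hb => by
        rw [ite_ne_right_iff] at hb
        obtain ⟨hb, hb'⟩ := hb
        rw [ite_ne_right_iff] at hb'
        exact Finset.mem_biUnion.2 ⟨m b, Finset.mem_range.2 (hmn b hb),
          Finsupp.mem_support_iff.2 hb'.2⟩))
  have hy : ∀ Γ b, (y Γ).coeff b =
      if length b = w then (if m b ∈ Γ then (u (Γ.erase (m b))).coeff b else 0) else 0 :=
    fun Γ b => rfl
  have happ : ∀ Γ ⊆ Finset.range n, ∃ f, LenLT w (f * permSum (negGen k n Γ) n - y Γ) := by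
    intro Γ hΓ
    refine (hasLead_permSum k hΓ n).exists_approx fun b hb => ?_
    rw [hy, ite_ne_right_iff] at hb
    obtain ⟨hb, hb'⟩ := hb
    rw [ite_ne_right_iff] at hb'
    refine ⟨hb, garside_rdvd le_rfl fun s hs hsn => ?_⟩
    by_cases hsm : s = m b
    · rw [hsm]; exact hmd b hb
    · exact hdvd b hb _ ((Finset.erase_subset _ _).trans hΓ) hb'.2 s (Finset.mem_erase.2 ⟨hsm, hs⟩)
  choose! f hf using happ
  let v : Finset ℕ → MonoidAlgebra k (BraidMonoid n) := fun Γ =>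
    if Γ.card = c + 1 then f Γ * permSum (negGen k n Γ) n else 0
  have hv : ∀ Γ ⊆ Finset.range n, LenLT w (v Γ - y Γ) := by
    intro Γ hΓ
    by_cases h : Γ.card = c + 1
    · simp only [v, if_pos h]; exact hf Γ hΓ
    · simp only [v, if_neg h]
      have : y Γ = 0 := by
        ext b
        rw [hy]
        split_ifs with hb hb'
        · rw [hc _ (by rw [Finset.card_erase_of_mem hb']
                       have := Finset.card_pos.2 ⟨_, hb'⟩
                       omega)]
        · rfl
        · rfl
      rw [this, sub_zero]; exact LenLT.zero _
  refine ⟨v, fun Γ hΓ => ?_, fun Γ h => if_neg h, fun Γ hΓ b hb => ?_⟩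
  · by_cases h : Γ.card = c + 1
    · exact ⟨_, if_pos h⟩
    · exact ⟨0, by simp only [v, if_neg h, zero_mul]⟩
  · have hvy : ∀ Γ ⊆ Finset.range n, (v Γ).coeff b = (y Γ).coeff b := fun Γ hΓ =>
      sub_eq_zero.1 (by simpa using hv Γ hΓ b hb)
    rw [MonoidAlgebra.coeff_sub, Finsupp.sub_apply, coeff_bd, bd_congr hΓ hvy]
    rcases hb.lt_or_eq with hb | hb
    · rw [hlen Γ hΓ b hb, zero_sub, neg_eq_zero]
      exact Finset.sum_eq_zero fun s _ => by beta_reduce; rw [hy, if_neg hb.ne', smul_zero]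
    · rw [sub_eq_zero, bd_congr (v := fun Γ => if m b ∈ Γ then (u (Γ.erase (m b))).coeff b else 0) hΓ
        (fun Γ _ => by rw [hy, if_pos hb.symm])]
      symm
      refine bd_ite_mem_erase (c := fun Γ => (u Γ).coeff b) (hmn b hb.symm) ?_ ?_ hΓ
      · exact fun Γ hΓ h0 s hs => hmax b hb.symm s (Finset.mem_range.1 (hΓ hs))
          (hdvd b hb.symm Γ hΓ h0 s hs)
      · intro Γ hΓ
        rw [← coeff_bd, hbd Γ hΓ]; rfl

theorem exists_bd_of_bd_eq_zero {c : ℕ} (w : ℕ) (u : Finset ℕ → MonoidAlgebra k (BraidMonoid n))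
    (hu : ∀ Γ ⊆ Finset.range n, ∃ f, u Γ = f * permSum (negGen k n Γ) n)
    (hc : ∀ Γ, Γ.card ≠ c → u Γ = 0) (hbd : ∀ Γ ⊆ Finset.range n, bd n u Γ = 0)
    (hlen : ∀ Γ ⊆ Finset.range n, LenLT w (u Γ)) :
    ∃ (v : Finset ℕ → MonoidAlgebra k (BraidMonoid n)) (r : k),
      (∀ Γ ⊆ Finset.range n, ∃ f, v Γ = f * permSum (negGen k n Γ) n) ∧
      (∀ Γ, Γ.card ≠ c + 1 → v Γ = 0) ∧
      ∀ Γ ⊆ Finset.range n,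
        u Γ = bd n v Γ + if Γ = ∅ then MonoidAlgebra.single 1 r else 0 := by
  induction w generalizing u with
  | zero =>
    refine ⟨0, 0, fun Γ _ => ⟨0, by simp⟩, fun _ _ => rfl, fun Γ hΓ => ?_⟩
    rw [(hlen Γ hΓ).eq_zero]
    simp [bd]
  | succ w ih =>
    by_cases hw : w = 0
    · subst hw
      refine ⟨0, (u ∅).coeff 1, fun Γ _ => ⟨0, by simp⟩, fun _ _ => rfl, fun Γ hΓ => ?_⟩
      have : bd n (0 : Finset ℕ → MonoidAlgebra k (BraidMonoid n)) Γ = 0 := by simp [bd]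
      rw [this, zero_add]
      ext b
      by_cases hb : b = 1
      · subst hb
        split_ifs with h
        · subst h; simp
        · obtain ⟨s, hs⟩ := Finset.nonempty_iff_ne_empty.2 h
          by_contra h0
          have := (sigma_rdvd_of_coeff_ne_zero hΓ (hu Γ hΓ) (by simpa using hlen Γ hΓ) h0
            hs).length_le
          rw [length_sigma (Finset.mem_range.1 (hΓ hs)), length_one] at this
          omega
      · rw [hlen Γ hΓ b (Nat.one_le_iff_ne_zero.2 fun h => hb (length_eq_zero.1 h))]
        split_ifs
        · rw [MonoidAlgebra.coeff_single, Finsupp.single_eq_of_ne hb]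
        · rfl
    · obtain ⟨v, hv, hvc, hlv⟩ := exists_bd_approx hw hu hc hbd hlen
      have h₁ : ∀ Γ ⊆ Finset.range n, ∃ f, (u - bd n v) Γ = f * permSum (negGen k n Γ) n := by
        intro Γ hΓ
        obtain ⟨f, hf⟩ := hu Γ hΓ
        obtain ⟨f', hf'⟩ := exists_bd_eq_mul hv hΓ
        exact ⟨f - f', by rw [Pi.sub_apply, hf, hf', sub_mul]⟩
      have h₂ : ∀ Γ, Γ.card ≠ c → (u - bd n v) Γ = 0 := by
        intro Γ h
        rw [Pi.sub_apply, hc Γ h, bd_eq_zero_of_card hvc h, sub_zero]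
      have h₃ : ∀ Γ ⊆ Finset.range n, bd n (u - bd n v) Γ = 0 := by
        intro Γ hΓ
        rw [bd_sub, bd_bd, hbd Γ hΓ, sub_zero]
      obtain ⟨v', r, hv', hvc', h⟩ := ih (u - bd n v) h₁ h₂ h₃ hlv
      refine ⟨v' + v, r, fun Γ hΓ => ?_, fun Γ h => ?_, fun Γ hΓ => ?_⟩
      · obtain ⟨f, hf⟩ := hv Γ hΓ
        obtain ⟨f', hf'⟩ := hv' Γ hΓ
        exact ⟨f' + f, by rw [Pi.add_apply, hf, hf', add_mul]⟩
      · rw [Pi.add_apply, hvc Γ h, hvc' Γ h, add_zero]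
      · rw [bd_add, add_right_comm, ← h Γ hΓ, Pi.sub_apply, sub_add_cancel]

end Exactness

end

section

open ArtinMonoid BraidMonoid BraidIdentities

section GroupRing

variable (k : Type*) [CommRing k] (n : ℕ)

/-- The inclusion of the monoid algebra of the braid monoid in the group algebra. -/
noncomputable def toGroupRing :
    MonoidAlgebra k (BraidMonoid n) →+* MonoidAlgebra k (BraidGroup (n + 1)) :=
  MonoidAlgebra.mapDomainRingHom k (toBraidGroup n)

variable {k n}

theorem toGroupRing_single (a : BraidMonoid n) (r : k) :
    toGroupRing k n (MonoidAlgebra.single a r) = MonoidAlgebra.single (toBraidGroup n a) r :=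
  MonoidAlgebra.mapDomain_single

theorem toGroupRing_injective : Function.Injective (toGroupRing k n) :=
  MonoidAlgebra.mapDomain_injective (toBraidGroup_injective n)

theorem single_pow_mul_cancel (m : ℕ) (y : MonoidAlgebra k (BraidGroup (n + 1))) :
    MonoidAlgebra.single ((toBraidGroup n (fundamental n) ^ m)⁻¹) (1 : k) *
      (MonoidAlgebra.single (toBraidGroup n (fundamental n) ^ m) 1 * y) = y := by
  rw [← mul_assoc, MonoidAlgebra.single_mul_single, inv_mul_cancel, mul_one,
    ← MonoidAlgebra.one_def, one_mul]

theorem exists_pow_mul_eq_toGroupRing (y : MonoidAlgebra k (BraidGroup (n + 1))) :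
    ∃ K, ∀ m, K ≤ m → ∃ a, MonoidAlgebra.single (toBraidGroup n (fundamental n) ^ m) (1 : k) * y =
      toGroupRing k n a := by
  induction y using MonoidAlgebra.induction_linear with
  | zero => exact ⟨0, fun m _ => ⟨0, by simp⟩⟩
  | add y z hy hz =>
    obtain ⟨K, hK⟩ := hy
    obtain ⟨L, hL⟩ := hz
    refine ⟨max K L, fun m hm => ?_⟩
    obtain ⟨a, ha⟩ := hK m ((le_max_left _ _).trans hm)
    obtain ⟨b, hb⟩ := hL m ((le_max_right _ _).trans hm)
    exact ⟨a + b, by rw [mul_add, ha, hb, map_add]⟩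
  | single g r =>
    obtain ⟨K, hK⟩ := BraidGroup.exists_fundamental_pow_mul g
    refine ⟨K, fun m hm => ?_⟩
    obtain ⟨a, ha⟩ := hK m hm
    exact ⟨MonoidAlgebra.single a r, by
      rw [MonoidAlgebra.single_mul_single, ha, one_mul, toGroupRing_single]⟩

theorem toGroupRing_permSum_cancel {Γ : Finset ℕ} (hΓ : Γ ⊆ Finset.range n)
    {y : MonoidAlgebra k (BraidGroup (n + 1))}
    (hy : y * toGroupRing k n (permSum (negGen k n Γ) n) = 0) : y = 0 := by
  obtain ⟨K, hK⟩ := exists_pow_mul_eq_toGroupRing y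
  obtain ⟨a, ha⟩ := hK K le_rfl
  have h₁ : a * permSum (negGen k n Γ) n = 0 * permSum (negGen k n Γ) n :=
    toGroupRing_injective (by rw [map_mul, ← ha, mul_assoc, hy, mul_zero, zero_mul, map_zero])
  rw [(hasLead_permSum k hΓ n).mul_right_cancel h₁, map_zero] at ha
  rw [← single_pow_mul_cancel K y, ha, mul_zero]

/-- The boundary operator of the Salvetti complex. -/
noncomputable def salvettiBd (f : Finset ℕ → MonoidAlgebra k (BraidGroup (n + 1))) (Γ : Finset ℕ) :
    MonoidAlgebra k (BraidGroup (n + 1)) :=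
  ∑ s ∈ Finset.range n \ Γ,
    incSign Γ s • (f (insert s Γ) * toGroupRing k n (bdCoeff k n (insert s Γ) s))

theorem mul_salvettiBd (y : MonoidAlgebra k (BraidGroup (n + 1)))
    (f : Finset ℕ → MonoidAlgebra k (BraidGroup (n + 1))) (Γ : Finset ℕ) :
    y * salvettiBd f Γ = salvettiBd (fun Γ => y * f Γ) Γ := by
  rw [salvettiBd, Finset.mul_sum]
  exact Finset.sum_congr rfl fun s _ => by rw [mul_smul_comm, mul_assoc]

theorem salvettiBd_mul (f : Finset ℕ → MonoidAlgebra k (BraidGroup (n + 1))) {Γ : Finset ℕ}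
    (hΓ : Γ ⊆ Finset.range n) :
    salvettiBd f Γ * toGroupRing k n (permSum (negGen k n Γ) n) =
      bd n (fun Γ => f Γ * toGroupRing k n (permSum (negGen k n Γ) n)) Γ := by
  rw [salvettiBd, Finset.sum_mul]
  refine Finset.sum_congr rfl fun s hs => ?_
  rw [Finset.mem_sdiff] at hs
  beta_reduce
  rw [permSum_negGen_eq k (Finset.insert_subset hs.1 hΓ) s, Finset.erase_insert hs.2, map_mul,
    smul_mul_assoc, mul_assoc]

theorem salvettiBd_congr {f f' : Finset ℕ → MonoidAlgebra k (BraidGroup (n + 1))} {Γ : Finset ℕ}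
    (hΓ : Γ ⊆ Finset.range n) (h : ∀ Γ ⊆ Finset.range n, f Γ = f' Γ) :
    salvettiBd f Γ = salvettiBd f' Γ :=
  Finset.sum_congr rfl fun s hs => by
    rw [h _ (Finset.insert_subset (Finset.mem_sdiff.1 hs).1 hΓ)]

theorem salvettiBd_salvettiBd (f : Finset ℕ → MonoidAlgebra k (BraidGroup (n + 1))) {Γ : Finset ℕ}
    (hΓ : Γ ⊆ Finset.range n) : salvettiBd (salvettiBd f) Γ = 0 := by
  refine toGroupRing_permSum_cancel hΓ ?_
  rw [salvettiBd_mul _ hΓ, bd_congr hΓ (fun Γ hΓ => salvettiBd_mul f hΓ), bd_bd]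

theorem permSum_negGen_empty (t : ℕ) : permSum (negGen k n ∅) t = 1 := by
  have : ∀ t, ascSum (negGen k n ∅) 0 t = 1 := by
    rintro (_ | t)
    · rfl
    · rw [ascSum_succ _ (Nat.zero_le _)]; simp [negGen]
  induction t with
  | zero => rfl
  | succ t ih => rw [permSum, ih, this, mul_one]

/-- The augmentation of the group algebra. -/
noncomputable def augmentation (k : Type*) [CommRing k] (n : ℕ) :
    MonoidAlgebra k (BraidGroup (n + 1)) →ₐ[k] k :=
  MonoidAlgebra.lift k k (BraidGroup (n + 1)) 1

theorem augmentation_single (g : BraidGroup (n + 1)) (r : k) :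
    augmentation k n (MonoidAlgebra.single g r) = r := by
  simp [augmentation]

theorem augmentation_permSum {s : ℕ} (hs : s < n) :
    augmentation k n (toGroupRing k n (permSum (negGen k n {s}) n)) = 0 := by
  let F : MonoidAlgebra k (BraidMonoid n) →+* k :=
    (augmentation k n).toRingHom.comp (toGroupRing k n)
  have hx : ∀ j, F (negGen k n {s} j) = if j = s then -1 else 0 := by
    intro j
    rw [negGen]
    by_cases h : j = s
    · simp only [h, Finset.mem_singleton, if_true, map_neg]
      rw [MonoidAlgebra.of_apply, RingHom.comp_apply, toGroupRing_single]
      exact congrArg _ (augmentation_single _ _)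
    · simp [h]
  have key : ∀ t, ascSum (fun j => F (negGen k n {s} j)) 0 t = if t = s + 1 then 0 else 1 := by
    intro t
    induction t with
    | zero => simp [ascSum]
    | succ t ih =>
      rw [ascSum_succ _ (Nat.zero_le _), ih, hx]
      by_cases h : t = s
      · subst h; simp
      · simp [h]
  have : ∀ t, s < t → permSum (fun j => F (negGen k n {s} j)) t = 0 := by
    intro t
    induction t with
    | zero => intro h; omega
    | succ t ih =>
      intro h
      rw [permSum]
      rcases (Nat.lt_succ_iff.1 h).lt_or_eq with h | h
      · rw [ih h, mul_zero]
      · rw [key, if_pos (by omega), zero_mul]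
  change F _ = 0
  rw [map_permSum]
  exact this n hs

theorem augmentation_salvettiBd (f : Finset ℕ → MonoidAlgebra k (BraidGroup (n + 1))) :
    augmentation k n (salvettiBd f ∅) = 0 := by
  rw [salvettiBd, map_sum]
  refine Finset.sum_eq_zero fun s hs => ?_
  rw [Finset.sdiff_empty, Finset.mem_range] at hs
  have := permSum_negGen_eq k (Γ := {s}) (by simpa using hs) s
  rw [Finset.erase_singleton, permSum_negGen_empty, mul_one] at this
  rw [map_zsmul, map_mul, insert_empty_eq, ← this, augmentation_permSum hs, mul_zero, smul_zero]

theorem exists_salvettiBd_eq {c : ℕ} (f : Finset ℕ → MonoidAlgebra k (BraidGroup (n + 1)))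
    (hc : ∀ Γ, Γ.card ≠ c → f Γ = 0) (hf : ∀ Γ ⊆ Finset.range n, salvettiBd f Γ = 0)
    (haug : augmentation k n (f ∅) = 0) :
    ∃ g : Finset ℕ → MonoidAlgebra k (BraidGroup (n + 1)), (∀ Γ, Γ.card ≠ c + 1 → g Γ = 0) ∧
      ∀ Γ ⊆ Finset.range n, f Γ = salvettiBd g Γ := by
  choose K hK using fun Γ => exists_pow_mul_eq_toGroupRing (f Γ)
  obtain ⟨m, hm⟩ : ∃ m, ∀ Γ ⊆ Finset.range n, K Γ ≤ m :=
    ⟨(Finset.range n).powerset.sup K, fun Γ hΓ => Finset.le_sup (Finset.mem_powerset.2 hΓ)⟩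
  have : ∀ Γ, ∃ a, (Γ ⊆ Finset.range n →
      MonoidAlgebra.single (toBraidGroup n (fundamental n) ^ m) (1 : k) * f Γ =
        toGroupRing k n a) ∧ (Γ.card ≠ c → a = 0) := by
    intro Γ
    by_cases hΓc : Γ.card = c
    · by_cases hΓ : Γ ⊆ Finset.range n
      · obtain ⟨a, ha⟩ := hK Γ m (hm Γ hΓ)
        exact ⟨a, fun _ => ha, fun h => absurd hΓc h⟩
      · exact ⟨0, fun h => absurd h hΓ, fun _ => rfl⟩
    · exact ⟨0, fun _ => by rw [hc Γ hΓc, mul_zero, map_zero], fun _ => rfl⟩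
  choose a ha hac using this
  let u : Finset ℕ → MonoidAlgebra k (BraidMonoid n) := fun Γ => a Γ * permSum (negGen k n Γ) n
  have hbd : ∀ Γ ⊆ Finset.range n, bd n u Γ = 0 := by
    intro Γ hΓ
    apply toGroupRing_injective (k := k)
    have h₁ : toGroupRing k n (bd n u Γ) = bd n (fun Γ => toGroupRing k n (u Γ)) Γ :=
      map_bd (toGroupRing k n).toAddMonoidHom n u Γ
    rw [h₁, map_zero, bd_congr (v := fun Γ => (MonoidAlgebra.single
      (toBraidGroup n (fundamental n) ^ m) (1 : k) * f Γ) *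
        toGroupRing k n (permSum (negGen k n Γ) n)) hΓ fun Γ hΓ => by
          rw [map_mul, ha Γ hΓ], ← salvettiBd_mul _ hΓ, ← mul_salvettiBd, hf Γ hΓ, mul_zero, zero_mul]
  choose L hL using fun Γ => exists_lenLT (u Γ)
  obtain ⟨v, r, hv, hvc, h⟩ := exists_bd_of_bd_eq_zero (c := c)
    ((Finset.range n).powerset.sup L) u (fun Γ _ => ⟨_, rfl⟩)
    (fun Γ h => by simp only [u, hac Γ h, zero_mul]) hbd
    (fun Γ hΓ => (hL Γ).mono (Finset.le_sup (Finset.mem_powerset.2 hΓ)))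
  have : ∀ Γ, ∃ b, (Γ ⊆ Finset.range n → v Γ = b * permSum (negGen k n Γ) n) ∧
      (Γ.card ≠ c + 1 → b = 0) := by
    intro Γ
    by_cases hΓc : Γ.card = c + 1
    · by_cases hΓ : Γ ⊆ Finset.range n
      · obtain ⟨b, hb⟩ := hv Γ hΓ
        exact ⟨b, fun _ => hb, fun h => absurd hΓc h⟩
      · exact ⟨0, fun h => absurd h hΓ, fun _ => rfl⟩
    · exact ⟨0, fun _ => by rw [hvc Γ hΓc, zero_mul], fun _ => rfl⟩
  choose b hb hbc using this
  have key : ∀ Γ ⊆ Finset.range n, toGroupRing k n (a Γ) =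
      salvettiBd (fun Γ => toGroupRing k n (b Γ)) Γ +
        if Γ = ∅ then MonoidAlgebra.single 1 r else 0 := by
    intro Γ hΓ
    refine sub_eq_zero.1 (toGroupRing_permSum_cancel hΓ ?_)
    have h₁ : toGroupRing k n (bd n v Γ) = bd n (fun Γ => toGroupRing k n (v Γ)) Γ :=
      map_bd (toGroupRing k n).toAddMonoidHom n v Γ
    have h₂ : toGroupRing k n (u Γ) = _ := congrArg (toGroupRing k n) (h Γ hΓ)
    rw [map_add, h₁, bd_congr hΓ fun Γ hΓ => by rw [hb Γ hΓ, map_mul], ← salvettiBd_mul _ hΓ,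
      map_mul] at h₂
    rw [sub_mul, add_mul, h₂]
    split_ifs with h0
    · rw [h0, permSum_negGen_empty, map_one, mul_one, mul_one, toGroupRing_single, map_one, sub_self]
    · rw [zero_mul, map_zero, sub_self]
  have hr : r = 0 := by
    have h₁ := congrArg (augmentation k n) (key ∅ (Finset.empty_subset _))
    rwa [← ha ∅ (Finset.empty_subset _), map_mul, haug, mul_zero, map_add, augmentation_salvettiBd,
      zero_add, if_pos rfl, augmentation_single, eq_comm] at h₁
  refine ⟨fun Γ => MonoidAlgebra.single ((toBraidGroup n (fundamental n) ^ m)⁻¹) (1 : k) *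
    toGroupRing k n (b Γ), fun Γ h => by simp only [hbc Γ h, map_zero, mul_zero], fun Γ hΓ => ?_⟩
  rw [← mul_salvettiBd, ← single_pow_mul_cancel m (f Γ), ha Γ hΓ, key Γ hΓ, hr]
  simp

end GroupRing

end

section

open ArtinMonoid BraidMonoid BraidIdentities CategoryTheory

section Resolution

variable (k : Type) [CommRing k] (n : ℕ)

/-- The cells of dimension `c` of the Salvetti complex. -/
abbrev Cell (n c : ℕ) : Type := {Γ : Finset ℕ // Γ ∈ (Finset.range n).powersetCard c}

variable {k n}

theorem Cell.subset {c : ℕ} (Γ : Cell n c) : Γ.1 ⊆ Finset.range n :=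
  (Finset.mem_powersetCard.1 Γ.2).1

theorem Cell.card {c : ℕ} (Γ : Cell n c) : Γ.1.card = c := (Finset.mem_powersetCard.1 Γ.2).2

/-- Extension by zero of a function on cells. -/
def extendCell {c : ℕ} {M : Type*} [Zero M] (x : Cell n c → M) (Γ : Finset ℕ) : M :=
  if h : Γ ∈ (Finset.range n).powersetCard c then x ⟨Γ, h⟩ else 0

theorem extendCell_coe {c : ℕ} {M : Type*} [Zero M] (x : Cell n c → M) (Γ : Cell n c) :
    extendCell x Γ.1 = x Γ := dif_pos Γ.2

theorem extendCell_of_card_ne {c : ℕ} {M : Type*} [Zero M] (x : Cell n c → M) {Γ : Finset ℕ}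
    (h : Γ.card ≠ c) : extendCell x Γ = 0 :=
  dif_neg fun h' => h (Finset.mem_powersetCard.1 h').2

theorem extendCell_comp {c : ℕ} {M M' : Type*} [Zero M] [Zero M'] (x : Cell n c → M) (φ : M → M')
    (hφ : φ 0 = 0) (Γ : Finset ℕ) : extendCell (fun Γ => φ (x Γ)) Γ = φ (extendCell x Γ) := by
  unfold extendCell; split_ifs <;> simp [hφ]

theorem extendCell_add {c : ℕ} {M : Type*} [AddMonoid M] (x y : Cell n c → M) :
    extendCell (x + y) = extendCell x + extendCell y := by
  funext Γ; simp only [extendCell, Pi.add_apply]; split_ifs <;> simp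

theorem extendCell_restrict {c : ℕ} {M : Type*} [Zero M] (f : Finset ℕ → M)
    (hf : ∀ Γ, Γ.card ≠ c → f Γ = 0) {Γ : Finset ℕ} (hΓ : Γ ⊆ Finset.range n) :
    extendCell (fun Γ : Cell n c => f Γ.1) Γ = f Γ := by
  by_cases h : Γ.card = c
  · exact dif_pos (Finset.mem_powersetCard.2 ⟨hΓ, h⟩)
  · rw [hf Γ h, extendCell_of_card_ne _ h]

theorem salvettiBd_add (f g : Finset ℕ → MonoidAlgebra k (BraidGroup (n + 1))) (Γ : Finset ℕ) :
    salvettiBd (f + g) Γ = salvettiBd f Γ + salvettiBd g Γ := by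
  simp only [salvettiBd, Pi.add_apply, add_mul, smul_add, Finset.sum_add_distrib]

theorem salvettiBd_eq_zero_of_card {c : ℕ} {f : Finset ℕ → MonoidAlgebra k (BraidGroup (n + 1))}
    (h : ∀ Γ, Γ.card ≠ c + 1 → f Γ = 0) {Γ : Finset ℕ} (hΓ : Γ.card ≠ c) : salvettiBd f Γ = 0 :=
  Finset.sum_eq_zero fun s hs => by
    rw [h, zero_mul, smul_zero]
    rw [Finset.card_insert_of_notMem (Finset.mem_sdiff.1 hs).2]
    omega

theorem leftRegular_apply_eq (g : BraidGroup (n + 1)) (y : MonoidAlgebra k (BraidGroup (n + 1))) :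
    Representation.leftRegular k (BraidGroup (n + 1)) g y = MonoidAlgebra.single g 1 * y := by
  induction y using MonoidAlgebra.induction_linear with
  | zero => simp
  | add y z hy hz => rw [map_add, hy, hz, mul_add]
  | single h r => simp

theorem single_one_mul_eq_smul (r : k) (y : MonoidAlgebra k (BraidGroup (n + 1))) :
    MonoidAlgebra.single 1 r * y = r • y := by
  have : MonoidAlgebra.single (1 : BraidGroup (n + 1)) r = r • 1 := by
    rw [MonoidAlgebra.one_def, MonoidAlgebra.smul_single, smul_eq_mul, mul_one]
  rw [this, smul_mul_assoc, one_mul]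

variable (k n)

/-- The boundary map of the Salvetti complex as a linear map. -/
noncomputable def salvettiLin (c : ℕ) :
    (Cell n (c + 1) →₀ MonoidAlgebra k (BraidGroup (n + 1))) →ₗ[k]
      (Cell n c →₀ MonoidAlgebra k (BraidGroup (n + 1))) where
  toFun x := Finsupp.equivFunOnFinite.symm fun Γ => salvettiBd (extendCell x) Γ.1
  map_add' x y := by
    ext1 Γ
    simp only [Finsupp.coe_add, extendCell_add, salvettiBd_add, Finsupp.add_apply,
      Finsupp.equivFunOnFinite_symm_apply_apply]
  map_smul' r x := by
    ext1 Γ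
    have : extendCell (⇑(r • x)) =
        fun Γ => MonoidAlgebra.single (1 : BraidGroup (n + 1)) r * extendCell x Γ := by
      funext Γ
      rw [← extendCell_comp _ _ (mul_zero _)]
      congr 1
      funext Γ
      rw [Finsupp.smul_apply, ← single_one_mul_eq_smul]
    simp only [this, Finsupp.smul_apply, RingHom.id_apply,
      Finsupp.equivFunOnFinite_symm_apply_apply]
    rw [← mul_salvettiBd, single_one_mul_eq_smul]

theorem salvettiLin_apply {c : ℕ} (x : Cell n (c + 1) →₀ MonoidAlgebra k (BraidGroup (n + 1)))
    (Γ : Cell n c) : salvettiLin k n c x Γ = salvettiBd (extendCell x) Γ.1 := rfl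

theorem extendCell_salvettiLin {c : ℕ}
    (x : Cell n (c + 1) →₀ MonoidAlgebra k (BraidGroup (n + 1))) {Γ : Finset ℕ}
    (hΓ : Γ ⊆ Finset.range n) :
    extendCell (salvettiLin k n c x) Γ = salvettiBd (extendCell x) Γ :=
  extendCell_restrict _ (fun _ h => salvettiBd_eq_zero_of_card
    (fun _ h' => extendCell_of_card_ne _ h') h) hΓ

theorem free_apply_eq {c : ℕ} (g : BraidGroup (n + 1))
    (x : Cell n c →₀ MonoidAlgebra k (BraidGroup (n + 1))) (Γ : Cell n c) :
    Representation.free k (BraidGroup (n + 1)) (Cell n c) g x Γ =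
      MonoidAlgebra.single g 1 * x Γ := by
  classical
  induction x using Finsupp.induction_linear with
  | zero => simp
  | add x y hx hy => rw [map_add, Finsupp.add_apply, hx, hy, Finsupp.add_apply, mul_add]
  | single Γ' y =>
    rw [Representation.finsupp_single, leftRegular_apply_eq, Finsupp.single_apply,
      Finsupp.single_apply]
    split_ifs <;> simp

/-- The modules of the Salvetti complex. -/
noncomputable abbrev salvettiX (c : ℕ) : Rep.{0} k (BraidGroup (n + 1)) :=
  Rep.free k (BraidGroup (n + 1)) (Cell n c)

/-- The boundary map of the Salvetti complex as a map of representations. -/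
noncomputable def salvettiD (c : ℕ) : salvettiX k n (c + 1) ⟶ salvettiX k n c :=
  Rep.ofHom (LinearMap.intertwiningMap_of_isIntertwiningMap _ _ (salvettiLin k n c) fun g x => by
    ext1 Γ
    rw [free_apply_eq, salvettiLin_apply, salvettiLin_apply, mul_salvettiBd]
    congr 1
    funext Γ
    rw [← extendCell_comp _ _ (mul_zero _)]
    congr 1
    funext Γ
    exact free_apply_eq k n g x Γ)

theorem salvettiLin_salvettiLin (c : ℕ)
    (x : Cell n (c + 2) →₀ MonoidAlgebra k (BraidGroup (n + 1))) :
    salvettiLin k n c (salvettiLin k n (c + 1) x) = 0 := by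
  ext1 Γ
  rw [salvettiLin_apply, salvettiBd_congr Γ.subset fun Γ hΓ => extendCell_salvettiLin k n x hΓ,
    salvettiBd_salvettiBd _ Γ.subset]
  rfl

/-- The Salvetti complex. -/
noncomputable def salvettiComplex : ChainComplex (Rep.{0} k (BraidGroup (n + 1))) ℕ :=
  ChainComplex.of (salvettiX k n) (salvettiD k n) fun c => by
    refine Rep.hom_ext (Representation.IntertwiningMap.ext (LinearMap.ext fun x => ?_))
    exact salvettiLin_salvettiLin k n c x

/-- The unique cell of dimension zero. -/
def Cell.empty : Cell n 0 := ⟨∅, by simp⟩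

/-- The augmentation of the Salvetti complex. -/
noncomputable def salvettiAug : salvettiX k n 0 ⟶ Rep.trivial k (BraidGroup (n + 1)) k :=
  Rep.ofHom (LinearMap.intertwiningMap_of_isIntertwiningMap _ _
    ((augmentation k n).toLinearMap ∘ₗ Finsupp.lapply (Cell.empty n)) fun g x => by
      change augmentation k n (Representation.free k (BraidGroup (n + 1)) (Cell n 0) g x _) =
        augmentation k n (x _)
      rw [free_apply_eq, map_mul, augmentation_single, one_mul])

theorem salvettiAug_apply (x : salvettiX k n 0) :
    (salvettiAug k n).hom x = augmentation k n (x (Cell.empty n)) := rfl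

theorem salvettiD_salvettiAug : salvettiD k n 0 ≫ salvettiAug k n = 0 :=
  Rep.hom_ext (Representation.IntertwiningMap.ext (LinearMap.ext fun x =>
    augmentation_salvettiBd (extendCell x)))

/-- Exactness of the Salvetti complex. -/
theorem exists_salvettiLin_eq {c : ℕ} (x : Cell n c →₀ MonoidAlgebra k (BraidGroup (n + 1)))
    (hx : ∀ Γ ⊆ Finset.range n, salvettiBd (extendCell x) Γ = 0)
    (haug : augmentation k n (extendCell x ∅) = 0) : ∃ y, salvettiLin k n c y = x := by
  obtain ⟨g, hg, h⟩ := exists_salvettiBd_eq _ (fun Γ h => extendCell_of_card_ne x h) hx haug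
  refine ⟨Finsupp.equivFunOnFinite.symm fun Γ => g Γ.1, ?_⟩
  ext1 Γ
  rw [salvettiLin_apply, ← extendCell_coe x Γ, h Γ.1 Γ.subset]
  exact salvettiBd_congr Γ.subset fun Γ hΓ => extendCell_restrict g hg hΓ

theorem salvettiComplex_d (c : ℕ) : (salvettiComplex k n).d (c + 1) c = salvettiD k n c :=
  ChainComplex.of_d ..

/-- The augmentation of the Salvetti complex as a map of complexes. -/
noncomputable def salvettiπ : salvettiComplex k n ⟶
    (ChainComplex.single₀ (Rep.{0} k (BraidGroup (n + 1)))).obj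
      (Rep.trivial k (BraidGroup (n + 1)) k) :=
  ((salvettiComplex k n).toSingle₀Equiv _).symm ⟨salvettiAug k n, by
    rw [salvettiComplex_d]; exact salvettiD_salvettiAug k n⟩

theorem salvettiπ_f_zero : (salvettiπ k n).f 0 = salvettiAug k n := by
  exact ChainComplex.toSingle₀Equiv_symm_apply_f_zero _ _

theorem salvettiπ_quasiIso : QuasiIso (salvettiπ k n) where
  quasiIsoAt m := by
    induction m with
    | zero =>
      rw [ChainComplex.quasiIsoAt₀_iff, ShortComplex.quasiIso_iff_of_zeros' _ rfl rfl rfl]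
      constructor
      · apply (forget₂ _ (ModuleCat k)).reflects_exact_of_faithful
        rw [ShortComplex.moduleCat_exact_iff]
        intro x hx
        change Cell n 0 →₀ MonoidAlgebra k (BraidGroup (n + 1)) at x
        have hx' : augmentation k n (x (Cell.empty n)) = 0 := by
          rw [← salvettiAug_apply, ← salvettiπ_f_zero]
          exact hx
        have h₁ : ∀ Γ ⊆ Finset.range n, salvettiBd (extendCell x) Γ = 0 := fun Γ hΓ =>
          Finset.sum_eq_zero fun s hs => by
            rw [extendCell_of_card_ne, zero_mul, smul_zero]
            rw [Finset.card_insert_of_notMem (Finset.mem_sdiff.1 hs).2]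
            omega
        obtain ⟨y, hy⟩ := exists_salvettiLin_eq k n x h₁ (by
          rwa [← extendCell_coe (⇑x)] at hx')
        exact ⟨y, (congrArg (fun f => f.hom y) (salvettiComplex_d k n 0)).trans hy⟩
      · rw [Rep.epi_iff_surjective]
        intro x
        refine ⟨(Finsupp.single (Cell.empty n) (MonoidAlgebra.single 1 x) :
          Cell n 0 →₀ MonoidAlgebra k (BraidGroup (n + 1))), ?_⟩
        change ((salvettiπ k n).f 0).hom _ = x
        rw [salvettiπ_f_zero]
        refine (salvettiAug_apply k n _).trans ?_
        rw [Finsupp.single_eq_same]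
        exact augmentation_single (k := k) 1 x
    | succ m _ =>
      rw [quasiIsoAt_iff_exactAt' (hL := ChainComplex.exactAt_succ_single_obj ..),
          HomologicalComplex.exactAt_iff' _ (m + 2) (m + 1) m (by simp) (by simp)]
      apply (forget₂ _ (ModuleCat k)).reflects_exact_of_faithful
      rw [ShortComplex.moduleCat_exact_iff]
      intro x hx
      change Cell n (m + 1) →₀ MonoidAlgebra k (BraidGroup (n + 1)) at x
      have hx' : salvettiLin k n m x = 0 :=
        ((congrArg (fun f => f.hom x) (salvettiComplex_d k n m)).symm.trans hx :)
      have h₁ : ∀ Γ ⊆ Finset.range n, salvettiBd (extendCell x) Γ = 0 := fun Γ hΓ => by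
        rw [← extendCell_salvettiLin k n x hΓ, hx', Finsupp.coe_zero]
        exact dite_eq_right_iff.2 fun _ => rfl
      have h₂ : augmentation k n (extendCell x ∅) = 0 := by
        rw [extendCell_of_card_ne _ (by simp), map_zero]
      obtain ⟨y, hy⟩ := exists_salvettiLin_eq k n x h₁ h₂
      exact ⟨y, (congrArg (fun f => f.hom y) (salvettiComplex_d k n (m + 1))).trans hy⟩

/-- The Salvetti complex is a free resolution of the trivial module. -/
noncomputable def salvettiResolution :
    ProjectiveResolution (Rep.trivial k (BraidGroup (n + 1)) k) where
  complex := salvettiComplex k n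
  projective c := inferInstanceAs <| Projective (salvettiX k n c)
  π := salvettiπ k n
  quasiIso := salvettiπ_quasiIso k n

end Resolution

end

section

open ArtinMonoid BraidMonoid BraidIdentities CategoryTheory

section Homology

universe u v

theorem CategoryTheory.ShortComplex.nonempty_homology_equiv_quotient_span {R : Type u} [CommRing R]
    (S : ShortComplex (ModuleCat.{v} R)) (t : R) (z : S.X₂) (hz : S.g z = 0)
    (hcyc : ∀ x : S.X₂, S.g x = 0 → ∃ (r : R) (y : S.X₁), x = r • z + S.f y)
    (ht : ∀ r : R, (∃ y : S.X₁, S.f y = r • z) ↔ t ∣ r) :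
    Nonempty (S.homology ≃ₗ[R] R ⧸ Ideal.span {t}) := by
  let e := S.moduleCatHomologyIso.toLinearEquiv
  let p : LinearMap.ker S.g.hom →ₗ[R] _ := (LinearMap.range S.moduleCatToCycles).mkQ
  let φ : R →ₗ[R] _ := p ∘ₗ LinearMap.toSpanSingleton R _ (⟨z, hz⟩ : LinearMap.ker S.g.hom)
  have hsurj : Function.Surjective φ := by
    intro y
    obtain ⟨⟨x, hx⟩, rfl⟩ := Submodule.mkQ_surjective _ y
    obtain ⟨r, y, hy⟩ := hcyc x hx
    refine ⟨r, ((Submodule.Quotient.eq _).2 ⟨-y, Subtype.ext ?_⟩)⟩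
    change S.f (-y) = r • z - x
    rw [hy, map_neg]; abel
  have hker : LinearMap.ker φ = Ideal.span {t} := by
    ext r
    rw [Ideal.mem_span_singleton, ← ht]
    refine (Submodule.Quotient.mk_eq_zero _).trans ⟨?_, ?_⟩
    · rintro ⟨y, hy⟩
      exact ⟨y, congrArg Subtype.val hy⟩
    · rintro ⟨y, hy⟩
      exact ⟨y, Subtype.ext hy⟩
  exact ⟨e.trans ((φ.quotKerEquivOfSurjective hsurj).symm.trans
    (Submodule.quotEquivOfEq _ _ hker))⟩

theorem CochainComplex.nonempty_homology_equiv_quotient_span {R : Type u} [CommRing R]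
    (K : CochainComplex (ModuleCat.{v} R) ℕ) (m : ℕ) (t : R) (z : K.X m) (hz : K.d m (m + 1) z = 0)
    (hcyc : ∀ x : K.X m, K.d m (m + 1) x = 0 →
      ∃ (r : R) (j : ℕ) (y : K.X j), x = r • z + K.d j m y)
    (ht : ∀ r : R, (∃ (j : ℕ) (y : K.X j), j + 1 = m ∧ K.d j m y = r • z) ∨ r • z = 0 ↔ t ∣ r) :
    Nonempty (K.homology m ≃ₗ[R] R ⧸ Ideal.span {t}) := by
  have hnext : (ComplexShape.up ℕ).next m = m + 1 := by simp
  have key : ∀ j, ∀ y : K.X j, ∃ y' : K.X ((ComplexShape.up ℕ).prev m),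
      K.d ((ComplexShape.up ℕ).prev m) m y' = K.d j m y := by
    intro j y
    by_cases h : (ComplexShape.up ℕ).Rel j m
    · obtain rfl := (ComplexShape.up ℕ).prev_eq' h
      exact ⟨y, rfl⟩
    · exact ⟨0, by rw [K.shape _ _ h, map_zero]; rfl⟩
  refine (K.sc m).nonempty_homology_equiv_quotient_span t z ?_ ?_ ?_
  · change K.d m ((ComplexShape.up ℕ).next m) z = 0
    rw [hnext]; exact hz
  · intro x hx
    change K.d m ((ComplexShape.up ℕ).next m) x = 0 at hx
    rw [hnext] at hx
    obtain ⟨r, j, y, hy⟩ := hcyc x hx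
    obtain ⟨y', hy'⟩ := key j y
    exact ⟨r, y', by rw [hy, ← hy']; rfl⟩
  · intro r
    rw [← ht]
    constructor
    · rintro ⟨y, hy⟩
      change K.d ((ComplexShape.up ℕ).prev m) m y = r • z at hy
      by_cases h : (ComplexShape.up ℕ).Rel ((ComplexShape.up ℕ).prev m) m
      · exact Or.inl ⟨_, y, h, hy⟩
      · right; rw [← hy, K.shape _ _ h]; rfl
    · rintro (⟨j, y, -, hy⟩ | h)
      · obtain ⟨y', hy'⟩ := key j y
        exact ⟨y', hy'.trans hy⟩
      · exact ⟨0, (map_zero _).trans h.symm⟩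

end Homology

section HomComplex

variable {k : Type} [CommRing k] {n : ℕ}

/-- The character through which the group ring acts on a representation of rank one. -/
noncomputable def rankOneChar {G : Type} [Group G] (ρ : Representation k G k) :
    MonoidAlgebra k G →ₐ[k] k :=
  MonoidAlgebra.lift k k G
    { toFun := fun g => ρ g 1
      map_one' := by simp
      map_mul' := fun g h => by
        have : ρ g (ρ h 1) = ρ h 1 * ρ g 1 := by
          conv_lhs => rw [← mul_one (ρ h 1), ← smul_eq_mul, map_smul, smul_eq_mul]
        rw [map_mul, Module.End.mul_apply, this, mul_comm] }

theorem rankOneChar_single {G : Type} [Group G] (ρ : Representation k G k) (g : G) (r : k) :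
    rankOneChar ρ (MonoidAlgebra.single g r) = r * ρ g 1 := by
  simp [rankOneChar]

/-- The value of the sequence `q, q, …` restricted to `Γ`. -/
def constOn (q : k) (Γ : Finset ℕ) (j : ℕ) : k := if j ∈ Γ then q else 0

/-- The coboundary of the Salvetti complex with coefficients in a rank one local system. -/
def twistedDelta (n : ℕ) (q : k) (f : Finset ℕ → k) (Γ : Finset ℕ) : k :=
  ∑ s ∈ Γ, incSign (Γ.erase s) s • (shuffleSum (constOn q Γ) n (s + 1) * f (Γ.erase s))

theorem rankOneChar_bdCoeff (ρ : Representation k (BraidGroup (n + 1)) k) (q : k)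
    (hρ : ∀ s : Fin n, ρ (braidGen (n + 1) s) 1 = -q) {Γ : Finset ℕ} (hΓ : Γ ⊆ Finset.range n)
    (s : ℕ) : rankOneChar ρ (toGroupRing k n (bdCoeff k n Γ s)) =
      shuffleSum (constOn q Γ) n (s + 1) := by
  have : (fun j => ((rankOneChar ρ : MonoidAlgebra k (BraidGroup (n + 1)) →+* k).comp
      (toGroupRing k n)) (negGen k n Γ j)) = constOn q Γ := by
    funext j
    simp only [negGen, constOn]
    split_ifs with h
    · have hj := Finset.mem_range.1 (hΓ h)
      rw [map_neg, RingHom.comp_apply, MonoidAlgebra.of_apply, toGroupRing_single, sigma_of_lt hj,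
        toBraidGroup_gen]
      exact neg_eq_iff_eq_neg.2 ((rankOneChar_single ρ _ _).trans (by rw [hρ, one_mul]))
    · rw [map_zero]
  rw [bdCoeff, ← this, ← map_shuffleSum]
  rfl

/-- The cochain of a map from the Salvetti complex to a representation of rank one. -/
noncomputable def toCochain {c : ℕ} {ρ : Representation k (BraidGroup (n + 1)) k}
    (φ : salvettiX k n c ⟶ Rep.of ρ) : Finset ℕ → k :=
  extendCell fun Γ : Cell n c => (φ.hom (Finsupp.single Γ (MonoidAlgebra.single 1 1)) : k)

theorem hom_apply_eq_sum {c : ℕ} {ρ : Representation k (BraidGroup (n + 1)) k}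
    (φ : salvettiX k n c ⟶ Rep.of ρ) (x : Cell n c →₀ MonoidAlgebra k (BraidGroup (n + 1))) :
    (φ.hom x : k) = ∑ Γ : Cell n c, rankOneChar ρ (x Γ) * toCochain φ Γ.1 := by
  induction x using Finsupp.induction_linear with
  | zero => simp
  | add x y hx hy =>
    simp only [Finsupp.add_apply, map_add, add_mul, Finset.sum_add_distrib, ← hx, ← hy]
  | single Γ y =>
    rw [Finset.sum_eq_single Γ (fun Γ' _ h => by simp [h.symm])
      (fun h => absurd (Finset.mem_univ _) h), Finsupp.single_eq_same]
    induction y using MonoidAlgebra.induction_linear with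
    | zero => simp
    | add y z hy hz =>
      rw [Finsupp.single_add, map_add, map_add, add_mul, ← hy, ← hz]
    | single g r =>
      have h1 : (Finsupp.single Γ (MonoidAlgebra.single g r) : Cell n c →₀ _) =
          r • Representation.free k (BraidGroup (n + 1)) (Cell n c) g
            (Finsupp.single Γ (MonoidAlgebra.single 1 1)) := by
        simp
      have h2 : (φ.hom (Representation.free k (BraidGroup (n + 1)) (Cell n c) g
          (Finsupp.single Γ (MonoidAlgebra.single 1 1))) : k) =
          ρ g (φ.hom (Finsupp.single Γ (MonoidAlgebra.single 1 1))) :=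
        Representation.IntertwiningMap.isIntertwining _ _ φ.hom g _
      have h3 (v : k) : ρ g v = v * ρ g 1 := by
        conv_lhs => rw [← mul_one v, ← smul_eq_mul, map_smul, smul_eq_mul]
      rw [rankOneChar_single, toCochain, extendCell_coe, h1]
      refine (map_smul φ.hom r _).trans ((congrArg (r • ·) (h2.trans (h3 _))).trans ?_)
      rw [smul_eq_mul]
      ring

theorem toCochain_comp {c : ℕ} (ρ : Representation k (BraidGroup (n + 1)) k) (q : k)
    (hρ : ∀ s : Fin n, ρ (braidGen (n + 1) s) 1 = -q) (φ : salvettiX k n c ⟶ Rep.of ρ)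
    (Γ : Cell n (c + 1)) :
    toCochain (salvettiD k n c ≫ φ) Γ.1 = twistedDelta n q (toCochain φ) Γ.1 := by
  classical
  have h0 : toCochain (salvettiD k n c ≫ φ) Γ.1 =
      φ.hom (salvettiLin k n c (Finsupp.single Γ (MonoidAlgebra.single 1 1))) :=
    extendCell_coe _ _
  have h1 (Δ : Finset ℕ) : extendCell (Finsupp.single Γ (MonoidAlgebra.single 1 1) :
      Cell n (c + 1) →₀ MonoidAlgebra k (BraidGroup (n + 1))) Δ = if Δ = Γ.1 then 1 else 0 := by
    unfold extendCell
    split_ifs with h h' h'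
    · obtain rfl : Γ = ⟨Δ, h⟩ := Subtype.ext h'.symm
      simp [MonoidAlgebra.one_def]
    · rw [Finsupp.single_eq_of_ne]
      rintro rfl; exact h' rfl
    · exact absurd (h' ▸ Γ.2) h
    · rfl
  rw [h0, hom_apply_eq_sum, twistedDelta]
  simp only [salvettiLin_apply, salvettiBd, map_sum, Finset.sum_mul, h1]
  have h2 : ∑ s ∈ Γ.1, incSign (Γ.1.erase s) s •
        (shuffleSum (constOn q Γ.1) n (s + 1) * toCochain φ (Γ.1.erase s)) =
      ∑ s ∈ Finset.range n, if s ∈ Γ.1 then incSign (Γ.1.erase s) s •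
        (shuffleSum (constOn q Γ.1) n (s + 1) * toCochain φ (Γ.1.erase s)) else 0 := by
    rw [← Finset.sum_filter, Finset.filter_mem_eq_inter, Finset.inter_eq_right.2 Γ.subset]
  simp only [h2, Finset.sdiff_eq_filter, Finset.sum_filter]
  rw [Finset.sum_comm]
  refine Finset.sum_congr rfl fun s _ => ?_
  split_ifs with hs
  · have hc : Γ.1.erase s ∈ (Finset.range n).powersetCard c := Finset.mem_powersetCard.2
      ⟨(Finset.erase_subset _ _).trans Γ.subset, by rw [Finset.card_erase_of_mem hs, Γ.card]; rfl⟩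
    rw [Finset.sum_eq_single (⟨Γ.1.erase s, hc⟩ : Cell n c)]
    · rw [if_pos (Finset.notMem_erase _ _), Finset.insert_erase hs, if_pos rfl, one_mul,
        map_zsmul, rankOneChar_bdCoeff ρ q hρ Γ.subset, smul_mul_assoc]
    · intro Δ _ hΔ
      by_cases h : s ∈ Δ.1
      · rw [if_neg (not_not.2 h)]
      · have h' : insert s Δ.1 ≠ Γ.1 := fun h' =>
          hΔ (Subtype.ext (by simp [← h', Finset.erase_insert h]))
        rw [if_neg h', zero_mul, smul_zero, map_zero, zero_mul, ite_self]
    · exact fun h => absurd (Finset.mem_univ _) h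
  · refine Finset.sum_eq_zero fun Δ _ => ?_
    have h' : insert s Δ.1 ≠ Γ.1 := fun h => hs (h ▸ Finset.mem_insert_self _ _)
    rw [if_neg h', zero_mul, smul_zero, map_zero, zero_mul, ite_self]

theorem twistedDelta_eq_zero_of_card {c : ℕ} {q : k} {f : Finset ℕ → k}
    (h : ∀ Γ, Γ.card ≠ c → f Γ = 0) {Γ : Finset ℕ} (hΓ : Γ.card ≠ c + 1) :
    twistedDelta n q f Γ = 0 :=
  Finset.sum_eq_zero fun s hs => by
    rw [h, mul_zero, smul_zero]
    have := Finset.card_pos.2 ⟨s, hs⟩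
    rw [Finset.card_erase_of_mem hs]
    omega

/-- The map from the Salvetti complex with a given cochain. -/
noncomputable def ofCochain {c : ℕ} (ρ : Representation k (BraidGroup (n + 1)) k)
    (f : Finset ℕ → k) : salvettiX k n c ⟶ Rep.of ρ :=
  Rep.freeLift k (BraidGroup (n + 1)) (Rep.of ρ) fun Γ : Cell n c => f Γ.1

theorem toCochain_ofCochain {c : ℕ} (ρ : Representation k (BraidGroup (n + 1)) k)
    (f : Finset ℕ → k) (Γ : Cell n c) :
    toCochain (ofCochain ρ f : salvettiX k n c ⟶ _) Γ.1 = f Γ.1 := by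
  rw [toCochain, extendCell_coe]
  refine (Representation.freeLift_single_single ρ Γ 1 1 fun Γ : Cell n c => f Γ.1).trans ?_
  simp

theorem toCochain_injective {c : ℕ} {ρ : Representation k (BraidGroup (n + 1)) k}
    {φ ψ : salvettiX k n c ⟶ Rep.of ρ}
    (h : ∀ Γ : Cell n c, toCochain φ Γ.1 = toCochain ψ Γ.1) : φ = ψ := by
  refine Rep.free_ext _ _ _ _ _ fun Γ => ?_
  simpa only [toCochain, extendCell_coe] using h Γ

theorem nonempty_groupCohomology_equiv (ρ : Representation k (BraidGroup (n + 1)) k) (q : k)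
    (hρ : ∀ s : Fin n, ρ (braidGen (n + 1) s) 1 = -q) (m : ℕ) (t : k) (z : Finset ℕ → k)
    (hz : ∀ Γ ⊆ Finset.range n, twistedDelta n q z Γ = 0) (hz' : ∀ Γ, Γ.card ≠ m → z Γ = 0)
    (hcyc : ∀ x : Finset ℕ → k, (∀ Γ, Γ.card ≠ m → x Γ = 0) →
      (∀ Γ ⊆ Finset.range n, twistedDelta n q x Γ = 0) →
      ∃ (r : k) (y : Finset ℕ → k), (∀ Γ, Γ.card + 1 ≠ m → y Γ = 0) ∧
        ∀ Γ ⊆ Finset.range n, x Γ = r * z Γ + twistedDelta n q y Γ)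
    (ht : ∀ r : k, (∃ y : Finset ℕ → k, (∀ Γ, Γ.card + 1 ≠ m → y Γ = 0) ∧
      ∀ Γ ⊆ Finset.range n, twistedDelta n q y Γ = r * z Γ) ↔ t ∣ r) :
    Nonempty (groupCohomology (Rep.of ρ) m ≃ₗ[k] k ⧸ Ideal.span {t}) := by
  let K := (salvettiResolution k n).complex.linearYonedaObj k (Rep.of ρ)
  have hd (c : ℕ) (φ : salvettiX k n c ⟶ Rep.of ρ) :
      (K.d c (c + 1) φ : salvettiX k n (c + 1) ⟶ Rep.of ρ) = salvettiD k n c ≫ φ :=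
    congrArg (· ≫ φ) (salvettiComplex_d k n c)
  have hδ {c : ℕ} (φ : salvettiX k n c ⟶ Rep.of ρ) (Γ : Cell n (c + 1)) :
      toCochain (salvettiD k n c ≫ φ) Γ.1 = twistedDelta n q (toCochain φ) Γ.1 :=
    toCochain_comp ρ q hρ φ Γ
  have hcongr {f f' : Finset ℕ → k} {Γ : Finset ℕ} (hΓ : Γ ⊆ Finset.range n)
      (h : ∀ Γ ⊆ Finset.range n, f Γ = f' Γ) :
      twistedDelta n q f Γ = twistedDelta n q f' Γ :=
    Finset.sum_congr rfl fun s _ => by rw [h _ ((Finset.erase_subset _ _).trans hΓ)]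
  have hof {c : ℕ} {f : Finset ℕ → k} (hf : ∀ Γ, Γ.card ≠ c → f Γ = 0) {Γ : Finset ℕ}
      (hΓ : Γ ⊆ Finset.range n) : toCochain (ofCochain ρ f : salvettiX k n c ⟶ _) Γ = f Γ := by
    by_cases h : Γ.card = c
    · exact toCochain_ofCochain ρ f ⟨Γ, Finset.mem_powersetCard.2 ⟨hΓ, h⟩⟩
    · rw [hf Γ h]; exact extendCell_of_card_ne _ h
  have hzero {c : ℕ} : toCochain (0 : salvettiX k n c ⟶ Rep.of ρ) = fun _ => 0 := by
    funext Γ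
    simp only [toCochain, extendCell]
    split_ifs <;> rfl
  have hadd {c : ℕ} (r : k) (φ ψ : salvettiX k n c ⟶ Rep.of ρ) (Γ : Finset ℕ) :
      toCochain (r • φ + ψ) Γ = r * toCochain φ Γ + toCochain ψ Γ := by
    simp only [toCochain, extendCell]
    split_ifs
    · rfl
    · simp
  have hsmul {c : ℕ} (r : k) (φ : salvettiX k n c ⟶ Rep.of ρ) (Γ : Finset ℕ) :
      toCochain (r • φ) Γ = r * toCochain φ Γ := by
    have := hadd r φ 0 Γ
    rwa [add_zero, hzero, add_zero] at this
  have hδof {c : ℕ} {f : Finset ℕ → k} (hf : ∀ Γ, Γ.card ≠ c → f Γ = 0) (Γ : Cell n (c + 1)) :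
      toCochain (salvettiD k n c ≫ ofCochain ρ f) Γ.1 = twistedDelta n q f Γ.1 :=
    (hδ _ Γ).trans (hcongr Γ.subset fun _ h => hof hf h)
  refine (CochainComplex.nonempty_homology_equiv_quotient_span K m t
    (ofCochain ρ z : salvettiX k n m ⟶ _) ?_ ?_ ?_).map
      fun e => (groupCohomologyIso (Rep.of ρ) m (salvettiResolution k n)).toLinearEquiv.trans e
  · refine (hd m _).trans (toCochain_injective fun Γ => ?_)
    exact (hδof hz' Γ).trans ((hz _ Γ.subset).trans (congrFun hzero Γ.1).symm)
  · intro (φ : salvettiX k n m ⟶ Rep.of ρ) hφ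
    replace hφ : salvettiD k n m ≫ φ = 0 := (hd m φ).symm.trans hφ
    have hcard : ∀ Γ, Γ.card ≠ m → toCochain φ Γ = 0 := fun _ h => extendCell_of_card_ne _ h
    obtain ⟨r, y, hy, hy'⟩ := hcyc (toCochain φ) hcard fun Γ hΓ => by
      by_cases h : Γ.card = m + 1
      · rw [← hδ φ ⟨Γ, Finset.mem_powersetCard.2 ⟨hΓ, h⟩⟩, hφ, hzero]
      · exact twistedDelta_eq_zero_of_card hcard h
    cases m with
    | zero =>
      refine ⟨r, 0, 0, ?_⟩
      rw [map_zero, add_zero]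
      refine toCochain_injective (ρ := ρ) (φ := φ) (ψ := r • ofCochain ρ z) fun Γ => ?_
      refine ((hy' _ Γ.subset).trans ?_).trans ((hsmul r (ofCochain ρ z) Γ.1).trans
        (congrArg (r * ·) (toCochain_ofCochain ρ z Γ))).symm
      simp [twistedDelta, hy]
    | succ m =>
      refine ⟨r, m, (ofCochain ρ y : salvettiX k n m ⟶ _), ?_⟩
      rw [hd]
      refine toCochain_injective (ρ := ρ) (φ := φ)
        (ψ := r • ofCochain ρ z + salvettiD k n m ≫ ofCochain ρ y) fun Γ => ?_
      have := hadd r (ofCochain ρ z) (salvettiD k n m ≫ ofCochain ρ y) Γ.1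
      rw [hδof fun Γ h => hy Γ (by omega), toCochain_ofCochain] at this
      exact (hy' _ Γ.subset).trans this.symm
  · intro r
    rw [← ht]
    constructor
    · rintro (⟨j, φ, rfl, hφ⟩ | h)
      · replace hφ := (hd j φ).symm.trans hφ
        refine ⟨toCochain (ρ := ρ) φ, fun Γ h => extendCell_of_card_ne _ (by omega),
          fun Γ hΓ => ?_⟩
        by_cases h : Γ.card = j + 1
        · rw [← hδ φ ⟨Γ, Finset.mem_powersetCard.2 ⟨hΓ, h⟩⟩]
          rw [← hof hz' hΓ]
          refine Eq.trans ?_ (hsmul r (ofCochain ρ z : salvettiX k n (j + 1) ⟶ _) Γ)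
          exact congrArg (fun φ : salvettiX k n (j + 1) ⟶ Rep.of ρ => toCochain φ Γ) hφ
        · rw [hz' _ h, mul_zero]
          exact twistedDelta_eq_zero_of_card (fun _ h => extendCell_of_card_ne _ h) h
      · refine ⟨0, fun _ _ => rfl, fun Γ hΓ => ?_⟩
        rw [← hof hz' hΓ]
        refine Eq.trans ?_ (hsmul r (ofCochain ρ z : salvettiX k n m ⟶ _) Γ)
        have h2 := congrArg (fun φ : salvettiX k n m ⟶ Rep.of ρ => toCochain φ Γ) h
        exact Eq.trans (by simp [twistedDelta]) (h2.trans (congrFun hzero Γ)).symm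
    · rintro ⟨y, hy, hy'⟩
      cases m with
      | zero =>
        right
        refine toCochain_injective (ρ := ρ) (φ := r • ofCochain ρ z) (ψ := 0) fun Γ => ?_
        refine ((hsmul r (ofCochain ρ z) Γ.1).trans (congrArg (r * ·)
          (toCochain_ofCochain ρ z Γ))).trans (((hy' _ Γ.subset).symm.trans ?_).trans
            (congrFun hzero Γ.1).symm)
        simp [twistedDelta, hy]
      | succ m =>
        left
        refine ⟨m, (ofCochain ρ y : salvettiX k n m ⟶ _), rfl, ?_⟩
        rw [hd]
        refine toCochain_injective (ρ := ρ) (φ := salvettiD k n m ≫ ofCochain ρ y)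
          (ψ := r • ofCochain ρ z) fun Γ => ?_
        exact ((hδof (fun Γ h => hy Γ (by omega)) Γ).trans (hy' _ Γ.subset)).trans
          ((hsmul r (ofCochain ρ z) Γ.1).trans
            (congrArg (r * ·) (toCochain_ofCochain ρ z Γ))).symm

end HomComplex

end

namespace SimplexCochain

section Basic

variable {R F : Type*} [CommRing R] [Field F] [Algebra R F]

/-- The coboundary of the simplex; a face is encoded as the list of its indicator values. -/
def coboundary : (List Bool → F) → List Bool → F
  | _, [] => 0
  | x, false :: l => coboundary (fun l => x (false :: l)) l
  | x, true :: l => x (false :: l) - coboundary (fun l => x (true :: l)) l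

theorem coboundary_add (x y : List Bool → F) :
    coboundary (x + y) = coboundary x + coboundary y := by
  funext l
  induction l generalizing x y with
  | nil => simp [coboundary]
  | cons b l ih =>
    cases b
    · exact ih (fun l => x (false :: l)) fun l => y (false :: l)
    · have := ih (fun l => x (true :: l)) fun l => y (true :: l)
      simp only [Pi.add_apply] at this
      simp only [coboundary, Pi.add_apply]
      rw [show (fun l => x (true :: l) + y (true :: l)) =
        (fun l => x (true :: l)) + fun l => y (true :: l) from rfl, this]
      ring

theorem coboundary_smul (r : R) (x : List Bool → F) :
    coboundary (r • x) = r • coboundary x := by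
  funext l
  induction l generalizing x with
  | nil => simp [coboundary]
  | cons b l ih =>
    cases b
    · exact ih fun l => x (false :: l)
    · have := ih (fun l => x (true :: l))
      simp only [Pi.smul_apply] at this
      simp only [coboundary, Pi.smul_apply]
      rw [show (fun l => r • x (true :: l)) = r • (fun l => x (true :: l)) from rfl, this, smul_sub]

theorem coboundary_congr {x y : List Bool → F} {l : List Bool}
    (h : ∀ l', l'.length = l.length → x l' = y l') : coboundary x l = coboundary y l := by
  induction l generalizing x y with
  | nil => rfl
  | cons b l ih =>
    cases b
    · exact ih fun l' hl => h _ (by simp [hl])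
    · simp only [coboundary]
      rw [h (false :: l) rfl, ih (y := fun l => y (true :: l)) fun l' hl => h _ (by simp [hl])]

theorem coboundary_coboundary (x : List Bool → F) : coboundary (coboundary x) = 0 := by
  funext l
  induction l generalizing x with
  | nil => rfl
  | cons b l ih =>
    cases b
    · exact ih fun l => x (false :: l)
    · have h1 := ih fun l => x (true :: l)
      have h2 := coboundary_add (fun l => x (false :: l))
        ((-1 : ℤ) • coboundary (fun l => x (true :: l)))
      rw [coboundary_smul] at h2
      simp only [coboundary]
      rw [show (fun l => x (false :: l) - coboundary (fun l => x (true :: l)) l) =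
        (fun l => x (false :: l)) + (-1 : ℤ) • coboundary (fun l => x (true :: l)) by
          funext l; simp [sub_eq_add_neg], h2]
      simp [h1]

variable (F) in
/-- The coboundary as a linear map. -/
def d (R : Type*) [CommRing R] [Algebra R F] : (List Bool → F) →ₗ[R] (List Bool → F) where
  toFun := coboundary
  map_add' := coboundary_add
  map_smul' := coboundary_smul

theorem d_d (x : List Bool → F) : d F R (d F R x) = 0 := coboundary_coboundary x

/-- The cochain on the faces of a cone with given values on the two kinds of faces. -/
def pair (a b : List Bool → F) : List Bool → F
  | [] => 0
  | false :: l => a l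
  | true :: l => b l

theorem eq_pair {x : List Bool → F} (h : x [] = 0) :
    x = pair (fun l => x (false :: l)) fun l => x (true :: l) := by
  funext l
  cases l with
  | nil => exact h
  | cons b l => cases b <;> rfl

theorem pair_inj {a b a' b' : List Bool → F} : pair a b = pair a' b' ↔ a = a' ∧ b = b' := by
  refine ⟨fun h => ⟨funext fun l => congrFun h (false :: l), funext fun l => congrFun h (true :: l)⟩,
    ?_⟩
  rintro ⟨rfl, rfl⟩; rfl

theorem pair_add (a b a' b' : List Bool → F) : pair a b + pair a' b' = pair (a + a') (b + b') := by
  funext l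
  cases l with
  | nil => exact add_zero _
  | cons b l => cases b <;> rfl

theorem smul_pair (r : R) (a b : List Bool → F) : r • pair a b = pair (r • a) (r • b) := by
  funext l
  cases l with
  | nil => exact smul_zero (A := F) r
  | cons b l => cases b <;> rfl

theorem pair_zero : pair (0 : List Bool → F) 0 = 0 := (eq_pair (x := (0 : List Bool → F)) rfl).symm

theorem d_pair (a b : List Bool → F) : d F R (pair a b) = pair (d F R a) (a - d F R b) := by
  funext l
  cases l with
  | nil => rfl
  | cons b l => cases b <;> rfl

variable (F) in
/-- The cochains of an `n`-element simplex which are supported on the faces with `k` missing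
vertices and become integral after multiplication with the weight `u`. -/
def W (u : List Bool → R) (n : ℕ) (k : ℤ) : Submodule R (List Bool → F) where
  carrier := {x | ∀ l, (x l ≠ 0 → l.length = n ∧ (l.count false : ℤ) = k) ∧
    ∃ r : R, algebraMap R F (u l) * x l = algebraMap R F r}
  zero_mem' := fun l => ⟨fun h => absurd rfl h, 0, by simp⟩
  add_mem' := by
    intro x y hx hy l
    refine ⟨fun h => ?_, ?_⟩
    · by_cases h' : x l = 0
      · exact (hy l).1 fun h'' => h (by simp [h', h''])
      · exact (hx l).1 h'
    · obtain ⟨r, hr⟩ := (hx l).2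
      obtain ⟨s, hs⟩ := (hy l).2
      exact ⟨r + s, by rw [Pi.add_apply, mul_add, hr, hs, map_add]⟩
  smul_mem' := by
    intro c x hx l
    refine ⟨fun h => (hx l).1 fun h' => h (by simp [h']), ?_⟩
    obtain ⟨r, hr⟩ := (hx l).2
    exact ⟨c * r, by rw [Pi.smul_apply, mul_smul_comm, hr, Algebra.smul_def, map_mul]⟩

theorem W_mono {u v : List Bool → R} (h : ∀ l, u l ∣ v l) (n : ℕ) (k : ℤ) :
    W F u n k ≤ W F v n k := by
  intro x hx l
  refine ⟨(hx l).1, ?_⟩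
  obtain ⟨r, hr⟩ := (hx l).2
  obtain ⟨s, hs⟩ := h l
  exact ⟨s * r, by rw [hs, map_mul, map_mul, ← hr]; ring⟩

theorem pair_mem {u : List Bool → R} {n : ℕ} {k : ℤ} {a b : List Bool → F} :
    pair a b ∈ W F u (n + 1) k ↔
      a ∈ W F (fun l => u (false :: l)) n (k - 1) ∧ b ∈ W F (fun l => u (true :: l)) n k := by
  constructor
  · intro h
    refine ⟨fun l => ⟨fun hl => ?_, (h (false :: l)).2⟩, fun l => ⟨fun hl => ?_, (h (true :: l)).2⟩⟩
    · have := (h (false :: l)).1 hl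
      simp only [List.length_cons, List.count_cons, beq_self_eq_true, if_true] at this
      push_cast at this
      omega
    · have := (h (true :: l)).1 hl
      simp at this
      omega
  · rintro ⟨ha, hb⟩ l
    match l with
    | [] => exact ⟨fun h => absurd rfl h, 0, by simp [pair]⟩
    | false :: l =>
      refine ⟨fun hl => ?_, (ha l).2⟩
      have := (ha l).1 hl
      simp
      omega
    | true :: l =>
      refine ⟨fun hl => ?_, (hb l).2⟩
      have := (hb l).1 hl
      simp
      omega

theorem exists_eq_pair {u : List Bool → R} {n : ℕ} {k : ℤ} {x : List Bool → F}
    (hx : x ∈ W F u (n + 1) k) : ∃ a ∈ W F (fun l => u (false :: l)) n (k - 1),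
      ∃ b ∈ W F (fun l => u (true :: l)) n k, x = pair a b := by
  have h0 : x [] = 0 := by
    by_contra h
    have := ((hx []).1 h).1
    simp at this
  have := eq_pair h0
  rw [this, pair_mem] at hx
  exact ⟨_, hx.1, _, hx.2, this⟩

end Basic

section Homology

variable {R V : Type*} [CommRing R] [AddCommGroup V] [Module R V]

/-- Exactness at degree `k` of a graded family of submodules with a differential lowering the
degree. -/
def Ex (δ : V →ₗ[R] V) (K : ℤ → Submodule R V) (k : ℤ) : Prop :=
  ∀ x ∈ K k, δ x = 0 → ∃ y ∈ K (k + 1), δ y = x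

/-- The homology at degree `k` is cyclic with annihilator generated by `t`. -/
def Cyc (δ : V →ₗ[R] V) (K : ℤ → Submodule R V) (t : R) (k : ℤ) : Prop :=
  ∃ z ∈ K k, δ z = 0 ∧ (∀ x ∈ K k, δ x = 0 → ∃ r : R, ∃ y ∈ K (k + 1), x = r • z + δ y) ∧
    ∀ r : R, (∃ y ∈ K (k + 1), δ y = r • z) ↔ t ∣ r

variable {δ : V →ₗ[R] V} {K K₁ K₂ K₀ : ℤ → Submodule R V}

/-- Two families of submodules of the same complex, covering `K` and meeting in `K₀`. -/
structure Cover (δ : V →ₗ[R] V) (K K₁ K₂ K₀ : ℤ → Submodule R V) : Prop where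
  stable : ∀ k, ∀ x ∈ K₁ (k + 1), δ x ∈ K₁ k
  stable' : ∀ k, ∀ x ∈ K₂ (k + 1), δ x ∈ K₂ k
  le : ∀ k, K₁ k ≤ K k
  le' : ∀ k, K₂ k ≤ K k
  inter : ∀ k, ∀ x ∈ K₁ k, x ∈ K₂ k → x ∈ K₀ k
  base : ∀ k, K₀ k ≤ K₁ k
  base' : ∀ k, K₀ k ≤ K₂ k
  exists_add : ∀ k, ∀ x ∈ K k, ∃ y ∈ K₁ k, ∃ z ∈ K₂ k, x = y + z

theorem Cover.exists_cycles (h : Cover δ K K₁ K₂ K₀) (hδ : ∀ x, δ (δ x) = 0)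
    (h₀ : ∀ k, Ex δ K₀ k) {k : ℤ} {x : V} (hx : x ∈ K k) (hx' : δ x = 0) :
    ∃ y ∈ K₁ k, ∃ z ∈ K₂ k, x = y + z ∧ δ y = 0 ∧ δ z = 0 := by
  obtain ⟨y, hy, z, hz, rfl⟩ := h.exists_add k x hx
  rw [map_add] at hx'
  obtain ⟨j, rfl⟩ : ∃ j, k = j + 1 := ⟨k - 1, by ring⟩
  have h1 : δ y ∈ K₀ j := h.inter j _ (h.stable j y hy) (by
    rw [eq_neg_of_add_eq_zero_left hx']
    exact neg_mem (h.stable' j z hz))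
  obtain ⟨w, hw, hw'⟩ := h₀ j _ h1 (hδ y)
  refine ⟨y - w, sub_mem hy (h.base _ hw), z + w, add_mem hz (h.base' _ hw), by abel, ?_, ?_⟩
  · rw [map_sub, hw', sub_self]
  · rw [map_add, hw', add_comm, hx']

theorem Cover.ex (h : Cover δ K K₁ K₂ K₀) (hδ : ∀ x, δ (δ x) = 0)
    (h₀ : ∀ k, Ex δ K₀ k) {k : ℤ} (h₁ : Ex δ K₁ k) (h₂ : Ex δ K₂ k) : Ex δ K k := by
  intro x hx hx'
  obtain ⟨y, hy, z, hz, rfl, hy', hz'⟩ := h.exists_cycles hδ h₀ hx hx'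
  obtain ⟨a, ha, rfl⟩ := h₁ y hy hy'
  obtain ⟨b, hb, rfl⟩ := h₂ z hz hz'
  exact ⟨a + b, add_mem (h.le _ ha) (h.le' _ hb), map_add _ _ _⟩

theorem Cover.cyc (h : Cover δ K K₁ K₂ K₀) (hδ : ∀ x, δ (δ x) = 0)
    (h₀ : ∀ k, Ex δ K₀ k) {k : ℤ} {t : R} (h₁ : Cyc δ K₁ t k) (h₂ : Ex δ K₂ k) : Cyc δ K t k := by
  obtain ⟨z, hz, hz', hc, ht⟩ := h₁
  refine ⟨z, h.le _ hz, hz', ?_, fun r => ?_⟩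
  · intro x hx hx'
    obtain ⟨y, hy, w, hw, rfl, hy', hw'⟩ := h.exists_cycles hδ h₀ hx hx'
    obtain ⟨r, a, ha, rfl⟩ := hc y hy hy'
    obtain ⟨b, hb, rfl⟩ := h₂ w hw hw'
    exact ⟨r, a + b, add_mem (h.le _ ha) (h.le' _ hb), by rw [map_add, add_assoc]⟩
  · rw [← ht]
    constructor
    · rintro ⟨y, hy, hy'⟩
      obtain ⟨a, ha, b, hb, rfl⟩ := h.exists_add _ y hy
      have h1 : δ b = r • z - δ a := by rw [← hy', map_add]; abel
      have h2 : δ b ∈ K₀ k := h.inter k _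
        (h1 ▸ sub_mem (Submodule.smul_mem _ _ hz) (h.stable k a ha)) (h.stable' k b hb)
      obtain ⟨w, hw, hw'⟩ := h₀ k _ h2 (hδ b)
      exact ⟨a + w, add_mem ha (h.base _ hw), by rw [map_add, hw', h1]; abel⟩
    · rintro ⟨y, hy, hy'⟩
      exact ⟨y, h.le _ hy, hy'⟩

end Homology

section Cone

variable {R F : Type*} [CommRing R] [Field F] [Algebra R F]

theorem d_mem_cone {u : List Bool → R} {n : ℕ} (hu : ∀ l, u (false :: l) ∣ u (true :: l))
    (hA : ∀ k, ∀ x ∈ W F (fun l => u (false :: l)) n (k + 1),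
      d F R x ∈ W F (fun l => u (false :: l)) n k)
    (hB : ∀ k, ∀ x ∈ W F (fun l => u (true :: l)) n (k + 1),
      d F R x ∈ W F (fun l => u (true :: l)) n k) (k : ℤ) (x : List Bool → F)
    (hx : x ∈ W F u (n + 1) (k + 1)) : d F R x ∈ W F u (n + 1) k := by
  obtain ⟨a, ha, b, hb, rfl⟩ := exists_eq_pair hx
  rw [d_pair, pair_mem]
  refine ⟨hA (k - 1) _ (by rwa [sub_add_cancel, ← add_sub_cancel_right k 1]), sub_mem ?_ (hB _ _ hb)⟩
  rw [add_sub_cancel_right] at ha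
  exact W_mono hu _ _ ha

theorem d_pair_eq_zero {a b : List Bool → F} : d F R (pair a b) = 0 ↔ d F R b = a := by
  rw [d_pair, ← pair_zero, pair_inj]
  constructor
  · rintro ⟨-, h⟩
    exact (sub_eq_zero.1 h).symm
  · rintro rfl
    exact ⟨d_d b, sub_self _⟩

theorem ex_of_eq {u : List Bool → R} {n : ℕ} (hu : ∀ l, u (false :: l) = u (true :: l)) (k : ℤ) :
    Ex (d F R) (W F u (n + 1)) k := by
  intro x hx hx'
  obtain ⟨a, ha, b, hb, rfl⟩ := exists_eq_pair hx
  obtain rfl := d_pair_eq_zero.1 hx'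
  refine ⟨pair b 0, pair_mem.2 ⟨?_, zero_mem _⟩, ?_⟩
  · rw [add_sub_cancel_right, show (fun l => u (false :: l)) = fun l => u (true :: l) from funext hu]
    exact hb
  · rw [d_pair, map_zero, sub_zero]

theorem ex_cone {u : List Bool → R} {n : ℕ} {k : ℤ}
    (hinj : ∀ b ∈ W F (fun l => u (true :: l)) n k,
      d F R b ∈ W F (fun l => u (false :: l)) n (k - 1) →
      ∃ a ∈ W F (fun l => u (false :: l)) n k, d F R a = d F R b)
    (hsurj : ∀ b ∈ W F (fun l => u (true :: l)) n k, d F R b = 0 →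
      ∃ a ∈ W F (fun l => u (false :: l)) n k, ∃ c ∈ W F (fun l => u (true :: l)) n (k + 1),
        b = a + d F R c)
    (hu : ∀ l, u (false :: l) ∣ u (true :: l)) :
    Ex (d F R) (W F u (n + 1)) k := by
  intro x hx hx'
  obtain ⟨a, ha, b, hb, rfl⟩ := exists_eq_pair hx
  obtain rfl := d_pair_eq_zero.1 hx'
  obtain ⟨a, ha', h⟩ := hinj b hb ha
  obtain ⟨a', ha'', c, hc, h'⟩ := hsurj (b - a) (sub_mem hb (W_mono hu _ _ ha'))
    (by rw [map_sub, h, sub_self])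
  refine ⟨pair (a + a') (-c), pair_mem.2 ⟨?_, neg_mem hc⟩, ?_⟩
  · rw [add_sub_cancel_right]
    exact add_mem ha' ha''
  · obtain rfl : b = a + a' + d F R c := by rw [add_assoc, ← h']; abel
    rw [d_pair, map_neg, sub_neg_eq_add, map_add _ (a + a'), d_d, add_zero]

theorem cyc_cone_of_ex_left {u : List Bool → R} {n : ℕ} {k : ℤ} {t : R}
    (hu : ∀ l, u (false :: l) ∣ u (true :: l))
    (hA : Ex (d F R) (W F (fun l => u (false :: l)) n) (k - 1))
    (hA' : Ex (d F R) (W F (fun l => u (false :: l)) n) k)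
    (hB : Cyc (d F R) (W F (fun l => u (true :: l)) n) t k) :
    Cyc (d F R) (W F u (n + 1)) t k := by
  obtain ⟨z, hz, hz', hc, ht⟩ := hB
  refine ⟨pair 0 z, pair_mem.2 ⟨zero_mem _, hz⟩, d_pair_eq_zero.2 hz', ?_, fun r => ?_⟩
  · intro x hx hx'
    obtain ⟨a, ha, b, hb, rfl⟩ := exists_eq_pair hx
    obtain rfl := d_pair_eq_zero.1 hx'
    obtain ⟨a, ha', h⟩ := hA _ ha (d_d b)
    rw [sub_add_cancel] at ha'
    obtain ⟨r, c, hc, h'⟩ := hc (b - a) (sub_mem hb (W_mono hu _ _ ha'))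
      (by rw [map_sub, h, sub_self])
    refine ⟨r, pair a (-c), pair_mem.2 ⟨by rwa [add_sub_cancel_right], neg_mem hc⟩, ?_⟩
    rw [smul_pair, d_pair, pair_add, pair_inj, smul_zero, zero_add, h, map_neg, sub_neg_eq_add]
    exact ⟨rfl, by rw [eq_add_of_sub_eq h']; abel⟩
  · rw [← ht]
    constructor
    · rintro ⟨y, hy, hy'⟩
      obtain ⟨a, ha, b, hb, rfl⟩ := exists_eq_pair hy
      rw [add_sub_cancel_right] at ha
      rw [d_pair, smul_pair, pair_inj, smul_zero] at hy'
      obtain ⟨c, hc, rfl⟩ := hA' a ha hy'.1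
      exact ⟨c - b, sub_mem (W_mono hu _ _ hc) hb, by rw [map_sub, hy'.2]⟩
    · rintro ⟨y, hy, hy'⟩
      refine ⟨pair 0 (-y), pair_mem.2 ⟨zero_mem _, neg_mem hy⟩, ?_⟩
      rw [d_pair, smul_pair, map_zero, map_neg, hy', smul_zero, zero_sub, neg_neg]

theorem cyc_cone_of_ex_right {u : List Bool → R} {n : ℕ} {k : ℤ} {t : R}
    (hu : ∀ l, u (false :: l) ∣ u (true :: l))
    (hA : Cyc (d F R) (W F (fun l => u (false :: l)) n) t (k - 1))
    (hB : Ex (d F R) (W F (fun l => u (true :: l)) n) (k - 1))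
    (hB' : Ex (d F R) (W F (fun l => u (true :: l)) n) k) :
    Cyc (d F R) (W F u (n + 1)) t k := by
  obtain ⟨z, hz, hz', hc, ht⟩ := hA
  obtain ⟨b₀, hb₀, rfl⟩ := hB z (W_mono hu _ _ hz) hz'
  simp only [sub_add_cancel] at hc ht hb₀
  refine ⟨pair (d F R b₀) b₀, pair_mem.2 ⟨hz, hb₀⟩, d_pair_eq_zero.2 rfl, ?_, fun r => ?_⟩
  · intro x hx hx'
    obtain ⟨a, ha, b, hb, rfl⟩ := exists_eq_pair hx
    obtain rfl := d_pair_eq_zero.1 hx'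
    obtain ⟨r, a, ha', h⟩ := hc _ ha (d_d b)
    obtain ⟨c, hc, h'⟩ := hB' (b - r • b₀ - a)
      (sub_mem (sub_mem hb (Submodule.smul_mem _ _ hb₀)) (W_mono hu _ _ ha'))
      (by rw [map_sub, map_sub, h, map_smul]; abel)
    refine ⟨r, pair a (-c), pair_mem.2 ⟨by rwa [add_sub_cancel_right], neg_mem hc⟩, ?_⟩
    rw [smul_pair, d_pair, pair_add, pair_inj, map_neg, sub_neg_eq_add]
    exact ⟨h, by rw [h']; abel⟩
  · rw [← ht]
    constructor
    · rintro ⟨y, hy, hy'⟩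
      obtain ⟨a, ha, b, hb, rfl⟩ := exists_eq_pair hy
      rw [add_sub_cancel_right] at ha
      rw [d_pair, smul_pair, pair_inj] at hy'
      exact ⟨a, ha, hy'.1⟩
    · rintro ⟨a, ha, h⟩
      obtain ⟨c, hc, h'⟩ := hB' (r • b₀ - a)
        (sub_mem (Submodule.smul_mem _ _ hb₀) (W_mono hu _ _ ha))
        (by rw [map_sub, map_smul, h, sub_self])
      refine ⟨pair a (-c), pair_mem.2 ⟨by rwa [add_sub_cancel_right], neg_mem hc⟩, ?_⟩
      rw [d_pair, smul_pair, pair_inj, map_neg, sub_neg_eq_add]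
      exact ⟨h, by rw [h']; abel⟩

theorem injective_cone {u v : List Bool → R} {n : ℕ} {k : ℤ}
    (hu : ∀ l, u (false :: l) ∣ u (true :: l)) (huv : ∀ l, v (false :: l) = u (false :: l))
    (hB : Ex (d F R) (W F (fun l => u (true :: l)) n) k) (y : List Bool → F)
    (hy : y ∈ W F v (n + 1) (k + 1)) (hy' : d F R y ∈ W F u (n + 1) k) :
    ∃ x ∈ W F u (n + 1) (k + 1), d F R x = d F R y := by
  obtain ⟨a, ha, b, hb, rfl⟩ := exists_eq_pair hy
  rw [show (fun l => v (false :: l)) = fun l => u (false :: l) from funext huv] at ha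
  rw [d_pair, pair_mem] at hy'
  have ha' := ha
  rw [add_sub_cancel_right] at ha'
  have h1 : d F R b ∈ W F (fun l => u (true :: l)) n k := by
    have := sub_mem (W_mono hu _ _ ha') hy'.2
    rwa [sub_sub_cancel] at this
  obtain ⟨c, hc, h⟩ := hB _ h1 (d_d b)
  exact ⟨pair a c, pair_mem.2 ⟨ha, hc⟩, by rw [d_pair, d_pair, h]⟩

theorem surjective_cone {u v : List Bool → R} {n : ℕ} {k : ℤ}
    (hu : ∀ l, u (false :: l) ∣ u (true :: l)) (huv : ∀ l, v (false :: l) = u (false :: l))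
    (huv' : ∀ l, u (true :: l) ∣ v (true :: l))
    (hB : Ex (d F R) (W F (fun l => u (true :: l)) n) (k - 1))
    (hB' : Ex (d F R) (W F (fun l => v (true :: l)) n) k) (y : List Bool → F)
    (hy : y ∈ W F v (n + 1) k) (hy' : d F R y = 0) :
    ∃ x ∈ W F u (n + 1) k, ∃ c ∈ W F v (n + 1) (k + 1), y = x + d F R c := by
  obtain ⟨a, ha, b, hb, rfl⟩ := exists_eq_pair hy
  rw [show (fun l => v (false :: l)) = fun l => u (false :: l) from funext huv] at ha
  obtain rfl := d_pair_eq_zero.1 hy'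
  obtain ⟨b', hb', h⟩ := hB _ (W_mono hu _ _ ha) (d_d b)
  rw [sub_add_cancel] at hb'
  obtain ⟨c, hc, h'⟩ := hB' (b - b') (sub_mem hb (W_mono huv' _ _ hb'))
    (by rw [map_sub, h, sub_self])
  refine ⟨pair (d F R b) b', pair_mem.2 ⟨ha, hb'⟩, pair 0 (-c),
    pair_mem.2 ⟨zero_mem _, neg_mem hc⟩, ?_⟩
  rw [d_pair, pair_add, pair_inj, map_zero, map_neg, sub_neg_eq_add, zero_add, h', add_zero]
  exact ⟨rfl, by abel⟩

end Cone

/-- A counter runs along the list, starting at `c`; it is increased at every `true`, reset to `1`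
at every `false`, and reset to `0` when it reaches `h`. The result is the number of times it
reaches `h`. -/
def jumps (h : ℕ) : ℕ → List Bool → ℕ
  | _, [] => 0
  | _, false :: l => jumps h 1 l
  | c, true :: l => if c + 1 = h then 1 + jumps h 0 l else jumps h (c + 1) l

section Jumps

variable {h : ℕ}

theorem jumps_zero_cons (hh : 2 ≤ h) (b : Bool) (l : List Bool) :
    jumps h 0 (b :: l) = jumps h 1 l := by
  cases b
  · rfl
  · simp only [jumps]
    rw [if_neg (by omega)]

theorem jumps_mono_and_le (hh : 2 ≤ h) (l : List Bool) :
    (∀ c c', c ≤ c' → c' < h → jumps h c l ≤ jumps h c' l) ∧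
      ∀ c, c < h → jumps h c l ≤ 1 + jumps h 0 l := by
  induction l with
  | nil => simp [jumps]
  | cons b l ih =>
    obtain ⟨ih1, ih2⟩ := ih
    cases b
    · exact ⟨fun _ _ _ _ => le_rfl, fun _ _ => Nat.le_add_left _ _⟩
    · refine ⟨fun c c' hc hc' => ?_, fun c hc => ?_⟩
      · simp only [jumps]
        split_ifs with h1 h2 h2
        · exact le_rfl
        · omega
        · exact ih2 _ (by omega)
        · exact ih1 _ _ (by omega) (by omega)
      · rw [jumps_zero_cons hh]
        have h01 := ih1 0 1 (by omega) (by omega)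
        simp only [jumps]
        split_ifs with h1
        · omega
        · have := ih2 (c + 1) (by omega)
          omega

theorem jumps_mono (hh : 2 ≤ h) (l : List Bool) {c c' : ℕ} (hc : c ≤ c') (hc' : c' < h) :
    jumps h c l ≤ jumps h c' l := (jumps_mono_and_le hh l).1 c c' hc hc'

theorem jumps_le (hh : 2 ≤ h) (l : List Bool) {c : ℕ} (hc : c < h) :
    jumps h c l ≤ 1 + jumps h 0 l := (jumps_mono_and_le hh l).2 c hc

theorem jumps_false_le_true (hh : 2 ≤ h) (l : List Bool) {c : ℕ} (hc : c < h) :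
    jumps h c (false :: l) ≤ jumps h c (true :: l) := by
  simp only [jumps]
  split_ifs with h1
  · exact jumps_le hh l (by omega)
  · exact jumps_mono hh l (by omega) (by omega)

end Jumps

section Nil

variable {R F : Type*} [CommRing R] [Field F] [Algebra R F]

theorem d_eq_zero_of_mem_nil {u : List Bool → R} {k : ℤ} {x : List Bool → F}
    (hx : x ∈ W F u 0 k) : d F R x = 0 := by
  funext l
  cases l with
  | nil => rfl
  | cons b l =>
    have h1 : coboundary x (b :: l) = coboundary 0 (b :: l) := by
      refine coboundary_congr fun l' hl' => ?_
      by_contra h0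
      have := ((hx l').1 h0).1
      simp [this] at hl'
    exact h1.trans (congrFun (map_zero (d F R)) (b :: l))

theorem mem_nil_of_dvd {u v : List Bool → R} {k : ℤ} {x : List Bool → F} (h : u [] ∣ v [])
    (hx : x ∈ W F u 0 k) : x ∈ W F v 0 k := by
  intro l
  refine ⟨(hx l).1, ?_⟩
  cases l with
  | nil =>
    obtain ⟨r, hr⟩ := (hx []).2
    obtain ⟨s, hs⟩ := h
    exact ⟨s * r, by rw [hs, map_mul, map_mul, ← hr]; ring⟩
  | cons b l =>
    have h0 : x (b :: l) = 0 := by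
      by_contra h0
      simpa using ((hx _).1 h0).1
    exact ⟨0, by simp [h0]⟩

theorem eq_zero_of_mem_nil {u : List Bool → R} {k : ℤ} {x : List Bool → F} (hk : k ≠ 0)
    (hx : x ∈ W F u 0 k) : x = 0 := by
  funext l
  by_contra h0
  obtain ⟨h1, h2⟩ := (hx l).1 h0
  rw [List.length_eq_zero_iff] at h1
  subst h1
  exact hk (by simpa using h2.symm)

theorem d_mem_nil {u : List Bool → R} (k : ℤ) (x : List Bool → F)
    (hx : x ∈ W F u 0 (k + 1)) : d F R x ∈ W F u 0 k := by
  rw [d_eq_zero_of_mem_nil hx]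
  exact zero_mem _

theorem cyc_one [FaithfulSMul R F] {u : List Bool → R} {t : R} (ht : t ≠ 0) (h0 : u [false] = 1)
    (h1 : u [true] = t) : Cyc (d F R) (W F u 1) t 0 := by
  have hinj := FaithfulSMul.algebraMap_injective R F
  have ht' : algebraMap R F t ≠ 0 := fun h => ht (hinj (by rw [h, map_zero]))
  let z : List Bool → F := fun l => if l = [] then (algebraMap R F t)⁻¹ else 0
  have hz : z ∈ W F (fun l => u (true :: l)) 0 0 := by
    intro l
    by_cases hl : l = []
    · subst hl
      exact ⟨fun _ => by simp, 1, by simp [z, h1, mul_inv_cancel₀ ht']⟩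
    · exact ⟨fun h => absurd (if_neg hl) h, 0, by simp [z, hl]⟩
  refine ⟨pair 0 z, pair_mem.2 ⟨zero_mem _, hz⟩, d_pair_eq_zero.2 (d_eq_zero_of_mem_nil hz), ?_,
    fun r => ⟨?_, ?_⟩⟩
  · intro x hx _
    obtain ⟨a, ha, b, hb, rfl⟩ := exists_eq_pair (n := 0) hx
    obtain rfl := eq_zero_of_mem_nil (by omega) ha
    obtain ⟨r, hr⟩ := (hb []).2
    refine ⟨r, 0, zero_mem _, ?_⟩
    rw [map_zero, add_zero, smul_pair, smul_zero, pair_inj]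
    refine ⟨rfl, funext fun l => ?_⟩
    by_cases hl : l = []
    · subst hl
      beta_reduce at hr
      rw [h1] at hr
      simp only [Pi.smul_apply, z, if_true, Algebra.smul_def, ← hr]
      field_simp
    · have : b l = 0 := by
        by_contra h
        exact hl (List.length_eq_zero_iff.1 ((hb l).1 h).1)
      simp [this, z, hl]
  · rintro ⟨y, hy, hy'⟩
    obtain ⟨a, ha, b, hb, rfl⟩ := exists_eq_pair (n := 0) hy
    rw [d_pair, smul_pair, pair_inj, d_eq_zero_of_mem_nil hb, sub_zero] at hy'
    obtain ⟨s, hs⟩ := (ha []).2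
    beta_reduce at hs
    rw [hy'.2, h0, map_one, one_mul] at hs
    simp only [Pi.smul_apply, z, if_true, Algebra.smul_def] at hs
    refine ⟨s, hinj ?_⟩
    rw [map_mul, ← hs]
    field_simp
  · rintro ⟨s, rfl⟩
    refine ⟨pair ((t * s) • z) 0, pair_mem.2 ⟨?_, zero_mem _⟩, ?_⟩
    · intro l
      by_cases hl : l = []
      · subst hl
        refine ⟨fun _ => by simp, s, ?_⟩
        simp only [Pi.smul_apply, z, if_true, Algebra.smul_def, h0, map_one, one_mul, map_mul]
        field_simp
      · have : z l = 0 := if_neg hl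
        exact ⟨fun h => absurd (by simp [this]) h, 0, by simp [this]⟩
    · rw [d_pair, smul_pair, pair_inj, smul_zero, map_smul, d_eq_zero_of_mem_nil hz]
      simp

theorem ex_cone_of_ex {u : List Bool → R} {n : ℕ} {k : ℤ}
    (hA : Ex (d F R) (W F (fun l => u (false :: l)) n) (k - 1))
    (hB : Ex (d F R) (W F (fun l => u (true :: l)) n) k)
    (hu : ∀ l, u (false :: l) ∣ u (true :: l)) :
    Ex (d F R) (W F u (n + 1)) k := by
  refine ex_cone (fun b _ h => ?_) (fun b hb h => ?_) hu
  · obtain ⟨a, ha, h'⟩ := hA _ h (d_d b)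
    exact ⟨a, by rwa [sub_add_cancel] at ha, h'⟩
  · obtain ⟨c, hc, h'⟩ := hB b hb h
    exact ⟨0, zero_mem _, c, hc, by rw [h', zero_add]⟩

end Nil

section SingleWeight

variable {R F : Type*} [CommRing R] [Field F] [Algebra R F] {h : ℕ} {t : R}

variable (F h t) in
/-- The cochains whose denominators are controlled by powers of `t`, counted by `jumps`. -/
def J (c n : ℕ) : ℤ → Submodule R (List Bool → F) := W F (fun l => t ^ jumps h c l) n

variable (F h t) in
/-- The part of `J` that lives on the faces containing the first vertex. -/
def J' (c n : ℕ) : ℤ → Submodule R (List Bool → F) := W F (fun l => t ^ jumps h c (true :: l)) n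

theorem dvd_true (hh : 2 ≤ h) {c : ℕ} (hc : c < h) (l : List Bool) :
    t ^ jumps h c (false :: l) ∣ t ^ jumps h c (true :: l) :=
  pow_dvd_pow _ (jumps_false_le_true hh l hc)

theorem J'_eq {c : ℕ} (hc : c + 1 ≠ h) (n : ℕ) : J' F h t c n = J F h t (c + 1) n := by
  unfold J' J
  simp only [jumps, if_neg hc]

theorem ex_J'_of_eq (hh : 2 ≤ h) {c : ℕ} (hc : c + 1 = h) (n : ℕ) (k : ℤ) :
    Ex (d F R) (J' F h t c (n + 1)) k :=
  ex_of_eq (fun l => by simp only [jumps, if_pos hc]; rw [if_neg (by omega)]) k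

theorem jumps_append_false_le (hh : 2 ≤ h) (l₁ l₂ : List Bool) {c : ℕ} (hc : c < h) :
    jumps h c (l₁ ++ false :: l₂) ≤ jumps h c (l₁ ++ true :: l₂) := by
  induction l₁ generalizing c with
  | nil => exact jumps_false_le_true hh l₂ hc
  | cons b l ih =>
    cases b
    · exact ih (by omega)
    · simp only [List.cons_append, jumps]
      split_ifs with h1
      · exact Nat.add_le_add_left (ih (by omega)) 1
      · exact ih (by omega)

theorem d_mem_W {u : List Bool → R} (hu : ∀ l₁ l₂, u (l₁ ++ false :: l₂) ∣ u (l₁ ++ true :: l₂))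
    (n : ℕ) (k : ℤ) (x : List Bool → F) (hx : x ∈ W F u n (k + 1)) : d F R x ∈ W F u n k := by
  induction n generalizing u k x with
  | zero => exact d_mem_nil k x hx
  | succ n ih =>
    exact d_mem_cone (hu []) (fun k x => ih (fun l₁ l₂ => hu (false :: l₁) l₂) k x)
      (fun k x => ih (fun l₁ l₂ => hu (true :: l₁) l₂) k x) k x hx

variable (F h t) in
/-- The homology of the complexes `J` in all degrees. -/
structure Computed (n c : ℕ) (j : ℤ) : Prop where
  ex_even : ((c + n : ℕ) : ℤ) ≠ (j + 1) * h → Ex (d F R) (J F h t c n) (2 * j)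
  ex_odd : (n : ℤ) ≠ (j + 1) * h → Ex (d F R) (J F h t c n) (2 * j + 1)
  cyc_even : ((c + n : ℕ) : ℤ) = (j + 1) * h → Cyc (d F R) (J F h t c n) t (2 * j)
  cyc_odd : (n : ℤ) = (j + 1) * h → Cyc (d F R) (J F h t c n) t (2 * j + 1)
  injective : (n : ℤ) = (j + 1) * h → ∀ y ∈ J F h t c n (2 * j + 1 + 1),
    d F R y ∈ J F h t 1 n (2 * j + 1) → ∃ x ∈ J F h t 1 n (2 * j + 1 + 1), d F R x = d F R y
  surjective : (n : ℤ) = (j + 1) * h → ∀ y ∈ J F h t c n (2 * j + 1), d F R y = 0 →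
    ∃ x ∈ J F h t 1 n (2 * j + 1), ∃ w ∈ J F h t c n (2 * j + 1 + 1), y = x + d F R w

theorem ex_J_one (hh : 2 ≤ h) {c : ℕ} (hc : c < h) {k : ℤ} (hk : c + 1 ≠ h ∨ k ≠ 0) :
    Ex (d F R) (J F h t c 1) k := by
  refine ex_cone (fun b hb _ => ⟨0, zero_mem _, ?_⟩) (fun b hb _ => ?_) (dvd_true hh hc)
  · rw [d_eq_zero_of_mem_nil hb, map_zero]
  · rcases hk with hk | hk
    · refine ⟨b, mem_nil_of_dvd ?_ hb, 0, zero_mem _, by rw [map_zero, add_zero]⟩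
      simp [jumps, hk]
    · obtain rfl := eq_zero_of_mem_nil hk hb
      exact ⟨0, zero_mem _, 0, zero_mem _, by rw [map_zero, add_zero]⟩

theorem computed_one [FaithfulSMul R F] (ht : t ≠ 0) (hh : 2 ≤ h) {c : ℕ} (hc : c < h)
    (j : ℤ) : Computed F h t 1 c j := by
  have hodd : ((1 : ℕ) : ℤ) ≠ (j + 1) * h := by
    intro h1
    have := Int.isUnit_iff.1 (IsUnit.of_mul_eq_one_right _ h1.symm)
    omega
  refine ⟨fun h1 => ex_J_one hh hc ?_, fun _ => ex_J_one hh hc (Or.inr (by omega)), fun h1 => ?_,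
    fun h1 => absurd h1 hodd, fun h1 => absurd h1 hodd, fun h1 => absurd h1 hodd⟩
  · by_contra! h2
    obtain rfl : j = 0 := by omega
    exact h1 (by push_cast; omega)
  · have hj : j = 0 := by
      have h2 : 0 < j + 1 := by
        by_contra! h2
        push_cast at h1
        nlinarith
      have h3 : j + 1 < 2 := by
        by_contra! h3
        push_cast at h1
        nlinarith
      omega
    subst hj
    have hc' : c + 1 = h := by push_cast at h1; omega
    exact cyc_one ht (by simp [jumps]) (by simp [jumps, hc'])

theorem computed_succ (hh : 2 ≤ h) {n : ℕ}
    (ih : ∀ c, 1 ≤ c → c < h → ∀ j, Computed F h t (n + 1) c j) {c : ℕ} (hc0 : 1 ≤ c) (hc : c < h)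
    (j : ℤ) : Computed F h t (n + 2) c j := by
  have ihA := ih 1 le_rfl (by omega)
  have hu := dvd_true (t := t) hh hc
  have hB_even : ∀ c, 1 ≤ c → c < h → ((n + 2 : ℕ) : ℤ) = (j + 1) * h →
      Ex (d F R) (J' F h t c (n + 1)) (2 * j) := by
    intro c hc0 hc h1
    by_cases hc' : c + 1 = h
    · exact ex_J'_of_eq hh hc' n _
    · rw [J'_eq hc']
      exact (ih (c + 1) (by omega) (by omega) j).ex_even (by push_cast at h1 ⊢; omega)
  have hB_odd : ∀ c, 1 ≤ c → c < h → ((n + 2 : ℕ) : ℤ) = (j + 1) * h →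
      Ex (d F R) (J' F h t c (n + 1)) (2 * j + 1) := by
    intro c hc0 hc h1
    by_cases hc' : c + 1 = h
    · exact ex_J'_of_eq hh hc' n _
    · rw [J'_eq hc']
      exact (ih (c + 1) (by omega) (by omega) j).ex_odd (by push_cast at h1 ⊢; omega)
  constructor
  · intro h1
    have hB : Ex (d F R) (J' F h t c (n + 1)) (2 * j) := by
      by_cases hc' : c + 1 = h
      · exact ex_J'_of_eq hh hc' n _
      · rw [J'_eq hc']
        exact (ih (c + 1) (by omega) (by omega) j).ex_even (by push_cast at h1 ⊢; omega)
    by_cases h2 : ((n + 1 : ℕ) : ℤ) = (j - 1 + 1) * h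
    · have hc' : c + 1 ≠ h := by
        rintro rfl
        apply h1
        push_cast at h2 ⊢
        linarith
      have hI := (ih (c + 1) (by omega) (by omega) (j - 1)).injective h2
      rw [← J'_eq hc', show 2 * (j - 1) + 1 + 1 = 2 * j by ring,
        show 2 * (j - 1) + 1 = 2 * j - 1 by ring] at hI
      refine ex_cone hI (fun b hb h => ?_) hu
      obtain ⟨c, hc, h'⟩ := hB b hb h
      exact ⟨0, zero_mem _, c, hc, by rw [h', zero_add]⟩
    · have hA := (ihA (j - 1)).ex_odd h2
      rw [show 2 * (j - 1) + 1 = 2 * j - 1 by ring] at hA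
      exact ex_cone_of_ex hA hB hu
  · intro h1
    have hA := (ihA j).ex_even (by push_cast at h1 ⊢; omega)
    by_cases hc' : c + 1 = h
    · exact ex_cone_of_ex (by rwa [add_sub_cancel_right]) (ex_J'_of_eq hh hc' n _) hu
    · have ihB := ih (c + 1) (by omega) (by omega) j
      refine ex_cone (fun b _ h => ?_) ?_ hu
      · rw [add_sub_cancel_right] at h
        exact hA _ h (d_d b)
      · by_cases h2 : ((n + 1 : ℕ) : ℤ) = (j + 1) * h
        · have hS := ihB.surjective h2
          rw [← J'_eq hc'] at hS
          exact hS
        · have hB := ihB.ex_odd h2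
          rw [← J'_eq hc'] at hB
          intro b hb h
          obtain ⟨c, hc, h'⟩ := hB b hb h
          exact ⟨0, zero_mem _, c, hc, by rw [h', zero_add]⟩
  · intro h1
    by_cases hc' : c + 1 = h
    · have hA := (ihA (j - 1)).cyc_odd (by
        rw [← hc'] at h1 ⊢
        push_cast at h1 ⊢
        linarith)
      rw [show 2 * (j - 1) + 1 = 2 * j - 1 by ring] at hA
      exact cyc_cone_of_ex_right hu hA (ex_J'_of_eq hh hc' n _) (ex_J'_of_eq hh hc' n _)
    · have hA := (ihA (j - 1)).ex_odd (by
        have : (j - 1 + 1) * (h : ℤ) = (j + 1) * h - h := by ring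
        rw [this]
        push_cast at h1 ⊢
        omega)
      rw [show 2 * (j - 1) + 1 = 2 * j - 1 by ring] at hA
      have hA' := (ihA j).ex_even (by push_cast at h1 ⊢; omega)
      have hB := (ih (c + 1) (by omega) (by omega) j).cyc_even (by push_cast at h1 ⊢; omega)
      rw [← J'_eq hc'] at hB
      exact cyc_cone_of_ex_left hu hA hA' hB
  · intro h1
    have hA := (ihA j).cyc_even (by push_cast at h1 ⊢; omega)
    exact cyc_cone_of_ex_right hu (by rwa [add_sub_cancel_right])
      (by rw [add_sub_cancel_right]; exact hB_even c hc0 hc h1) (hB_odd c hc0 hc h1)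
  · intro h1
    exact injective_cone (dvd_true hh (by omega)) (fun _ => rfl) (hB_odd 1 le_rfl (by omega) h1)
  · intro h1
    refine surjective_cone (dvd_true hh (by omega)) (fun _ => rfl) (fun l => pow_dvd_pow _ ?_)
      (by rw [add_sub_cancel_right]; exact hB_even 1 le_rfl (by omega) h1) (hB_odd c hc0 hc h1)
    exact jumps_mono hh (true :: l) hc0 hc

theorem computed [FaithfulSMul R F] (ht : t ≠ 0) (hh : 2 ≤ h) (n c : ℕ) (hc0 : 1 ≤ c) (hc : c < h)
    (j : ℤ) : Computed F h t (n + 1) c j := by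
  induction n generalizing c j with
  | zero => exact computed_one ht hh hc j
  | succ n ih => exact computed_succ hh ih hc0 hc j

end SingleWeight

section Product

variable {R F : Type*} [CommRing R] [Field F] [Algebra R F]

theorem cover_of_isCoprime {u v : List Bool → R} (n : ℕ) (huv : ∀ l, IsCoprime (u l) (v l))
    (hu : ∀ l₁ l₂, u (l₁ ++ false :: l₂) ∣ u (l₁ ++ true :: l₂))
    (hv : ∀ l₁ l₂, v (l₁ ++ false :: l₂) ∣ v (l₁ ++ true :: l₂)) :
    Cover (d F R) (W F (fun l => u l * v l) n) (W F u n) (W F v n) (W F (fun _ => (1 : R)) n) where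
  stable k x hx := d_mem_W hu n k x hx
  stable' k x hx := d_mem_W hv n k x hx
  le k := W_mono (fun l => dvd_mul_right _ _) n k
  le' k := W_mono (fun l => dvd_mul_left _ _) n k
  base k := W_mono (fun l => one_dvd _) n k
  base' k := W_mono (fun l => one_dvd _) n k
  inter k x hx hx' l := by
    refine ⟨(hx l).1, ?_⟩
    obtain ⟨r, hr⟩ := (hx l).2
    obtain ⟨s, hs⟩ := (hx' l).2
    obtain ⟨a, b, hab⟩ := huv l
    refine ⟨a * r + b * s, ?_⟩
    rw [← hab, map_add, map_add, map_mul, map_mul, map_mul, map_mul, ← hr, ← hs]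
    ring
  exists_add k x hx := by
    choose a b hab using huv
    have hF : ∀ l, algebraMap R F (a l) * algebraMap R F (u l) +
        algebraMap R F (b l) * algebraMap R F (v l) = 1 := fun l => by
      rw [← map_mul, ← map_mul, ← map_add, hab, map_one]
    refine ⟨fun l => algebraMap R F (b l) * algebraMap R F (v l) * x l, fun l => ?_,
      fun l => algebraMap R F (a l) * algebraMap R F (u l) * x l, fun l => ?_, funext fun l => ?_⟩
    · refine ⟨fun h => (hx l).1 (right_ne_zero_of_mul h), ?_⟩
      obtain ⟨r, hr⟩ := (hx l).2
      exact ⟨b l * r, by rw [map_mul, ← hr, map_mul]; ring⟩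
    · refine ⟨fun h => (hx l).1 (right_ne_zero_of_mul h), ?_⟩
      obtain ⟨r, hr⟩ := (hx l).2
      exact ⟨a l * r, by rw [map_mul, ← hr, map_mul]; ring⟩
    · change x l = _ * x l + _ * x l
      rw [← add_mul, add_comm, hF, one_mul]

variable {φ : ℕ → R} {s : Finset ℕ}

theorem prod_pow_jumps_dvd (hs : ∀ h ∈ s, 2 ≤ h) (l₁ l₂ : List Bool) :
    ∏ h ∈ s, φ h ^ jumps h 1 (l₁ ++ false :: l₂) ∣ ∏ h ∈ s, φ h ^ jumps h 1 (l₁ ++ true :: l₂) :=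
  Finset.prod_dvd_prod_of_dvd _ _ fun h hh =>
    pow_dvd_pow _ (jumps_append_false_le (hs h hh) l₁ l₂ (hs h hh))

theorem cover_insert {h : ℕ} (hh : h ∉ s) (hs : ∀ h' ∈ insert h s, 2 ≤ h')
    (hφ : ∀ h' ∈ s, IsCoprime (φ h) (φ h')) (n : ℕ) :
    Cover (d F R) (W F (fun l => ∏ h' ∈ insert h s, φ h' ^ jumps h' 1 l) n) (J F h (φ h) 1 n)
      (W F (fun l => ∏ h' ∈ s, φ h' ^ jumps h' 1 l) n) (W F (fun _ => (1 : R)) n) := by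
  simp only [Finset.prod_insert hh]
  have hh2 := hs h (Finset.mem_insert_self _ _)
  exact cover_of_isCoprime n
    (fun l => IsCoprime.prod_right fun h' hh' => (hφ h' hh').pow)
    (fun l₁ l₂ => pow_dvd_pow _ (jumps_append_false_le hh2 l₁ l₂ hh2))
    (prod_pow_jumps_dvd fun h' hh' => hs h' (Finset.mem_insert_of_mem hh'))

theorem ex_prod [FaithfulSMul R F] (hφ0 : ∀ h, φ h ≠ 0)
    (hφ : ∀ h h', h ≠ h' → IsCoprime (φ h) (φ h')) (hs : ∀ h ∈ s, 2 ≤ h) (n : ℕ) (j : ℤ)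
    (hj : ∀ h ∈ s, ((1 + (n + 1) : ℕ) : ℤ) ≠ (j + 1) * h) :
    Ex (d F R) (W F (fun l => ∏ h ∈ s, φ h ^ jumps h 1 l) (n + 1)) (2 * j) := by
  induction s using Finset.induction_on with
  | empty => exact ex_of_eq (fun l => by simp) _
  | insert h s hh ih =>
    have hh2 := hs h (Finset.mem_insert_self _ _)
    exact (cover_insert hh hs (fun h' hh' => hφ _ _ (by rintro rfl; exact hh hh')) (n + 1)).ex d_d
      (fun k => ex_of_eq (fun _ => rfl) k)
      ((computed (hφ0 h) hh2 n 1 le_rfl hh2 j).ex_even (hj h (Finset.mem_insert_self _ _)))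
      (ih (fun h' hh' => hs h' (Finset.mem_insert_of_mem hh'))
        fun h' hh' => hj h' (Finset.mem_insert_of_mem hh'))

theorem cyc_prod [FaithfulSMul R F] (hφ0 : ∀ h, φ h ≠ 0)
    (hφ : ∀ h h', h ≠ h' → IsCoprime (φ h) (φ h')) (hs : ∀ h ∈ s, 2 ≤ h) (n : ℕ) (j : ℤ)
    {h : ℕ} (hh : h ∈ s) (hj : ((1 + (n + 1) : ℕ) : ℤ) = (j + 1) * h) :
    Cyc (d F R) (W F (fun l => ∏ h ∈ s, φ h ^ jumps h 1 l) (n + 1)) (φ h) (2 * j) := by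
  rw [← Finset.insert_erase hh] at hs ⊢
  have hh2 := hs h (Finset.mem_insert_self _ _)
  refine (cover_insert (Finset.notMem_erase h s) hs
    (fun h' hh' => hφ _ _ (Finset.ne_of_mem_erase hh').symm) (n + 1)).cyc d_d
      (fun k => ex_of_eq (fun _ => rfl) k)
      ((computed (hφ0 h) hh2 n 1 le_rfl hh2 j).cyc_even hj)
      (ex_prod hφ0 hφ (fun h' hh' => hs h' (Finset.mem_insert_of_mem hh')) n j fun h' hh' h'' => ?_)
  have hj0 : j + 1 ≠ 0 := by
    intro h0
    rw [h0, zero_mul] at hj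
    omega
  rw [hj] at h''
  exact Finset.ne_of_mem_erase hh' (by exact_mod_cast (mul_left_cancel₀ hj0 h'').symm)

end Product

end SimplexCochain

section

open BraidIdentities

namespace SimplexCochain

section Faces

/-- The set of vertices of a face; the head of the list belongs to the last vertex. -/
def face : List Bool → Finset ℕ
  | [] => ∅
  | false :: l => face l
  | true :: l => insert l.length (face l)

/-- The face of the simplex on `0, …, n - 1` spanned by the vertices in `Γ`. -/
def faceList (Γ : Finset ℕ) : ℕ → List Bool
  | 0 => []
  | n + 1 => decide (n ∈ Γ) :: faceList Γ n

theorem lt_of_mem_face {l : List Bool} {i : ℕ} (h : i ∈ face l) : i < l.length := by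
  induction l with
  | nil => simp [face] at h
  | cons b l ih =>
    rw [List.length_cons]
    cases b
    · exact (ih h).trans (Nat.lt_succ_self _)
    · rcases Finset.mem_insert.1 h with rfl | h
      · exact Nat.lt_succ_self _
      · exact (ih h).trans (Nat.lt_succ_self _)

theorem length_notMem_face (l : List Bool) : l.length ∉ face l := fun h =>
  lt_irrefl _ (lt_of_mem_face h)

theorem face_subset (l : List Bool) : face l ⊆ Finset.range l.length := fun _ h =>
  Finset.mem_range.2 (lt_of_mem_face h)

theorem card_face (l : List Bool) : (face l).card + l.count false = l.length := by
  induction l with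
  | nil => rfl
  | cons b l ih =>
    cases b
    · simp [face]
      omega
    · simp [face, Finset.card_insert_of_notMem (length_notMem_face l)]
      omega

theorem length_faceList (Γ : Finset ℕ) (n : ℕ) : (faceList Γ n).length = n := by
  induction n with
  | zero => rfl
  | succ n ih => simp [faceList, ih]

theorem mem_face_faceList (Γ : Finset ℕ) (n i : ℕ) : i ∈ face (faceList Γ n) ↔ i ∈ Γ ∧ i < n := by
  induction n with
  | zero => simp [faceList, face]
  | succ n ih =>
    rw [faceList]
    by_cases h : n ∈ Γ
    · rw [decide_eq_true h, face, Finset.mem_insert, ih, length_faceList]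
      constructor
      · rintro (rfl | h')
        · exact ⟨h, Nat.lt_succ_self _⟩
        · exact ⟨h'.1, h'.2.trans (Nat.lt_succ_self _)⟩
      · rintro ⟨h1, h2⟩
        rcases (Nat.lt_succ_iff.1 h2).lt_or_eq with h3 | h3
        · exact Or.inr ⟨h1, h3⟩
        · exact Or.inl h3
    · rw [decide_eq_false h, face, ih]
      constructor
      · rintro ⟨h1, h2⟩
        exact ⟨h1, by omega⟩
      · rintro ⟨h1, h2⟩
        exact ⟨h1, lt_of_le_of_ne (Nat.lt_succ_iff.1 h2) (by rintro rfl; exact h h1)⟩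

theorem face_faceList {Γ : Finset ℕ} {n : ℕ} (h : Γ ⊆ Finset.range n) :
    face (faceList Γ n) = Γ := by
  ext i
  rw [mem_face_faceList]
  exact ⟨fun h => h.1, fun h' => ⟨h', Finset.mem_range.1 (h h')⟩⟩

theorem faceList_congr {Γ Γ' : Finset ℕ} {n : ℕ} (h : ∀ i < n, i ∈ Γ ↔ i ∈ Γ') :
    faceList Γ n = faceList Γ' n := by
  induction n with
  | zero => rfl
  | succ n ih =>
    rw [faceList, faceList, ih fun i hi => h i (by omega)]
    simp only [h n (Nat.lt_succ_self n)]

theorem faceList_face (l : List Bool) : faceList (face l) l.length = l := by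
  induction l with
  | nil => rfl
  | cons b l ih =>
    rw [List.length_cons, faceList]
    cases b
    · rw [show face (false :: l) = face l from rfl, ih, decide_eq_false (length_notMem_face l)]
    · rw [face, decide_eq_true (Finset.mem_insert_self _ _)]
      conv_rhs => rw [← ih]
      rw [faceList_congr fun i hi => ?_]
      simp [hi.ne]

theorem coboundary_face {F : Type*} [Field F] (G : Finset ℕ → F) (l : List Bool) :
    coboundary (fun l => G (face l)) l =
      ∑ s ∈ face l, incSign ((face l).erase s) s • G ((face l).erase s) := by
  induction l generalizing G with
  | nil => rfl
  | cons b l ih =>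
    cases b
    · exact ih G
    · have h1 : coboundary (fun l => G (face (true :: l))) l =
          coboundary (fun l' => G (insert l.length (face l'))) l :=
        coboundary_congr fun l' hl' => by rw [face, hl']
      have hl := length_notMem_face l
      rw [coboundary, h1, ih fun Γ => G (insert l.length Γ), face, face, Finset.sum_insert hl,
        Finset.erase_insert hl, incSign_of_forall_le fun i hi => (lt_of_mem_face hi).le, one_smul,
        sub_eq_add_neg, ← Finset.sum_neg_distrib]
      congr 1
      refine Finset.sum_congr rfl fun s hs => ?_
      have hs' := lt_of_mem_face hs
      rw [Finset.erase_insert_of_ne hs'.ne', incSign_insert_of_lt (by simp [hl]) hs', neg_smul]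

end Faces

section Weight

variable {k : Type} [CommRing k]

theorem isBraidSeq_constOn (q : k) (Γ : Finset ℕ) :
    IsBraidSeq (constOn q Γ) where
  braid i := by
    simp only [constOn]
    split_ifs <;> ring
  comm _ := Commute.all _ _

theorem shuffleSum_mul_permSum (q : k) (n : ℕ) {Γ : Finset ℕ} {s : ℕ} :
    shuffleSum (constOn q Γ) n (s + 1) * permSum (constOn q (Γ.erase s)) n =
      permSum (constOn q Γ) n :=
  (permSum_eq_shuffleSum_mul (isBraidSeq_constOn q Γ) (by simp [constOn])
    (fun i hi => by simp [constOn, hi]) n).symm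

end Weight

section Bridge

variable {k F : Type} [CommRing k] [Field F] [Algebra k F]

variable (F) in
/-- The cochain of the simplex obtained from a cochain of the Salvetti complex by division by the
weights. -/
noncomputable def ofTwisted (n : ℕ) (q : k) (f : Finset ℕ → k) (l : List Bool) : F :=
  if l.length = n then algebraMap k F (f (face l)) / algebraMap k F (permSum (constOn q (face l)) n)
  else 0

variable {n : ℕ} {q : k} {u : List Bool → k}

theorem ofTwisted_smul_add (r : k) (f g : Finset ℕ → k) :
    ofTwisted F n q (fun Γ => r * f Γ + g Γ) = r • ofTwisted F n q f + ofTwisted F n q g := by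
  funext l
  simp only [ofTwisted, Pi.add_apply, Pi.smul_apply]
  split_ifs
  · rw [Algebra.smul_def, map_add, map_mul]
    ring
  · simp

theorem ofTwisted_eq_iff [FaithfulSMul k F]
    (hw : ∀ Γ ⊆ Finset.range n, permSum (constOn q Γ) n ≠ 0) {f g : Finset ℕ → k} :
    ofTwisted F n q f = ofTwisted F n q g ↔ ∀ Γ ⊆ Finset.range n, f Γ = g Γ := by
  have hinj := FaithfulSMul.algebraMap_injective k F
  constructor
  · intro h Γ hΓ
    have h1 := congrFun h (faceList Γ n)
    simp only [ofTwisted, length_faceList, if_true, face_faceList hΓ] at h1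
    exact hinj ((div_left_inj' fun h => hw Γ hΓ (hinj (by rw [h, map_zero]))).1 h1)
  · intro h
    funext l
    simp only [ofTwisted]
    split_ifs with hl
    · rw [h _ (hl ▸ face_subset l)]
    · rfl

theorem d_ofTwisted [FaithfulSMul k F]
    (hw : ∀ Γ ⊆ Finset.range n, permSum (constOn q Γ) n ≠ 0) (f : Finset ℕ → k) :
    d F k (ofTwisted F n q f) = ofTwisted F n q (twistedDelta n q f) := by
  have hinj := FaithfulSMul.algebraMap_injective k F
  have hw' : ∀ Γ ⊆ Finset.range n, algebraMap k F (permSum (constOn q Γ) n) ≠ 0 :=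
    fun Γ hΓ h => hw Γ hΓ (hinj (by rw [h, map_zero]))
  funext l
  change coboundary _ l = _
  by_cases hl : l.length = n
  · have h0 : coboundary (ofTwisted F n q f) l = _ :=
      coboundary_congr fun l' hl' => if_pos (hl'.trans hl)
    rw [h0, coboundary_face fun Γ => algebraMap k F (f Γ) / algebraMap k F (permSum (constOn q Γ) n)]
    simp only [ofTwisted, if_pos hl, twistedDelta, map_sum, Finset.sum_div]
    refine Finset.sum_congr rfl fun s _ => ?_
    have hΓ : face l ⊆ Finset.range n := hl ▸ face_subset l
    have h1 := hw' _ hΓ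
    rw [← shuffleSum_mul_permSum (s := s), map_mul] at h1
    rw [map_zsmul, smul_div_assoc, ← shuffleSum_mul_permSum (Γ := face l) (s := s), map_mul, map_mul,
      mul_div_mul_left _ _ (left_ne_zero_of_mul h1)]
  · rw [coboundary_congr (y := 0) fun l' hl' => by
      simp only [ofTwisted, hl', if_neg hl, Pi.zero_apply], ofTwisted, if_neg hl]
    exact congrFun (map_zero (d F k)) l

theorem ofTwisted_mem [FaithfulSMul k F]
    (hw : ∀ Γ ⊆ Finset.range n, permSum (constOn q Γ) n ≠ 0)
    (hu : ∀ l, l.length = n → u l = permSum (constOn q (face l)) n) {f : Finset ℕ → k} {j : ℤ}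
    (hf : ∀ Γ, (Γ.card : ℤ) + j ≠ n → f Γ = 0) : ofTwisted F n q f ∈ W F u n j := by
  have hinj := FaithfulSMul.algebraMap_injective k F
  intro l
  by_cases hl : l.length = n
  · refine ⟨fun h => ⟨hl, ?_⟩, f (face l), ?_⟩
    · by_contra h0
      apply h
      have := card_face l
      rw [ofTwisted, if_pos hl, hf _ (by omega), map_zero, zero_div]
    · rw [ofTwisted, if_pos hl, hu l hl, mul_div_cancel₀]
      exact fun h => hw _ (hl ▸ face_subset l) (hinj (by rw [h, map_zero]))
  · have h0 : ofTwisted F n q f l = 0 := if_neg hl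
    exact ⟨fun h => absurd h0 h, 0, by rw [h0, mul_zero, map_zero]⟩

theorem exists_ofTwisted_eq [FaithfulSMul k F]
    (hw : ∀ Γ ⊆ Finset.range n, permSum (constOn q Γ) n ≠ 0)
    (hu : ∀ l, l.length = n → u l = permSum (constOn q (face l)) n) {x : List Bool → F} {j : ℤ}
    (hx : x ∈ W F u n j) : ∃ f : Finset ℕ → k, (∀ Γ, (Γ.card : ℤ) + j ≠ n → f Γ = 0) ∧
      ofTwisted F n q f = x := by
  classical
  have hinj := FaithfulSMul.algebraMap_injective k F
  choose hx1 r hr using hx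
  refine ⟨fun Γ => if Γ ⊆ Finset.range n then r (faceList Γ n) else 0, fun Γ hΓ => ?_,
    funext fun l => ?_⟩
  · dsimp only
    split_ifs with h
    · apply hinj
      rw [← hr, map_zero]
      suffices x (faceList Γ n) = 0 by rw [this, mul_zero]
      by_contra h0
      have h1 := (hx1 _ h0).2
      have h2 := card_face (faceList Γ n)
      rw [face_faceList h, length_faceList] at h2
      omega
    · rfl
  · by_cases hl : l.length = n
    · have hΓ : face l ⊆ Finset.range n := hl ▸ face_subset l
      have h1 := hr l
      rw [hu l hl] at h1
      rw [ofTwisted, if_pos hl, if_pos hΓ, show faceList (face l) n = l by rw [← hl, faceList_face],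
        ← h1, mul_div_cancel_left₀]
      exact fun h => hw _ hΓ (hinj (by rw [h, map_zero]))
    · rw [ofTwisted, if_neg hl]
      by_contra h0
      exact hl (hx1 l (Ne.symm h0)).1

theorem nonempty_groupCohomology_equiv_of_cyc [FaithfulSMul k F]
    (ρ : Representation k (BraidGroup (n + 1)) k)
    (hρ : ∀ s : Fin n, ρ (braidGen (n + 1) s) 1 = -q)
    (hw : ∀ Γ ⊆ Finset.range n, permSum (constOn q Γ) n ≠ 0)
    (hu : ∀ l, l.length = n → u l = permSum (constOn q (face l)) n) {m j : ℕ} (hm : m + j = n)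
    {t : k} (h : Cyc (d F k) (W F u n) t j) :
    Nonempty (groupCohomology (Rep.of ρ) m ≃ₗ[k] k ⧸ Ideal.span {t}) := by
  obtain ⟨z, hz, hz', hc, ht⟩ := h
  obtain ⟨z, hz1, rfl⟩ := exists_ofTwisted_eq hw hu hz
  have h0 : ofTwisted F n q 0 = 0 := by
    funext l
    simp [ofTwisted]
  have hδ : ∀ f : Finset ℕ → k, d F k (ofTwisted F n q f) = 0 ↔
      ∀ Γ ⊆ Finset.range n, twistedDelta n q f Γ = 0 := fun f => by
    rw [d_ofTwisted hw, ← h0, ofTwisted_eq_iff hw]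
    rfl
  refine nonempty_groupCohomology_equiv ρ q hρ m t z ((hδ z).1 hz')
    (fun Γ hΓ => hz1 Γ (by omega)) (fun x hx hx' => ?_) fun r => ?_
  · obtain ⟨r, y, hy, h⟩ := hc (ofTwisted F n q x)
      (ofTwisted_mem hw hu fun Γ hΓ => hx Γ (by omega)) ((hδ x).2 hx')
    obtain ⟨y, hy1, rfl⟩ := exists_ofTwisted_eq hw hu hy
    rw [d_ofTwisted hw, ← ofTwisted_smul_add, ofTwisted_eq_iff hw] at h
    exact ⟨r, y, fun Γ hΓ => hy1 Γ (by omega), h⟩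
  · have h1 : r • ofTwisted F n q z = ofTwisted F n q fun Γ => r * z Γ := by
      have := ofTwisted_smul_add (F := F) (n := n) (q := q) r z 0
      simpa [h0] using this.symm
    rw [← ht, h1]
    constructor
    · rintro ⟨y, hy, hy'⟩
      exact ⟨ofTwisted F n q y, ofTwisted_mem hw hu fun Γ hΓ => hy Γ (by omega), by
        rwa [d_ofTwisted hw, ofTwisted_eq_iff hw]⟩
    · rintro ⟨y, hy, hy'⟩
      obtain ⟨y, hy1, rfl⟩ := exists_ofTwisted_eq hw hu hy
      rw [d_ofTwisted hw, ofTwisted_eq_iff hw] at hy'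
      exact ⟨y, fun Γ hΓ => hy1 Γ (by omega), hy'⟩

end Bridge

end SimplexCochain

end

section

open BraidIdentities Polynomial

namespace SimplexCochain

section Runs

/-- One plus the number of leading `true`s. -/
def headRun : List Bool → ℕ
  | [] => 1
  | false :: _ => 1
  | true :: l => headRun l + 1

theorem headRun_pos (l : List Bool) : 0 < headRun l := by
  cases l with
  | nil => exact Nat.one_pos
  | cons b l => cases b <;> exact Nat.succ_pos _

theorem headRun_le (l : List Bool) : headRun l ≤ l.length + 1 := by
  induction l with
  | nil => exact le_rfl
  | cons b l ih =>
    cases b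
    · exact Nat.succ_le_succ (Nat.zero_le _)
    · exact Nat.succ_le_succ ih

/-- The number of suffixes whose head run is divisible by `h`. -/
def runCount (h : ℕ) : List Bool → ℕ
  | [] => 0
  | b :: l => runCount h l + if h ∣ headRun (b :: l) then 1 else 0

theorem runCount_false {h : ℕ} (hh : 2 ≤ h) (l : List Bool) :
    runCount h (false :: l) = runCount h l := by
  have : ¬ h ∣ headRun (false :: l) := fun h2 => by
    have := Nat.le_of_dvd Nat.one_pos h2
    omega
  rw [runCount, if_neg this, add_zero]

theorem runCount_true (h : ℕ) (l : List Bool) :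
    runCount h (true :: l) = runCount h l + if h ∣ headRun l + 1 then 1 else 0 := rfl

theorem jumps_add {h : ℕ} (hh : 2 ≤ h) (l : List Bool) {c : ℕ} (hc : c < h) :
    jumps h c l + headRun l / h = runCount h l + (headRun l + c - 1) / h := by
  induction l generalizing c with
  | nil =>
    simp only [jumps, headRun, runCount]
    rw [Nat.div_eq_of_lt (by omega), Nat.div_eq_of_lt (by omega)]
  | cons b l ih =>
    cases b
    · have h1 := ih (c := 1) (by omega)
      rw [Nat.add_sub_cancel] at h1
      simp only [jumps, headRun, runCount_false hh]
      rw [Nat.div_eq_of_lt (by omega), Nat.div_eq_of_lt (by omega)]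
      omega
    · have hp := headRun_pos l
      simp only [jumps, headRun, runCount_true]
      rw [Nat.succ_div, ← add_assoc, add_right_comm (runCount h l)]
      congr 1
      split_ifs with h1
      · have h3 := ih (c := 0) (by omega)
        have h5 : (headRun l + 1 + c - 1) / h = (headRun l + 0 - 1) / h + 1 := by
          rw [← Nat.add_div_right _ (by omega)]
          congr 1
          omega
        omega
      · have h4 := ih (c := c + 1) (by omega)
        rwa [show headRun l + (c + 1) - 1 = headRun l + 1 + c - 1 by omega] at h4

theorem jumps_one_eq {h : ℕ} (hh : 2 ≤ h) (l : List Bool) : jumps h 1 l = runCount h l := by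
  have := jumps_add hh l (c := 1) (by omega)
  rw [Nat.add_sub_cancel] at this
  omega

theorem permSum_congr {S : Type*} [Ring S] {x y : ℕ → S} {j : ℕ} (h : ∀ i < j, x i = y i) :
    permSum x j = permSum y j := by
  induction j with
  | zero => rfl
  | succ j ih => rw [permSum, permSum, ih fun i hi => h i (by omega), ascSum_congr h]

variable {k : Type} [CommRing k]

theorem constOn_face_cons (q : k) (b : Bool) (l : List Bool) :
    ∀ i < l.length, constOn q (face (b :: l)) i = constOn q (face l) i := by
  intro i hi
  cases b
  · rfl
  · simp [constOn, face, hi.ne]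

theorem ascSum_face (q : k) (l : List Bool) :
    ascSum (constOn q (face l)) 0 l.length = ∑ i ∈ Finset.range (headRun l), q ^ i := by
  induction l with
  | nil => simp [ascSum, headRun]
  | cons b l ih =>
    rw [List.length_cons, ascSum_succ _ (Nat.zero_le _), ascSum_congr (constOn_face_cons q b l), ih]
    cases b
    · simp [constOn, face, headRun, length_notMem_face]
    · rw [headRun, geom_sum_succ]
      simp [constOn, face]
      ring

theorem geom_sum_eq_prod_cyclotomic {m N : ℕ} (hm : 0 < m) (hN : m ≤ N) :
    ∑ i ∈ Finset.range m, (LaurentPolynomial.T 1 : LaurentPolynomial ℚ) ^ i =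
      ∏ h ∈ Finset.Icc 2 N, ((cyclotomic h ℚ).toLaurent : LaurentPolynomial ℚ) ^
        (if h ∣ m then 1 else 0) := by
  have h1 := congrArg toLaurent (prod_cyclotomic_eq_geom_sum hm ℚ)
  rw [map_prod, map_sum] at h1
  simp only [map_pow, toLaurent_X] at h1
  rw [← h1]
  simp only [pow_ite, pow_one, pow_zero]
  rw [← Finset.prod_filter]
  refine Finset.prod_congr ?_ fun _ _ => rfl
  ext h
  simp only [Finset.mem_erase, Nat.mem_divisors, Finset.mem_filter, Finset.mem_Icc]
  constructor
  · rintro ⟨h2, h3, h4⟩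
    have := Nat.le_of_dvd hm h3
    have := Nat.pos_of_dvd_of_pos h3 hm
    exact ⟨⟨by omega, by omega⟩, h3⟩
  · rintro ⟨⟨h2, h3⟩, h4⟩
    exact ⟨by omega, h4, by omega⟩

theorem permSum_face {N : ℕ} (l : List Bool) (hl : l.length + 1 ≤ N) :
    permSum (constOn (LaurentPolynomial.T 1 : LaurentPolynomial ℚ) (face l)) l.length =
      ∏ h ∈ Finset.Icc 2 N, ((cyclotomic h ℚ).toLaurent : LaurentPolynomial ℚ) ^ jumps h 1 l := by
  have h0 : ∏ h ∈ Finset.Icc 2 N, ((cyclotomic h ℚ).toLaurent : LaurentPolynomial ℚ) ^ jumps h 1 l =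
      ∏ h ∈ Finset.Icc 2 N, ((cyclotomic h ℚ).toLaurent : LaurentPolynomial ℚ) ^ runCount h l :=
    Finset.prod_congr rfl fun h hh => by rw [jumps_one_eq (Finset.mem_Icc.1 hh).1]
  rw [h0]
  clear h0
  induction l with
  | nil => simp [permSum, runCount]
  | cons b l ih =>
    have h1 := ascSum_face (LaurentPolynomial.T 1 : LaurentPolynomial ℚ) (b :: l)
    have h2 := headRun_le (b :: l)
    rw [List.length_cons] at hl h1 h2 ⊢
    rw [permSum, h1, permSum_congr (constOn_face_cons _ b l), ih (by omega),
      geom_sum_eq_prod_cyclotomic (N := N) (headRun_pos _) (by omega), ← Finset.prod_mul_distrib]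
    exact Finset.prod_congr rfl fun h _ => by rw [runCount, pow_add, mul_comm]

theorem isCoprime_toLaurent_cyclotomic (h h' : ℕ) (hne : h ≠ h') :
    IsCoprime ((cyclotomic h ℚ).toLaurent : LaurentPolynomial ℚ) (cyclotomic h' ℚ).toLaurent :=
  (cyclotomic.isCoprime_rat hne).map toLaurent

theorem toLaurent_cyclotomic_ne_zero (h : ℕ) :
    ((cyclotomic h ℚ).toLaurent : LaurentPolynomial ℚ) ≠ 0 :=
  (map_ne_zero_iff _ toLaurent_injective).2 (cyclotomic_ne_zero h ℚ)

theorem permSum_constOn_ne_zero {n : ℕ} {Γ : Finset ℕ} (hΓ : Γ ⊆ Finset.range n) :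
    permSum (constOn (LaurentPolynomial.T 1 : LaurentPolynomial ℚ) Γ) n ≠ 0 := by
  have h1 := permSum_face (faceList Γ n) le_rfl
  rw [face_faceList hΓ, length_faceList] at h1
  rw [h1]
  exact Finset.prod_ne_zero_iff.2 fun h _ => pow_ne_zero _ (toLaurent_cyclotomic_ne_zero h)

theorem cyc_of_ex {R V : Type*} [CommRing R] [AddCommGroup V] [Module R V] {δ : V →ₗ[R] V}
    {K : ℤ → Submodule R V} {i : ℤ} (h : Ex δ K i) : Cyc δ K 1 i := by
  refine ⟨0, zero_mem _, map_zero δ, fun x hx hx' => ?_, fun r =>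
    iff_of_true ⟨0, zero_mem _, by rw [map_zero, smul_zero]⟩ (one_dvd r)⟩
  obtain ⟨y, hy, h'⟩ := h x hx hx'
  exact ⟨0, y, hy, by rw [h', smul_zero, zero_add]⟩

end Runs

end SimplexCochain

section Main

open SimplexCochain

variable {N j : ℕ}
  (ρ : Representation (LaurentPolynomial ℚ) (BraidGroup (N + 1 + 1)) (LaurentPolynomial ℚ))

theorem braid_cohomology_equiv_of_cyc (hd : 2 * j ≤ N + 1)
    (hρ : ∀ (s : Fin (N + 1)) (x : LaurentPolynomial ℚ),
      (ρ (braidGen (N + 1 + 1) s)) x = -(LaurentPolynomial.T 1) * x) {t : LaurentPolynomial ℚ}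
    (h : Cyc (d (FractionRing (LaurentPolynomial ℚ)) (LaurentPolynomial ℚ))
      (W (FractionRing (LaurentPolynomial ℚ)) (fun l => ∏ h ∈ Finset.Icc 2 (N + 1 + 1),
        ((cyclotomic h ℚ).toLaurent : LaurentPolynomial ℚ) ^ jumps h 1 l) (N + 1)) t (2 * j)) :
    Nonempty ((groupCohomology (Rep.of ρ) (N + 1 - 2 * j)) ≃ₗ[LaurentPolynomial ℚ]
      (LaurentPolynomial ℚ ⧸ Ideal.span {t})) := by
  refine nonempty_groupCohomology_equiv_of_cyc (q := LaurentPolynomial.T 1) ρ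
    (fun s => by rw [hρ, mul_one])
    (fun Γ hΓ => permSum_constOn_ne_zero hΓ) (fun l hl => ?_) (j := 2 * j) (by omega)
    (by push_cast; exact h)
  rw [← permSum_face l (by omega), hl]

theorem braid_cohomology_of_eq_mul (hN : 1 ≤ N) (hd : 2 * j ≤ N + 1)
    (hρ : ∀ (s : Fin (N + 1)) (x : LaurentPolynomial ℚ),
      (ρ (braidGen (N + 1 + 1) s)) x = -(LaurentPolynomial.T 1) * x) {h : ℕ}
    (hh : N + 1 + 1 = (j + 1) * h) :
    Nonempty ((groupCohomology (Rep.of ρ) (N + 1 - 2 * j)) ≃ₗ[LaurentPolynomial ℚ]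
        (LaurentPolynomial ℚ ⧸
          Ideal.span {((cyclotomic h ℚ).toLaurent : LaurentPolynomial ℚ)})) := by
  have hh2 : 2 ≤ h := by
    by_contra! h2
    interval_cases h <;> omega
  refine braid_cohomology_equiv_of_cyc ρ hd hρ (cyc_prod toLaurent_cyclotomic_ne_zero
    isCoprime_toLaurent_cyclotomic (fun _ h' => (Finset.mem_Icc.1 h').1) N j
    (Finset.mem_Icc.2 ⟨hh2, Nat.le_of_dvd (Nat.succ_pos _) ⟨j + 1, by rw [hh, mul_comm]⟩⟩) ?_)
  rw [add_comm 1, hh]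
  push_cast
  rfl

theorem braid_cohomology_of_not_dvd (hd : 2 * j ≤ N + 1)
    (hρ : ∀ (s : Fin (N + 1)) (x : LaurentPolynomial ℚ),
      (ρ (braidGen (N + 1 + 1) s)) x = -(LaurentPolynomial.T 1) * x)
    (h : ¬ (j + 1) ∣ N + 1 + 1) :
    Subsingleton (groupCohomology (Rep.of ρ) (N + 1 - 2 * j)) := by
  obtain ⟨e⟩ := braid_cohomology_equiv_of_cyc ρ hd hρ (cyc_of_ex
    (ex_prod toLaurent_cyclotomic_ne_zero isCoprime_toLaurent_cyclotomic
      (fun _ h' => (Finset.mem_Icc.1 h').1) N j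
      fun h' _ h'' => h ⟨h', by rw [add_comm (N + 1)]; exact_mod_cast h''⟩))
  have : Subsingleton (LaurentPolynomial ℚ ⧸ Ideal.span {(1 : LaurentPolynomial ℚ)}) :=
    Ideal.Quotient.subsingleton_iff.2 Ideal.span_singleton_one
  exact e.toEquiv.subsingleton

end Main

end

theorem braid_cohomology_even_complementary_degree
    (n i : ℕ) (hn : 2 ≤ n) (hi : 1 ≤ i) (hd : 2 * (i - 1) ≤ n)
    (ρ : Representation (LaurentPolynomial ℚ) (BraidGroup (n + 1)) (LaurentPolynomial ℚ))
    (hρ : ∀ (s : Fin n) (x : LaurentPolynomial ℚ),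
      (ρ (braidGen (n + 1) s)) x = -(LaurentPolynomial.T 1) * x) :
    (∀ h : ℕ, n + 1 = i * h →
      Nonempty ((groupCohomology (Rep.of ρ) (n - 2 * (i - 1))) ≃ₗ[LaurentPolynomial ℚ]
        (LaurentPolynomial ℚ ⧸
          Ideal.span {((cyclotomic h ℚ).toLaurent : LaurentPolynomial ℚ)}))) ∧
    (¬ (i ∣ n + 1) →
      Subsingleton (groupCohomology (Rep.of ρ) (n - 2 * (i - 1)))) ∧
    Nonempty ((groupCohomology (Rep.of ρ) n) ≃ₗ[LaurentPolynomial ℚ]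
      (LaurentPolynomial ℚ ⧸
        Ideal.span {((cyclotomic (n + 1) ℚ).toLaurent : LaurentPolynomial ℚ)})) := by
  obtain ⟨N, rfl⟩ : ∃ N, n = N + 1 := ⟨n - 1, by omega⟩
  obtain ⟨j, rfl⟩ : ∃ j, i = j + 1 := ⟨i - 1, by omega⟩
  exact ⟨fun h hh => braid_cohomology_of_eq_mul ρ (by omega) hd hρ hh,
    braid_cohomology_of_not_dvd ρ hd hρ,
    braid_cohomology_of_eq_mul (j := 0) ρ (by omega) (Nat.zero_le _) hρ (by omega)⟩
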